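/- arXiv:2104.13683 — 4 statements merged into one kernel-verified Lean document; each statement's English description precedes it below -/
import Mathlib

section
/- Let Z be a connected, non-compact surface (a two-dimensional topological manifold, possibly with boundary). Then for every point z ∈ Z the fundamental group π₁(Z, z) is a free group. -/
namespace LocalCocycle

open Set Filter Topology CategoryTheory unitInterval

/-! ### Group-valued cocycles near the diagonal -/

/-- `c` satisfies the (multiplicative) cocycle identity on triples of points of `O`. -/
def IsCocycleOn {X G : Type*} [Group G] (c : X → X → G) (O : Set X) : Prop :=
  ∀ x ∈ O, ∀ y ∈ O, ∀ w ∈ O, c x y * c y w = c x w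

section Cocycle

variable {X G : Type*} [Group G] {c : X → X → G} {O O' : Set X}

theorem IsCocycleOn.mono (h : IsCocycleOn c O) (hO : O' ⊆ O) : IsCocycleOn c O' :=
  fun x hx y hy w hw => h x (hO hx) y (hO hy) w (hO hw)

theorem IsCocycleOn.self (h : IsCocycleOn c O) {x : X} (hx : x ∈ O) : c x x = 1 := by
  simpa using h x hx x hx x hx

theorem IsCocycleOn.inv_mul (h : IsCocycleOn c O) {x y w : X} (hx : x ∈ O) (hy : y ∈ O)
    (hw : w ∈ O) : (c x y)⁻¹ * c x w = c y w := by
  rw [← h x hx y hy w hw, inv_mul_cancel_left]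

theorem IsCocycleOn.inv (h : IsCocycleOn c O) {x y : X} (hx : x ∈ O) (hy : y ∈ O) :
    (c x y)⁻¹ = c y x := by
  simpa [h.self hx] using h.inv_mul hx hy hx

end Cocycle

/-! ### Holonomy along paths -/

/-- `f` is a primitive of the pullback of `s` along `γ`, locally on the unit interval. -/
def Trivializes {X E : Type*} [Group E] (s : X → X → E) (γ : I → X) (f : I → E) : Prop :=
  ∀ t, ∃ O ∈ 𝓝 t, ∀ u ∈ O, ∀ v ∈ O, (f u)⁻¹ * f v = s (γ u) (γ v)

section Holonomy

variable {X E : Type*} [Group E] {s : X → X → E} {γ : I → X} {f f' : I → E}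

theorem Trivializes.endpoints_eq (h : Trivializes s γ f) (h' : Trivializes s γ f') :
    (f 0)⁻¹ * f 1 = (f' 0)⁻¹ * f' 1 := by
  have hc : IsLocallyConstant fun t => f t * (f' t)⁻¹ := by
    rw [IsLocallyConstant.iff_eventually_eq]
    intro t
    obtain ⟨O, hO, h1⟩ := h t
    obtain ⟨O', hO', h2⟩ := h' t
    filter_upwards [hO, hO'] with u hu hu'
    have e : (f t)⁻¹ * f u = (f' t)⁻¹ * f' u := by
      rw [h1 t (mem_of_mem_nhds hO) u hu, h2 t (mem_of_mem_nhds hO') u hu']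
    have e2 : f u = f t * ((f' t)⁻¹ * f' u) := by rw [← e, mul_inv_cancel_left]
    rw [e2]; group
  have e : f 0 * (f' 0)⁻¹ = f 1 * (f' 1)⁻¹ := hc.apply_eq_of_preconnectedSpace 0 1
  have e2 : f 1 = f 0 * (f' 0)⁻¹ * f' 1 := by rw [e, inv_mul_cancel_right]
  rw [e2]; group

theorem Trivializes.comp (h : Trivializes s γ f) {φ : I → I} (hφ : Continuous φ) :
    Trivializes s (γ ∘ φ) (f ∘ φ) := by
  intro t
  obtain ⟨O, hO, h1⟩ := h (φ t)
  exact ⟨φ ⁻¹' O, hφ.continuousAt.preimage_mem_nhds hO, fun u hu v hv => h1 _ hu _ hv⟩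

variable [TopologicalSpace X]

theorem exists_trivializes (hs : ∀ p, ∃ O ∈ 𝓝 p, IsCocycleOn s O) (hγ : Continuous γ) :
    ∃ f, Trivializes s γ f := by
  classical
  choose O hO hsO using hs
  obtain ⟨t, t0, tmono, ⟨N, hN⟩, ht⟩ := exists_monotone_Icc_subset_open_cover_unitInterval
    (c := fun p : X => γ ⁻¹' interior (O p)) (fun p => isOpen_interior.preimage hγ)
    (fun u _ => mem_iUnion.2 ⟨γ u, mem_interior_iff_mem_nhds.2 (hO _)⟩)
  have key : ∀ n, ∃ f : I → E, ∀ a ≤ t n, ∃ O ∈ 𝓝 a, ∀ u ∈ O, ∀ v ∈ O, u ≤ t n → v ≤ t n →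
      (f u)⁻¹ * f v = s (γ u) (γ v) := by
    intro n
    induction n with
    | zero =>
      refine ⟨fun _ => 1, fun a _ => ⟨univ, univ_mem, fun u _ v _ hu hv => ?_⟩⟩
      rw [t0] at hu hv
      have hu : u = 0 := le_antisymm hu u.2.1
      have hv : v = 0 := le_antisymm hv v.2.1
      rw [hu, hv, (hsO (γ 0)).self (mem_of_mem_nhds (hO _))]
      simp
    | succ n ih =>
      obtain ⟨f, hf⟩ := ih
      obtain ⟨i, hi⟩ := ht n
      have hcoc : IsCocycleOn s (interior (O i)) := (hsO i).mono interior_subset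
      set τ := t n
      have hτ : γ τ ∈ interior (O i) := hi ⟨le_rfl, tmono n.le_succ⟩
      refine ⟨fun u => if u ≤ τ then f u else f τ * s (γ τ) (γ u), fun a ha => ?_⟩
      rcases lt_or_ge a τ with haτ | haτ
      · obtain ⟨W, hW, hfW⟩ := hf a haτ.le
        refine ⟨W ∩ Iio τ, inter_mem hW (Iio_mem_nhds haτ), fun u hu v hv _ _ => ?_⟩
        have h1 : u ≤ τ := le_of_lt hu.2
        have h2 : v ≤ τ := le_of_lt hv.2
        simp only [h1, h2, if_true]
        exact hfW u hu.1 v hv.1 h1 h2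
      · have hai : γ ⁻¹' interior (O i) ∈ 𝓝 a :=
          (isOpen_interior.preimage hγ).mem_nhds (hi ⟨haτ, ha⟩)
        obtain ⟨W, hW, hfW⟩ : ∃ W ∈ 𝓝 a, ∀ u ∈ W, u ≤ τ → f u = f τ * s (γ τ) (γ u) := by
          rcases haτ.eq_or_lt with rfl | hlt
          · obtain ⟨W, hW, hfW⟩ := hf τ le_rfl
            refine ⟨W, hW, fun u hu huτ => ?_⟩
            rw [← hfW τ (mem_of_mem_nhds hW) u hu le_rfl huτ, mul_inv_cancel_left]
          · exact ⟨Ioi τ, Ioi_mem_nhds hlt, fun u hu huτ => absurd hu (not_lt.2 huτ)⟩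
        have hform : ∀ u ∈ W, (if u ≤ τ then f u else f τ * s (γ τ) (γ u)) =
            f τ * s (γ τ) (γ u) := by
          intro u hu
          split_ifs with h
          · exact hfW u hu h
          · rfl
        refine ⟨W ∩ γ ⁻¹' interior (O i), inter_mem hW hai, fun u hu v hv _ _ => ?_⟩
        simp only [hform u hu.1, hform v hv.1]
        rw [← hcoc.inv_mul hτ hu.2 hv.2]
        group
  obtain ⟨f, hf⟩ := key N
  refine ⟨f, fun a => ?_⟩
  have h1 : ∀ u : I, u ≤ t N := fun u => by rw [hN N le_rfl]; exact u.2.2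
  obtain ⟨W, hW, h⟩ := hf a (h1 a)
  exact ⟨W, hW, fun u hu v hv => h u hu v hv (h1 u) (h1 v)⟩

/-- The holonomy along a path of a cocycle defined near the diagonal. -/
noncomputable def hol (hs : ∀ p, ∃ O ∈ 𝓝 p, IsCocycleOn s O) {x y : X} (p : Path x y) : E :=
  ((exists_trivializes hs p.continuous).choose 0)⁻¹ * (exists_trivializes hs p.continuous).choose 1

theorem hol_eq (hs : ∀ p, ∃ O ∈ 𝓝 p, IsCocycleOn s O) {x y : X} (p : Path x y)
    (hf : Trivializes s p f) : hol hs p = (f 0)⁻¹ * f 1 :=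
  (exists_trivializes hs p.continuous).choose_spec.endpoints_eq hf

theorem hol_trans (hs : ∀ p, ∃ O ∈ 𝓝 p, IsCocycleOn s O) {x y z : X} (p : Path x y)
    (q : Path y z) : hol hs (p.trans q) = hol hs p * hol hs q := by
  obtain ⟨f, hf⟩ := exists_trivializes hs (p.trans q).continuous
  have h2 : (1 / 2 : ℝ) ∈ I := ⟨by norm_num, by norm_num⟩
  let φ : I → I := fun t => ⟨t / 2, by constructor <;> linarith [t.2.1, t.2.2]⟩
  let ψ : I → I := fun t => ⟨t / 2 + 1 / 2, by constructor <;> linarith [t.2.1, t.2.2]⟩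
  have hφ : Continuous φ := by fun_prop
  have hψ : Continuous ψ := by fun_prop
  have e1 : (p.trans q) ∘ φ = p := by
    funext t
    have : (t : ℝ) / 2 ≤ 1 / 2 := by linarith [t.2.2]
    simp only [Function.comp, Path.trans_apply, φ, this, dif_pos]
    congr 1; ext; simp; ring
  have e2 : (p.trans q) ∘ ψ = q := by
    funext t
    simp only [Function.comp, Path.trans_apply, ψ]
    split_ifs with h
    · have : t = 0 := Subtype.ext (le_antisymm (show (t : ℝ) ≤ 0 by linarith) t.2.1)
      subst this
      simp
    · congr 1; ext; simp; ring
  have h1 := hf.comp hφ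
  have h3 := hf.comp hψ
  rw [e1] at h1
  rw [e2] at h3
  rw [hol_eq hs _ hf, hol_eq hs _ h1, hol_eq hs _ h3]
  have a0 : φ 0 = 0 := by ext; simp [φ]
  have a1 : φ 1 = ψ 0 := by ext; simp [φ, ψ]
  have a2 : ψ 1 = 1 := by ext; simp [ψ]; norm_num
  simp only [Function.comp, a0, a1, a2]
  group

theorem hol_homotopic (hs : ∀ p, ∃ O ∈ 𝓝 p, IsCocycleOn s O) {x y : X} {p q : Path x y}
    (h : p.Homotopic q) : hol hs p = hol hs q := by
  obtain ⟨H⟩ := h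
  have hc : IsLocallyConstant fun t => hol hs (H.eval t) := by
    rw [IsLocallyConstant.iff_eventually_eq]
    intro t
    obtain ⟨f, hf⟩ := exists_trivializes hs (H.eval t).continuous
    have key : ∀ᶠ t' in 𝓝 t, ∀ u ∈ (univ : Set I), ∃ O ∈ 𝓝 u, ∀ v ∈ O, ∀ w ∈ O,
        (f v * s (H (t, v)) (H (t', v)))⁻¹ * (f w * s (H (t, w)) (H (t', w))) =
          s (H (t', v)) (H (t', w)) := by
      refine isCompact_univ.eventually_forall_of_forall_eventually fun u _ => ?_
      obtain ⟨O, hO, hsO⟩ := hs (H (t, u))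
      obtain ⟨W, hW, hfW⟩ := hf u
      have hpre : H ⁻¹' O ∈ 𝓝 (t, u) := H.continuous.continuousAt.preimage_mem_nhds hO
      rw [nhds_prod_eq] at hpre
      obtain ⟨A, hA, B, hB, hAB⟩ := Filter.mem_prod_iff.1 hpre
      have : A ×ˢ interior (B ∩ W) ∈ 𝓝 (t, u) :=
        prod_mem_nhds hA (interior_mem_nhds.2 (inter_mem hB hW))
      filter_upwards [this] with z hz
      refine ⟨interior (B ∩ W), isOpen_interior.mem_nhds hz.2, fun v hv w hw => ?_⟩
      have hv := interior_subset hv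
      have hw := interior_subset hw
      have m1 : H (t, v) ∈ O := hAB (mk_mem_prod (mem_of_mem_nhds hA) hv.1)
      have m2 : H (t, w) ∈ O := hAB (mk_mem_prod (mem_of_mem_nhds hA) hw.1)
      have m3 : H (z.1, v) ∈ O := hAB (mk_mem_prod hz.1 hv.1)
      have m4 : H (z.1, w) ∈ O := hAB (mk_mem_prod hz.1 hw.1)
      have e : (f v)⁻¹ * f w = s (H (t, v)) (H (t, w)) := hfW v hv.2 w hw.2
      calc _ = (s (H (t, v)) (H (z.1, v)))⁻¹ * ((f v)⁻¹ * f w) * s (H (t, w)) (H (z.1, w)) := by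
            group
        _ = _ := by
            rw [e, hsO.inv m1 m3, hsO _ m3 _ m1 _ m2, hsO _ m3 _ m2 _ m4]
    filter_upwards [key] with t' ht'
    have hf' : Trivializes s (H.eval t') fun u => f u * s (H (t, u)) (H (t', u)) :=
      fun u => ht' u (mem_univ u)
    rw [hol_eq hs _ hf, hol_eq hs _ hf']
    obtain ⟨O, hO, hsO⟩ := hs x
    obtain ⟨O', hO', hsO'⟩ := hs y
    simp [hsO.self (mem_of_mem_nhds hO), hsO'.self (mem_of_mem_nhds hO')]
  have := hc.apply_eq_of_preconnectedSpace 0 1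
  simpa using this

end Holonomy

/-! ### Lifts of a cocycle along a surjective homomorphism -/

section Lift

variable {X E G : Type*} [Group E] [Group G] (π : E →* G) (c : X → X → G)

/-- On `O`, the function `s` is a cocycle lifting `c` along `π`. -/
structure IsLiftOn (s : X → X → E) (O : Set X) : Prop where
  cocycle : IsCocycleOn s O
  map_eq : ∀ x ∈ O, ∀ y ∈ O, π (s x y) = c x y

/-- Near `p`, the function `s` is a cocycle lifting `c` along `π`. -/
def IsLiftAt [TopologicalSpace X] (s : X → X → E) (p : X) : Prop :=
  ∃ O ∈ 𝓝 p, IsLiftOn π c s O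

variable {π c}

theorem IsLiftOn.mono {s : X → X → E} {O O' : Set X} (h : IsLiftOn π c s O) (hO : O' ⊆ O) :
    IsLiftOn π c s O' :=
  ⟨h.cocycle.mono hO, fun x hx y hy => h.map_eq x (hO hx) y (hO hy)⟩

theorem IsLiftOn.congr {s s' : X → X → E} {O : Set X} (h : IsLiftOn π c s O)
    (hs : ∀ x ∈ O, ∀ y ∈ O, s' x y = s x y) : IsLiftOn π c s' O :=
  ⟨fun x hx y hy w hw => by
    rw [hs x hx y hy, hs y hy w hw, hs x hx w hw, h.cocycle x hx y hy w hw],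
    fun x hx y hy => by rw [hs x hx y hy, h.map_eq x hx y hy]⟩

theorem IsLiftAt.congr [TopologicalSpace X] {s s' : X → X → E} {p : X} (h : IsLiftAt π c s p)
    {O : Set X} (hO : O ∈ 𝓝 p) (hs : ∀ x ∈ O, ∀ y ∈ O, s' x y = s x y) : IsLiftAt π c s' p := by
  obtain ⟨W, hW, hsW⟩ := h
  exact ⟨W ∩ O, inter_mem hW hO, (hsW.mono inter_subset_left).congr
    fun x hx y hy => hs x hx.2 y hy.2⟩

theorem IsLiftAt.exists_open [TopologicalSpace X] {s : X → X → E} {p : X}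
    (h : IsLiftAt π c s p) : ∃ O, IsOpen O ∧ p ∈ O ∧ IsLiftOn π c s O := by
  obtain ⟨W, hW, hsW⟩ := h
  exact ⟨interior W, isOpen_interior, mem_interior_iff_mem_nhds.2 hW, hsW.mono interior_subset⟩

/-- A coboundary of a lift of a primitive of `c` is a lift of `c`. -/
theorem isLiftOn_coboundary {O : Set X} {x₀ : X} (hc : IsCocycleOn c O) (hx₀ : x₀ ∈ O)
    {h : X → E} (hh : ∀ x ∈ O, π (h x) = c x₀ x) : IsLiftOn π c (fun x y => (h x)⁻¹ * h y) O :=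
  ⟨fun x _ y _ w _ => by group, fun x hx y hy => by
    rw [map_mul, map_inv, hh x hx, hh y hy, hc.inv_mul hx₀ hx hy]⟩

end Lift

/-! ### Half-plane coordinates -/

/-- Half-plane coordinates on a subset `D`: a homeomorphism of `D` with the trace on the closed
half-plane of an open subset of the plane. -/
structure HalfPlaneCoord {X : Type*} [TopologicalSpace X] (D : Set X) where
  /-- The coordinate map. -/
  e : X → EuclideanSpace ℝ (Fin 2)
  /-- The inverse of the coordinate map. -/
  j : EuclideanSpace ℝ (Fin 2) → X
  /-- An open subset of the plane whose trace is the image of the coordinate map. -/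
  T : Set (EuclideanSpace ℝ (Fin 2))
  isOpen_T : IsOpen T
  continuousOn_e : ContinuousOn e D
  continuousOn_j : ContinuousOn j (T ∩ {a | 0 ≤ a 0})
  e_mem : ∀ x ∈ D, e x ∈ T
  e_nonneg : ∀ x ∈ D, 0 ≤ e x 0
  j_e : ∀ x ∈ D, j (e x) = x
  j_mem : ∀ a ∈ T, 0 ≤ a 0 → j a ∈ D
  e_j : ∀ a ∈ T, 0 ≤ a 0 → e (j a) = a

theorem exists_halfPlaneCoord {Z : Type*} [TopologicalSpace Z]
    [ChartedSpace (EuclideanHalfSpace 2) Z] {x : Z} {N : Set Z} (hN : N ∈ 𝓝 x) :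
    ∃ D, IsOpen D ∧ x ∈ D ∧ D ⊆ N ∧ Nonempty (HalfPlaneCoord D) := by
  let φ := chartAt (EuclideanHalfSpace 2) x
  have hDo : IsOpen (φ.source ∩ interior N) := φ.open_source.inter isOpen_interior
  have himg : IsOpen (φ '' (φ.source ∩ interior N)) :=
    φ.isOpen_image_of_subset_source hDo inter_subset_left
  obtain ⟨T, hT, hTeq⟩ := isOpen_induced_iff.1 himg
  have hmem : ∀ a : EuclideanSpace ℝ (Fin 2), ∀ ha : 0 ≤ a 0, a ∈ T →
      ∃ y ∈ φ.source ∩ interior N, φ y = ⟨a, ha⟩ := by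
    intro a ha haT
    have : (⟨a, ha⟩ : EuclideanHalfSpace 2) ∈ Subtype.val ⁻¹' T := haT
    rw [hTeq] at this
    exact this
  have hmax : ∀ a : EuclideanSpace ℝ (Fin 2),
      0 ≤ (a + (max 0 (-(a 0))) • EuclideanSpace.single (0 : Fin 2) (1 : ℝ)) 0 := by
    intro a
    have := le_max_right 0 (-(a 0))
    simp
    linarith
  let proj : EuclideanSpace ℝ (Fin 2) → EuclideanHalfSpace 2 := fun a =>
    ⟨a + (max 0 (-(a 0))) • EuclideanSpace.single (0 : Fin 2) (1 : ℝ), hmax a⟩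
  have hproj : ∀ a : EuclideanSpace ℝ (Fin 2), ∀ ha : 0 ≤ a 0, proj a = ⟨a, ha⟩ := by
    intro a ha
    apply Subtype.ext
    have : max 0 (-(a 0)) = 0 := max_eq_left (by linarith)
    simp [proj, this]
  have hprojc : Continuous proj := by
    refine Continuous.subtype_mk ?_ _
    fun_prop
  refine ⟨φ.source ∩ interior N, hDo, ⟨mem_chart_source _ x, mem_interior_iff_mem_nhds.2 hN⟩,
    fun y hy => interior_subset hy.2, ⟨⟨fun y => (φ y).1, fun a => φ.symm (proj a), T, hT,
      ?_, ?_, ?_, ?_, ?_, ?_, ?_⟩⟩⟩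
  · exact continuous_subtype_val.comp_continuousOn (φ.continuousOn.mono inter_subset_left)
  · refine φ.symm.continuousOn.comp hprojc.continuousOn ?_
    rintro a ⟨haT, ha⟩
    obtain ⟨y, hy, hya⟩ := hmem a ha haT
    rw [hproj a ha, ← hya]
    exact φ.map_source hy.1
  · intro y hy
    change φ y ∈ Subtype.val ⁻¹' T
    rw [hTeq]
    exact mem_image_of_mem _ hy
  · exact fun y _ => (φ y).2
  · intro y hy
    rw [hproj _ (φ y).2]
    exact φ.left_inv hy.1
  · intro a haT ha
    obtain ⟨y, hy, hya⟩ := hmem a ha haT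
    rw [hproj a ha, ← hya, φ.left_inv hy.1]
    exact hy
  · intro a haT ha
    obtain ⟨y, hy, hya⟩ := hmem a ha haT
    rw [hproj a ha, ← hya, φ.left_inv hy.1, hya]

theorem HalfPlaneCoord.exists_dist_lt {X : Type*} [TopologicalSpace X] {D : Set X}
    (C : HalfPlaneCoord D) {p : X} (hp : p ∈ D) {W : Set X} (hW : W ∈ 𝓝 p) :
    ∃ δ > 0, ∀ y ∈ D, dist (C.e y) (C.e p) < δ → y ∈ W := by
  have h := C.continuousOn_j (C.e p) ⟨C.e_mem p hp, C.e_nonneg p hp⟩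
  have h2 : C.j ⁻¹' W ∈ 𝓝[C.T ∩ {a | 0 ≤ a 0}] (C.e p) := h (by rwa [C.j_e p hp])
  obtain ⟨δ, hδ, hsub⟩ := Metric.mem_nhdsWithin_iff.1 h2
  refine ⟨δ, hδ, fun y hy hyp => ?_⟩
  have := hsub ⟨Metric.mem_ball.2 hyp, C.e_mem y hy, C.e_nonneg y hy⟩
  rwa [mem_preimage, C.j_e y hy] at this

/-! ### Extending lifts across a coordinate patch, up to finitely many points -/

theorem eventually_floor_eq_or (t : ℝ) : ∀ᶠ u in 𝓝 t, ⌊u⌋ = ⌊t⌋ ∨ ⌊u⌋ = ⌈t⌉ - 1 := by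
  have h1 : (⌈t⌉ : ℝ) - 1 < t := by linarith [Int.ceil_lt_add_one t]
  have h2 : t < (⌊t⌋ : ℝ) + 1 := Int.lt_floor_add_one t
  filter_upwards [Ioo_mem_nhds h1 h2] with u hu
  have h3 : ⌊u⌋ < ⌊t⌋ + 1 := Int.floor_lt.2 (by push_cast; exact hu.2)
  have h4 : ⌈t⌉ - 1 ≤ ⌊u⌋ := Int.le_floor.2 (by push_cast; exact hu.1.le)
  have h5 : ⌊t⌋ ≤ ⌈t⌉ := Int.floor_le_ceil t
  have h6 : ⌈t⌉ ≤ ⌊t⌋ + 1 := Int.ceil_le_floor_add_one t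
  omega

theorem eventually_floor_eq {t : ℝ} (ht : (⌊t⌋ : ℝ) ≠ t) : ∀ᶠ u in 𝓝 t, ⌊u⌋ = ⌊t⌋ := by
  have h1 : (⌊t⌋ : ℝ) < t := lt_of_le_of_ne (Int.floor_le t) ht
  filter_upwards [Ioo_mem_nhds h1 (Int.lt_floor_add_one t)] with u hu
  exact Int.floor_eq_iff.2 ⟨hu.1.le, hu.2⟩

section Tile

variable {X E G : Type*} [TopologicalSpace X] [Group E] [Group G] {π : E →* G} {c : X → X → G}

/-- Gluing the values of a lift `s` on the good tiles of a decomposition with coboundaries of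
local primitives elsewhere gives a lift near every point at which at most two tiles meet. -/
theorem exists_lift_of_tiles {ι : Type*} (hπ : Function.Surjective π) {D : Set X} (hD : IsOpen D)
    {x₀ : X} (hx₀ : x₀ ∈ D) (hc : IsCocycleOn c D) (s : X → X → E) (r : X → ι) (good : ι → Prop)
    (hgood : ∀ n, good n → IsLiftOn π c s {x ∈ D | r x = n}) :
    ∃ s' : X → X → E,
      (∀ x y, good (r x) → good (r y) → s' x y = s x y) ∧
      ∀ p ∈ D, ∀ n n', (∀ᶠ y in 𝓝 p, r y = n ∨ r y = n') → ¬ (good n ∧ good n') →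
        IsLiftAt π c s' p := by
  classical
  have hex : ∀ n, ∃ h : X → E, (∀ x ∈ D, r x = n → π (h x) = c x₀ x) ∧
      (good n → ∀ x ∈ D, ∀ y ∈ D, r x = n → r y = n → (h x)⁻¹ * h y = s x y) := by
    intro n
    choose lft hlft using hπ
    by_cases hn : good n ∧ ∃ b ∈ D, r b = n
    · obtain ⟨hn, b, hb, hbn⟩ := hn
      have hl := hgood n hn
      refine ⟨fun x => lft (c x₀ b) * s b x, fun x hx hxn => ?_, fun _ x hx y hy hxn hyn => ?_⟩
      · rw [map_mul, hlft, hl.map_eq b ⟨hb, hbn⟩ x ⟨hx, hxn⟩, hc x₀ hx₀ b hb x hx]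
      · rw [← hl.cocycle.inv_mul (x := b) ⟨hb, hbn⟩ ⟨hx, hxn⟩ ⟨hy, hyn⟩]
        group
    · refine ⟨fun x => lft (c x₀ x), fun x _ _ => hlft _, fun hg x hx y _ hxn _ => ?_⟩
      exact absurd ⟨hg, x, hx, hxn⟩ hn
  choose h hh1 hh2 using hex
  refine ⟨fun x y => if good (r x) ∧ good (r y) then s x y else (h (r x) x)⁻¹ * h (r y) y,
    fun x y hx hy => if_pos ⟨hx, hy⟩, fun p hp n n' hr hbad => ?_⟩
  refine ⟨D ∩ {y | r y = n ∨ r y = n'}, inter_mem (hD.mem_nhds hp) hr, ?_⟩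
  refine ((isLiftOn_coboundary hc hx₀ (h := fun x => h (r x) x)
    fun x hx => hh1 _ x hx rfl).mono inter_subset_left).congr fun x hx y hy => ?_
  split_ifs with hxy
  · have hrxy : r y = r x := by
      rcases hx.2 with h1 | h1 <;> rcases hy.2 with h2 | h2
      · rw [h1, h2]
      · exact absurd ⟨h1 ▸ hxy.1, h2 ▸ hxy.2⟩ hbad
      · exact absurd ⟨h2 ▸ hxy.2, h1 ▸ hxy.1⟩ hbad
      · rw [h1, h2]
    rw [hrxy, hh2 (r x) hxy.1 x hx.1 y hy.1 rfl hrxy]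
  · rfl

end Tile

section Extension

variable {Z E G : Type*} [TopologicalSpace Z] [T2Space Z] [LocallyCompactSpace Z]
  [ChartedSpace (EuclideanHalfSpace 2) Z] [Group E] [Group G] {π : E →* G} {c : Z → Z → G}

theorem exists_nbhd_extension_punctured (hπ : Function.Surjective π)
    (hc : ∀ p, ∃ O ∈ 𝓝 p, IsCocycleOn c O) (x₀ : Z) :
    ∃ Q ∈ 𝓝 x₀, IsCompact Q ∧ ∀ (K U : Set Z) (s : Z → Z → E), IsCompact K → IsOpen U → K ⊆ U →
      (∀ p ∈ U, IsLiftAt π c s p) → ∃ (V F : Set Z) (s' : Z → Z → E), IsOpen V ∧ K ∪ Q ⊆ V ∧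
        F.Finite ∧ Disjoint F K ∧ (∀ p ∈ V \ F, IsLiftAt π c s' p) ∧
        ∃ L ∈ 𝓝ˢ K, ∀ x ∈ L, ∀ y ∈ L, s' x y = s x y := by
  classical
  obtain ⟨O, hO, hcO⟩ := hc x₀
  obtain ⟨D, hD, hxD, hDO, ⟨C⟩⟩ := exists_halfPlaneCoord hO
  have hcD := hcO.mono hDO
  obtain ⟨Q', hQ', hxQ', hQ'D⟩ := exists_compact_between (isCompact_singleton (x := x₀)) hD
    (singleton_subset_iff.2 hxD)
  obtain ⟨Q, hQ, hxQ, hQQ'⟩ := exists_compact_between (isCompact_singleton (x := x₀))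
    isOpen_interior hxQ'
  refine ⟨Q, mem_interior_iff_mem_nhds.1 (hxQ rfl), hQ, fun K U s hK hU hKU hs => ?_⟩
  obtain ⟨L, hL, hKL, hLU⟩ := exists_compact_between hK hU hKU
  have hLQ : IsCompact (L ∩ Q') := hL.inter hQ'
  have hW : ∀ p : (L ∩ Q' : Set Z), ∃ W, IsOpen W ∧ IsLiftOn π c s W ∧
      ∃ δ > 0, ∀ y ∈ D, dist (C.e y) (C.e p) < δ → y ∈ W := by
    intro p
    obtain ⟨W, hWo, hpW, hsW⟩ := (hs p (hLU p.2.1)).exists_open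
    obtain ⟨δ, hδ, h⟩ := C.exists_dist_lt (hQ'D p.2.2) (hWo.mem_nhds hpW)
    exact ⟨W, hWo, hsW, δ, hδ, h⟩
  choose W hWo hsW δ' hδ' hWδ using hW
  obtain ⟨δ, hδ, hLeb⟩ := lebesgue_number_lemma_of_metric
    (c := fun p : (L ∩ Q' : Set Z) => Metric.ball (C.e p) (δ' p))
    (hLQ.image_of_continuousOn (C.continuousOn_e.mono (inter_subset_right.trans hQ'D)))
    (fun _ => Metric.isOpen_ball) (by
      rintro _ ⟨p, hp, rfl⟩
      exact mem_iUnion.2 ⟨⟨p, hp⟩, Metric.mem_ball_self (hδ' _)⟩)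
  obtain ⟨ε, hε, hεδ⟩ : ∃ ε : ℝ, 0 < ε ∧ ε * 10 = δ := ⟨δ / 10, by positivity, by ring⟩
  let r : Z → ℤ × ℤ := fun y => (⌊C.e y 0 / ε⌋, ⌊C.e y 1 / ε⌋)
  let near : ℤ × ℤ → Z → Prop := fun n y =>
    |C.e y 0 - ε * n.1| < 3 * ε ∧ |C.e y 1 - ε * n.2| < 3 * ε
  let good : ℤ × ℤ → Prop := fun n => ∃ W, IsOpen W ∧ IsLiftOn π c s W ∧ ∀ y ∈ D, near n y → y ∈ W
  have hfl : ∀ a : ℝ, 0 ≤ a - ε * ⌊a / ε⌋ ∧ a - ε * ⌊a / ε⌋ < ε := by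
    intro a
    have h1 := Int.floor_le (a / ε)
    have h2 := Int.lt_floor_add_one (a / ε)
    rw [le_div_iff₀ hε] at h1
    rw [div_lt_iff₀ hε] at h2
    constructor <;> nlinarith
  have hcoord : ∀ i, ContinuousOn (fun y => C.e y i) D := fun i =>
    (show Continuous fun a : EuclideanSpace ℝ (Fin 2) => a i by fun_prop).comp_continuousOn
      C.continuousOn_e
  have hcoordAt : ∀ i, ∀ p ∈ D, ContinuousAt (fun y => C.e y i) p := fun i p hp =>
    (hcoord i).continuousAt (hD.mem_nhds hp)
  have hclose : ∀ p ∈ D, ∀ᶠ y in 𝓝 p, |C.e y 0 - C.e p 0| < ε ∧ |C.e y 1 - C.e p 1| < ε := by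
    intro p hp
    exact ((Metric.tendsto_nhds.1 (hcoordAt 0 p hp)) ε hε).and
      ((Metric.tendsto_nhds.1 (hcoordAt 1 p hp)) ε hε)
  have hnear : ∀ p ∈ D, ∀ᶠ y in 𝓝 p, near (r y) p := by
    intro p hp
    filter_upwards [hclose p hp] with y hy
    have h1 := hfl (C.e y 0)
    have h2 := hfl (C.e y 1)
    have h3 := abs_lt.1 hy.1
    have h4 := abs_lt.1 hy.2
    refine ⟨abs_lt.2 ⟨?_, ?_⟩, abs_lt.2 ⟨?_, ?_⟩⟩ <;> simp only [r] <;> linarith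
  have hself : ∀ p ∈ D, near (r p) p := fun p hp => (hnear p hp).self_of_nhds
  have hlift_of_good : ∀ p ∈ D, good (r p) → IsLiftAt π c s p := by
    rintro p hp ⟨W, hWo, hsW, h⟩
    exact ⟨W, hWo.mem_nhds (h p hp (hself p hp)), hsW⟩
  have hgoodT : ∀ p ∈ L ∩ Q', ∀ n, near n p → good n := by
    intro p hp n hn
    obtain ⟨q, hq⟩ := hLeb (C.e p) (mem_image_of_mem _ hp)
    refine ⟨W q, hWo q, hsW q, fun y hy hny => hWδ q y hy (hq ?_)⟩
    rw [Metric.mem_ball, EuclideanSpace.dist_eq, Fin.sum_univ_two]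
    have h1 := abs_lt.1 hn.1
    have h2 := abs_lt.1 hn.2
    have h3 := abs_lt.1 hny.1
    have h4 := abs_lt.1 hny.2
    rw [Real.sqrt_lt' hδ, Real.dist_eq, Real.dist_eq, sq_abs, sq_abs, ← hεδ]
    have h5 : (C.e y 0 - C.e p 0) ^ 2 < (6 * ε) ^ 2 := sq_lt_sq' (by linarith) (by linarith)
    have h6 : (C.e y 1 - C.e p 1) ^ 2 < (6 * ε) ^ 2 := sq_lt_sq' (by linarith) (by linarith)
    nlinarith
  obtain ⟨s₁, hs₁, hs₁'⟩ := exists_lift_of_tiles hπ hD hxD hcD s r good (by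
    rintro n ⟨W, -, hsW, h⟩
    refine hsW.mono ?_
    rintro y ⟨hy, rfl⟩
    exact h y hy (hself y hy))
  let vertex : Z → Prop := fun p =>
    (⌊C.e p 0 / ε⌋ : ℝ) = C.e p 0 / ε ∧ (⌊C.e p 1 / ε⌋ : ℝ) = C.e p 1 / ε
  have hcdiv : ∀ i, ∀ p ∈ D, Tendsto (fun y => C.e y i / ε) (𝓝 p) (𝓝 (C.e p i / ε)) :=
    fun i p hp => (hcoordAt i p hp).div_const ε
  have htwo : ∀ p ∈ D, ¬ vertex p → ∃ n n', ∀ᶠ y in 𝓝 p, r y = n ∨ r y = n' := by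
    intro p hp hv
    have h0 := (hcdiv 0 p hp).eventually (eventually_floor_eq_or _)
    have h1 := (hcdiv 1 p hp).eventually (eventually_floor_eq_or _)
    by_cases hv0 : (⌊C.e p 0 / ε⌋ : ℝ) = C.e p 0 / ε
    · have h1' := (hcdiv 1 p hp).eventually (eventually_floor_eq fun h => hv ⟨hv0, h⟩)
      refine ⟨(⌊C.e p 0 / ε⌋, ⌊C.e p 1 / ε⌋), (⌈C.e p 0 / ε⌉ - 1, ⌊C.e p 1 / ε⌋), ?_⟩
      filter_upwards [h0, h1'] with y ha hb
      simp only [r, Prod.mk.injEq]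
      tauto
    · have h0' := (hcdiv 0 p hp).eventually (eventually_floor_eq hv0)
      refine ⟨(⌊C.e p 0 / ε⌋, ⌊C.e p 1 / ε⌋), (⌊C.e p 0 / ε⌋, ⌈C.e p 1 / ε⌉ - 1), ?_⟩
      filter_upwards [h0', h1] with y ha hb
      simp only [r, Prod.mk.injEq]
      tauto
  have hgoodlift : ∀ p ∈ D, (∀ᶠ y in 𝓝 p, good (r y)) →
      ∃ A ∈ 𝓝 p, ∀ x ∈ A, ∀ y ∈ A, s₁ x y = s x y :=
    fun p _ h => ⟨_, h, fun x hx y hy => hs₁ x y hx hy⟩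
  have hs₁lift : ∀ p ∈ D, ¬ vertex p → IsLiftAt π c s₁ p := by
    intro p hp hv
    obtain ⟨n, n', hr⟩ := htwo p hp hv
    by_cases hg : good n ∧ good n'
    · have hev : ∀ᶠ y in 𝓝 p, good (r y) := by
        filter_upwards [hr] with y hy
        rcases hy with h | h <;> rw [h]
        exacts [hg.1, hg.2]
      obtain ⟨A, hA, hAs⟩ := hgoodlift p hp hev
      exact (hlift_of_good p hp hev.self_of_nhds).congr hA hAs
    · exact hs₁' p hp n n' hr hg
  refine ⟨interior L ∪ interior Q', {p | p ∈ Q' ∧ p ∉ L ∧ vertex p},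
    fun x y => if x ∈ L ∧ y ∈ L then s x y else s₁ x y,
    isOpen_interior.union isOpen_interior, union_subset_union hKL hQQ', ?_, ?_, ?_,
    L, mem_nhdsSet_iff_forall.2 fun p hp => mem_interior_iff_mem_nhds.1 (hKL hp),
    fun x hx y hy => if_pos ⟨hx, hy⟩⟩
  · refine Set.Finite.of_finite_image (f := r) ?_ ?_
    · have hb : ∀ i, ∃ M : ℝ, ∀ p ∈ Q', |C.e p i / ε| ≤ M := by
        intro i
        obtain ⟨M, hM⟩ := hQ'.exists_bound_of_continuousOn
          (((hcoord i).mono hQ'D).div_const ε)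
        exact ⟨M, hM⟩
      obtain ⟨M, hM⟩ := hb 0
      obtain ⟨N, hN⟩ := hb 1
      refine ((Set.finite_Icc (-⌈M⌉) ⌈M⌉).prod (Set.finite_Icc (-⌈N⌉) ⌈N⌉)).subset ?_
      rintro _ ⟨p, ⟨hpQ, -, hv⟩, rfl⟩
      have a0 := abs_le.1 (hM p hpQ)
      have a1 := abs_le.1 (hN p hpQ)
      rw [← hv.1] at a0
      rw [← hv.2] at a1
      have b0 := Int.le_ceil M
      have b1 := Int.le_ceil N
      refine ⟨⟨?_, ?_⟩, ⟨?_, ?_⟩⟩ <;> simp only [r] <;> rify <;> linarith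
    · rintro p ⟨hpQ, -, hv⟩ q ⟨hqQ, -, hw⟩ hpq
      simp only [r, Prod.mk.injEq] at hpq
      have e0 : C.e p 0 = C.e q 0 := by
        have : C.e p 0 / ε = C.e q 0 / ε := by rw [← hv.1, ← hw.1, hpq.1]
        field_simp at this
        exact this
      have e1 : C.e p 1 = C.e q 1 := by
        have : C.e p 1 / ε = C.e q 1 / ε := by rw [← hv.2, ← hw.2, hpq.2]
        field_simp at this
        exact this
      have : C.e p = C.e q := by
        ext i
        fin_cases i
        exacts [e0, e1]
      rw [← C.j_e p (hQ'D hpQ), this, C.j_e q (hQ'D hqQ)]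
  · exact Set.disjoint_left.2 fun p hp hpK => hp.2.1 (interior_subset (hKL hpK))
  · rintro p ⟨hpV, hpF⟩
    by_cases hpL : p ∈ interior L
    · exact (hs p (hLU (interior_subset hpL))).congr (isOpen_interior.mem_nhds hpL)
        fun x hx y hy => if_pos ⟨interior_subset hx, interior_subset hy⟩
    · have hpQ : p ∈ Q' := interior_subset (hpV.resolve_left hpL)
      by_cases hpL' : p ∈ L
      · have hev : ∀ᶠ y in 𝓝 p, good (r y) := (hnear p (hQ'D hpQ)).mono
          fun y hy => hgoodT p ⟨hpL', hpQ⟩ _ hy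
        obtain ⟨A, hA, hAs⟩ := hgoodlift p (hQ'D hpQ) hev
        refine (hs p (hLU hpL')).congr hA fun x hx y hy => ?_
        split_ifs
        exacts [rfl, hAs x hx y hy]
      · have hv : ¬ vertex p := fun hv => hpF ⟨hpQ, hpL', hv⟩
        refine (hs₁lift p (hQ'D hpQ) hv).congr (hL.isClosed.isOpen_compl.mem_nhds hpL')
          fun x hx y _ => if_neg fun h => hx h.1

end Extension

/-! ### Pushing singularities out of a coordinate disc -/

section Push

/-- Radial retraction of the punctured disc of radius `ρ` around `q` onto its boundary circle,
extended by the identity outside the disc. -/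
noncomputable def radialPush {n : ℕ} (q : EuclideanSpace ℝ (Fin n)) (ρ : ℝ)
    (a : EuclideanSpace ℝ (Fin n)) : EuclideanSpace ℝ (Fin n) :=
  q + max 1 (ρ / ‖a - q‖) • (a - q)

variable {n : ℕ} {q a : EuclideanSpace ℝ (Fin n)} {ρ : ℝ}

theorem radialPush_of_le (ha : a ≠ q) (h : ρ ≤ dist a q) : radialPush q ρ a = a := by
  have h0 : 0 < ‖a - q‖ := norm_pos_iff.2 (sub_ne_zero.2 ha)
  rw [dist_eq_norm] at h
  rw [radialPush, max_eq_left ((div_le_one h0).2 h), one_smul, add_sub_cancel]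

theorem dist_radialPush (hρ : 0 < ρ) (ha : a ≠ q) (h : dist a q ≤ ρ) :
    dist (radialPush q ρ a) q = ρ := by
  have h0 : 0 < ‖a - q‖ := norm_pos_iff.2 (sub_ne_zero.2 ha)
  rw [dist_eq_norm] at h
  rw [radialPush, max_eq_right ((one_le_div h0).2 h), dist_eq_norm, add_sub_cancel_left, norm_smul,
    Real.norm_of_nonneg (by positivity), div_mul_cancel₀ _ h0.ne']

theorem continuousAt_radialPush (ha : a ≠ q) : ContinuousAt (radialPush q ρ) a := by
  have h0 : ‖a - q‖ ≠ 0 := (norm_pos_iff.2 (sub_ne_zero.2 ha)).ne'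
  unfold radialPush
  fun_prop (disch := assumption)

theorem le_radialPush_apply {i : Fin n} (h : q i ≤ a i) : a i ≤ radialPush q ρ a i := by
  have h1 : 1 ≤ max 1 (ρ / ‖a - q‖) := le_max_left _ _
  simp only [radialPush, PiLp.add_apply, PiLp.smul_apply, PiLp.sub_apply, smul_eq_mul]
  nlinarith

variable {Z E G : Type*} [TopologicalSpace Z] [T2Space Z] [Group E] [Group G] {π : E →* G}
  {c : Z → Z → G}

/-- The coordinate disc of radius `ρ` around `q`. -/
def HalfPlaneCoord.disc {D : Set Z} (C : HalfPlaneCoord D) (q : EuclideanSpace ℝ (Fin 2))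
    (ρ : ℝ) : Set Z :=
  {x ∈ D | dist (C.e x) q ≤ ρ}

omit [T2Space Z] in
theorem HalfPlaneCoord.isCompact_disc {D : Set Z} (C : HalfPlaneCoord D)
    {q : EuclideanSpace ℝ (Fin 2)} {ρ : ℝ}
    (hT : ∀ a, dist a q ≤ ρ → 0 ≤ a 0 → a ∈ C.T) : IsCompact (C.disc q ρ) := by
  have h : IsCompact (Metric.closedBall q ρ ∩ {a | 0 ≤ a 0}) :=
    (isCompact_closedBall q ρ).inter_right (isClosed_le continuous_const (by fun_prop))
  have h2 := h.image_of_continuousOn (C.continuousOn_j.mono fun a ha => ⟨hT a ha.1 ha.2, ha.2⟩)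
  convert h2 using 1
  ext x
  constructor
  · rintro ⟨hx, hxq⟩
    exact ⟨C.e x, ⟨hxq, C.e_nonneg x hx⟩, C.j_e x hx⟩
  · rintro ⟨a, ⟨ha, ha0⟩, rfl⟩
    have haT := hT a ha ha0
    exact ⟨C.j_mem a haT ha0, by rwa [C.e_j a haT ha0]⟩

theorem exists_push (hπ : Function.Surjective π) {D : Set Z} (hD : IsOpen D)
    (C : HalfPlaneCoord D) {x₀ : Z} (hx₀ : x₀ ∈ D) (hc : IsCocycleOn c D)
    {q : EuclideanSpace ℝ (Fin 2)} {ρ : ℝ} (hρ : 0 < ρ)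
    (hT : ∀ a, dist a q ≤ ρ → 0 ≤ a 0 → a ∈ C.T)
    (hq : q 0 < 0 ∨ ∀ a, dist a q ≤ ρ → 0 ≤ a 0) {V F : Set Z} {s : Z → Z → E}
    (hDV : D ⊆ V) (hs : ∀ p ∈ V \ F, IsLiftAt π c s p)
    (hF : ∀ f ∈ F, f ∈ D → dist (C.e f) q ≠ ρ) :
    ∃ s' : Z → Z → E, (∀ p ∈ V, (p ∈ F → p ∈ C.disc q ρ) → (p ∈ D → C.e p ≠ q) →
      IsLiftAt π c s' p) ∧ ∀ x ∉ C.disc q ρ, ∀ y ∉ C.disc q ρ, s' x y = s x y := by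
  classical
  choose lft hlft using hπ
  let h : Z → E := fun x => lft (c x₀ x)
  let Φ : Z → Z := fun x => if x ∈ C.disc q ρ then C.j (radialPush q ρ (C.e x)) else x
  have hΦ : ∀ x ∉ C.disc q ρ, Φ x = x := fun x hx => if_neg hx
  have hs'eq : ∀ x ∉ C.disc q ρ, ∀ y ∉ C.disc q ρ,
      (h x)⁻¹ * h (Φ x) * s (Φ x) (Φ y) * (h (Φ y))⁻¹ * h y = s x y := by
    intro x hx y hy
    rw [hΦ x hx, hΦ y hy]
    group
  refine ⟨fun x y => (h x)⁻¹ * h (Φ x) * s (Φ x) (Φ y) * (h (Φ y))⁻¹ * h y, ?_, hs'eq⟩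
  intro p hpV hpF hpq
  by_cases hp : p ∈ C.disc q ρ
  · have hpD := hp.1
    have hmem : ∀ x ∈ D, C.e x ≠ q → radialPush q ρ (C.e x) ∈ C.T ∩ {a | 0 ≤ a 0} := by
      intro x hx hxq
      rcases le_total (dist (C.e x) q) ρ with hle | hle
      · have hd := dist_radialPush hρ hxq hle
        have h0 : 0 ≤ radialPush q ρ (C.e x) 0 := by
          rcases hq with hq | hq
          · have := C.e_nonneg x hx
            exact this.trans (le_radialPush_apply (by linarith))
          · exact hq _ hd.le
        exact ⟨hT _ hd.le h0, h0⟩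
      · rw [radialPush_of_le hxq hle]
        exact ⟨C.e_mem x hx, C.e_nonneg x hx⟩
    have hform : ∀ x ∈ D, C.e x ≠ q → Φ x = C.j (radialPush q ρ (C.e x)) := by
      intro x hx hxq
      by_cases hxC : x ∈ C.disc q ρ
      · exact if_pos hxC
      · have : ρ ≤ dist (C.e x) q := le_of_not_ge fun hle => hxC ⟨hx, hle⟩
        rw [hΦ x hxC, radialPush_of_le hxq this, C.j_e x hx]
    have hec : ContinuousAt C.e p := C.continuousOn_e.continuousAt (hD.mem_nhds hpD)
    have hev : ∀ᶠ x in 𝓝 p, x ∈ D ∧ C.e x ≠ q :=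
      (hD.eventually_mem hpD).and (hec.eventually_ne (hpq hpD))
    have hΦc : Tendsto Φ (𝓝 p) (𝓝 (Φ p)) := by
      have h1 : Tendsto (fun x => radialPush q ρ (C.e x)) (𝓝 p)
          (𝓝[C.T ∩ {a | 0 ≤ a 0}] (radialPush q ρ (C.e p))) := by
        refine tendsto_nhdsWithin_iff.2
          ⟨(continuousAt_radialPush (hpq hpD)).tendsto.comp hec, ?_⟩
        filter_upwards [hev] with x hx using hmem x hx.1 hx.2
      have h2 := (C.continuousOn_j _ (hmem p hpD (hpq hpD))).tendsto.comp h1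
      rw [← hform p hpD (hpq hpD)] at h2
      refine h2.congr' ?_
      filter_upwards [hev] with x hx using (hform x hx.1 hx.2).symm
    have hm := hmem p hpD (hpq hpD)
    have hΦD : Φ p ∈ D := by
      rw [hform p hpD (hpq hpD)]
      exact C.j_mem _ hm.1 hm.2
    have hΦF : Φ p ∉ F := fun hf => by
      apply hF _ hf hΦD
      rw [hform p hpD (hpq hpD), C.e_j _ hm.1 hm.2]
      exact dist_radialPush hρ (hpq hpD) hp.2
    obtain ⟨O, hO, hsO⟩ := hs _ ⟨hDV hΦD, hΦF⟩
    refine ⟨D ∩ Φ ⁻¹' (O ∩ D),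
      inter_mem (hD.mem_nhds hpD) (hΦc (inter_mem hO (hD.mem_nhds hΦD))), ?_, ?_⟩
    · intro x hx y hy w hw
      simp only
      rw [← hsO.cocycle (Φ x) hx.2.1 (Φ y) hy.2.1 (Φ w) hw.2.1]
      group
    · intro x hx y hy
      simp only [map_mul, map_inv, h, hlft]
      rw [hsO.map_eq _ hx.2.1 _ hy.2.1, hc.inv_mul hx₀ hx.1 hx.2.2, hc _ hx.1 _ hx.2.2 _ hy.2.2,
        mul_assoc, hc.inv_mul hx₀ hy.2.2 hy.1, hc _ hx.1 _ hy.2.2 _ hy.1]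
  · have hpF' : p ∉ F := fun hf => hp (hpF hf)
    exact (hs p ⟨hpV, hpF'⟩).congr ((C.isCompact_disc hT).isClosed.isOpen_compl.mem_nhds hp)
      fun x hx y hy => hs'eq x hx y hy

end Push

/-! ### Full compact sets -/

section Full

variable {Z : Type*} [TopologicalSpace Z]

/-- A set is full if its complement has no relatively compact union of components. -/
def IsFull (K : Set Z) : Prop :=
  ∀ C : Set Z, IsOpen C → C.Nonempty → Disjoint C K → IsClosed (C ∪ K) →
    ∀ L, IsCompact L → ¬ C ⊆ L

theorem isFull_empty [ConnectedSpace Z] [NoncompactSpace Z] : IsFull (∅ : Set Z) := by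
  intro C hC hne _ hcl L hL hCL
  rw [union_empty] at hcl
  have : C = univ := IsClopen.eq_univ ⟨hcl, hC⟩ hne
  subst this
  exact noncompact_univ Z (by rwa [univ_subset_iff.1 hCL] at hL)

theorem subset_of_isPreconnected {C K O : Set Z} (hC : IsOpen C) (hCK : IsClosed (C ∪ K))
    (hO : IsPreconnected O) (hOK : Disjoint O K) (h : (O ∩ C).Nonempty) : O ⊆ C := by
  refine hO.subset_left_of_subset_union hC hCK.isOpen_compl ?_ ?_ h
  · exact disjoint_compl_right.mono_left subset_union_left
  · intro x hx
    by_cases hxC : x ∈ C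
    · exact Or.inl hxC
    · exact Or.inr fun hxK => hxK.elim hxC fun hxK => hOK.le_bot ⟨hx, hxK⟩

theorem exists_isFull_superset [T2Space Z] [LocallyCompactSpace Z] [LocallyConnectedSpace Z]
    [ConnectedSpace Z] [NoncompactSpace Z] {K : Set Z} (hK : IsCompact K) :
    ∃ K', IsCompact K' ∧ IsFull K' ∧ K ⊆ K' := by
  classical
  let bad : Set Z → Prop := fun C =>
    IsOpen C ∧ Disjoint C K ∧ IsClosed (C ∪ K) ∧ ∃ L, IsCompact L ∧ C ⊆ L
  let W := ⋃₀ {C | bad C}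
  have hWo : IsOpen W := isOpen_sUnion fun C hC => hC.1
  have hWK : Disjoint W K := disjoint_sUnion_left.2 fun C hC => hC.2.1
  have hnbhd : ∀ p ∉ K, ∃ O, IsOpen O ∧ p ∈ O ∧ ∀ C, bad C → (O ∩ C).Nonempty → O ⊆ C := by
    intro p hp
    refine ⟨connectedComponentIn Kᶜ p, hK.isClosed.isOpen_compl.connectedComponentIn,
      mem_connectedComponentIn hp, fun C hC h => ?_⟩
    exact subset_of_isPreconnected hC.1 hC.2.2.1 isPreconnected_connectedComponentIn
      (disjoint_compl_left.mono_left (connectedComponentIn_subset _ _)) h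
  obtain ⟨L, hL, hKL, -⟩ := exists_compact_between hK isOpen_univ (subset_univ K)
  obtain ⟨M, hM, hWM⟩ : ∃ M, IsCompact M ∧ W ⊆ M := by
    have hfr : IsCompact (frontier L) :=
      hL.of_isClosed_subset isClosed_frontier hL.isClosed.frontier_subset
    have hfrK : ∀ p ∈ frontier L, p ∉ K := fun p hp hpK => hp.2 (hKL hpK)
    have hD : ∀ p : Z, ∃ O D, IsOpen O ∧ (p ∈ frontier L → p ∈ O) ∧ bad D ∧
        ∀ C, bad C → (O ∩ C).Nonempty → O ⊆ D := by
      intro p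
      by_cases hp : p ∈ frontier L
      · obtain ⟨O, hO, hpO, h⟩ := hnbhd p (hfrK p hp)
        by_cases hex : ∃ C, bad C ∧ (O ∩ C).Nonempty
        · obtain ⟨D, hD, hOD⟩ := hex
          exact ⟨O, D, hO, fun _ => hpO, hD, fun _ _ _ => h D hD hOD⟩
        · exact ⟨O, ∅, hO, fun _ => hpO, ⟨isOpen_empty, disjoint_bot_left, by simpa using hK.isClosed,
            ∅, isCompact_empty, subset_rfl⟩, fun C hC hne => absurd ⟨C, hC, hne⟩ hex⟩
      · exact ⟨∅, ∅, isOpen_empty, fun h => absurd h hp, ⟨isOpen_empty, disjoint_bot_left,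
          by simpa using hK.isClosed, ∅, isCompact_empty, subset_rfl⟩, by simp⟩
    choose O D hO hpO hDbad hOD using hD
    obtain ⟨t, ht, hcov⟩ := hfr.elim_nhds_subcover O fun p hp => (hO p).mem_nhds (hpO p hp)
    let D' := ⋃ p ∈ t, D p
    have hD'o : IsOpen D' := isOpen_biUnion fun p _ => (hDbad p).1
    have hD'K : IsClosed (D' ∪ K) := by
      have : IsClosed ((⋃ p ∈ t, (D p ∪ K)) ∪ K) :=
        (t.finite_toSet.isClosed_biUnion fun p _ => (hDbad p).2.2.1).union hK.isClosed
      convert this using 1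
      ext x
      simp only [D', mem_union, mem_iUnion]
      constructor
      · rintro (⟨p, hp, hx⟩ | hx)
        exacts [Or.inl ⟨p, hp, Or.inl hx⟩, Or.inr hx]
      · rintro (⟨p, hp, hx | hx⟩ | hx)
        exacts [Or.inl ⟨p, hp, hx⟩, Or.inr hx, Or.inr hx]
    have hcpt : ∀ p, ∃ M, IsCompact M ∧ D p ⊆ M := fun p => (hDbad p).2.2.2
    choose M hM hDM using hcpt
    refine ⟨L ∪ ⋃ p ∈ t, M p, hL.union (t.isCompact_biUnion fun p _ => hM p), ?_⟩
    rintro x ⟨C, hC, hxC⟩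
    by_contra hx
    have hD'M : D' ⊆ ⋃ p ∈ t, M p := iUnion₂_mono fun p _ => hDM p
    have hfrD : ∀ y ∈ frontier L, y ∈ C → y ∈ D' := by
      intro y hy hyC
      obtain ⟨p, hp, hyO⟩ := mem_iUnion₂.1 (hcov hy)
      exact mem_iUnion₂.2 ⟨p, hp, hOD p C hC ⟨y, hyO, hyC⟩ hyO⟩
    have heq : C \ (D' ∪ L) = (C ∪ K) \ (D' ∪ interior L) := by
      ext y
      simp only [Set.mem_sdiff, mem_union]
      constructor
      · rintro ⟨h1, h2⟩
        exact ⟨Or.inl h1, fun h => h2 (h.imp_right fun h => interior_subset h)⟩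
      · rintro ⟨h1, h2⟩
        have h3 : y ∈ C := h1.resolve_right fun h => h2 (Or.inr (hKL h))
        refine ⟨h3, fun h => h2 (Or.inl ?_)⟩
        rcases h with h | h
        · exact h
        · exact hfrD y ⟨subset_closure h, fun h' => h2 (Or.inr h')⟩ h3
    have hopen : IsOpen (C \ (D' ∪ L)) := by
      have : D' ∪ L = (D' ∪ K) ∪ L := by
        rw [union_assoc, union_eq_self_of_subset_left (hKL.trans interior_subset)]
      rw [this]
      exact hC.1.sdiff (hD'K.union hL.isClosed)
    have hclosed : IsClosed (C \ (D' ∪ L)) := by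
      rw [heq]
      exact hC.2.2.1.sdiff (hD'o.union isOpen_interior)
    obtain ⟨N, hN, hCN⟩ := hC.2.2.2
    refine isFull_empty (C \ (D' ∪ L)) hopen ⟨x, hxC, ?_⟩ disjoint_bot_right
      (by simpa using hclosed) N hN (sdiff_subset.trans hCN)
    rintro (h | h)
    exacts [hx (Or.inr (hD'M h)), hx (Or.inl h)]
  have hcl : IsClosed (K ∪ W) := by
    refine isClosed_of_closure_subset fun p hp => ?_
    by_contra hpn
    obtain ⟨O, hO, hpO, h⟩ := hnbhd p fun h => hpn (Or.inl h)
    obtain ⟨y, ⟨hyO, hyK⟩, hy⟩ := mem_closure_iff.1 hp (O ∩ Kᶜ) (hO.inter hK.isClosed.isOpen_compl)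
      ⟨hpO, fun h => hpn (Or.inl h)⟩
    obtain ⟨C, hC, hyC⟩ := hy.resolve_left hyK
    exact hpn (Or.inr ⟨C, hC, h C hC ⟨y, hyO, hyC⟩ hpO⟩)
  refine ⟨K ∪ W, (hK.union hM).of_isClosed_subset hcl (union_subset_union_right _ hWM), ?_,
    subset_union_left⟩
  intro C hC hne hCK hCcl N hN hCN
  have hb : bad (C ∪ W) := by
    refine ⟨hC.union hWo, disjoint_union_left.2 ⟨hCK.mono_right subset_union_left, hWK⟩, ?_,
      N ∪ M, hN.union hM, union_subset_union hCN hWM⟩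
    rwa [union_assoc, union_comm W]
  obtain ⟨x, hx⟩ := hne
  exact hCK.le_bot ⟨hx, Or.inr ⟨C ∪ W, hb, Or.inl hx⟩⟩

end Full

/-! ### Pushing singularities to infinity -/

section PushOut

variable {Z E G : Type*} [TopologicalSpace Z] [T2Space Z] [Group E] [Group G] {π : E →* G}
  {c : Z → Z → G}

theorem exists_push_of_finite (hπ : Function.Surjective π) {D : Set Z} (hD : IsOpen D)
    (C : HalfPlaneCoord D) {x₀ : Z} (hx₀ : x₀ ∈ D) (hc : IsCocycleOn c D)
    {q : EuclideanSpace ℝ (Fin 2)} {lo hi : ℝ} (hlo : 0 < lo) (hlohi : lo < hi)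
    (hT : ∀ a, dist a q < hi → 0 ≤ a 0 → a ∈ C.T)
    (hq : q 0 < 0 ∨ ∀ a, dist a q < hi → 0 ≤ a 0) {V F K : Set Z} {s : Z → Z → E}
    (hDV : D ⊆ V) (hDK : Disjoint D K) (hF : F.Finite) (hs : ∀ p ∈ V \ F, IsLiftAt π c s p) :
    ∃ s' : Z → Z → E, (∀ p ∈ V, (p ∈ F → p ∈ C.disc q lo) → (p ∈ D → C.e p ≠ q) →
      IsLiftAt π c s' p) ∧ ∃ L ∈ 𝓝ˢ K, ∀ x ∈ L, ∀ y ∈ L, s' x y = s x y := by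
  obtain ⟨ρ, ⟨h1, h2⟩, h3⟩ :=
    ((Ioo_infinite hlohi).sdiff (hF.image fun f => dist (C.e f) q)).nonempty
  have hT' : ∀ a, dist a q ≤ ρ → 0 ≤ a 0 → a ∈ C.T := fun a ha => hT a (ha.trans_lt h2)
  obtain ⟨s', hs', hs'eq⟩ := exists_push hπ hD C hx₀ hc (hlo.trans h1) hT'
    (hq.imp_right fun h a ha => h a (ha.trans_lt h2)) hDV hs
    fun f hf _ hfρ => h3 ⟨f, hf, hfρ⟩
  refine ⟨s', fun p hp hpF hpq => hs' p hp (fun h => ⟨(hpF h).1, (hpF h).2.trans h1.le⟩) hpq,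
    (C.disc q ρ)ᶜ, ?_, hs'eq⟩
  refine (C.isCompact_disc hT').isClosed.isOpen_compl.mem_nhdsSet.2 fun x hx hxd => ?_
  exact hDK.le_bot ⟨hxd.1, hx⟩

variable (π c) in
/-- A singularity at `x` of a lift on `V` can be removed, away from `K`, at the cost of modifying
the set of singularities outside `K'`. -/
def IsRemovable (V K K' : Set Z) (x : Z) : Prop :=
  ∀ (F : Set Z) (s : Z → Z → E), F.Finite → Disjoint F K →
    (∀ p ∈ V \ insert x F, IsLiftAt π c s p) → ∃ (F' : Set Z) (s' : Z → Z → E), F'.Finite ∧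
      Disjoint F' K ∧ F' ∩ K' ⊆ F \ {x} ∧ (∀ p ∈ V \ F', IsLiftAt π c s' p) ∧
      ∃ L ∈ 𝓝ˢ K, ∀ x ∈ L, ∀ y ∈ L, s' x y = s x y

omit [T2Space Z] in
theorem isRemovable_of_notMem {V K K' : Set Z} {x : Z} (hxK : x ∉ K) (hxK' : x ∉ K') :
    IsRemovable π c V K K' x := by
  intro F s hF hFK hs
  refine ⟨insert x F, s, hF.insert x, disjoint_insert_left.2 ⟨hxK, hFK⟩, ?_, hs, univ,
    univ_mem, fun _ _ _ _ => rfl⟩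
  rintro y ⟨hy, hyK⟩
  have : y ≠ x := fun h => hxK' (h ▸ hyK)
  exact ⟨hy.resolve_left this, this⟩

theorem exists_nbhd_isRemovable [ChartedSpace (EuclideanHalfSpace 2) Z]
    (hπ : Function.Surjective π) (hc : ∀ p, ∃ O ∈ 𝓝 p, IsCocycleOn c O) {V K K' : Set Z}
    (hK : IsClosed K) (hV : IsOpen V) {x : Z} (hxV : x ∈ V) (hxK : x ∉ K) :
    ∃ O, IsOpen O ∧ x ∈ O ∧ O ⊆ V \ K ∧ ((∀ y ∈ O, IsRemovable π c V K K' y) ∨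
      ∀ y ∈ O, ∀ y' ∈ O, IsRemovable π c V K K' y' → IsRemovable π c V K K' y) := by
  obtain ⟨N, hN, hcN⟩ := hc x
  obtain ⟨D, hD, hxD, hDN, ⟨C⟩⟩ := exists_halfPlaneCoord
    (inter_mem hN ((hV.sdiff hK).mem_nhds ⟨hxV, hxK⟩))
  have hcD : IsCocycleOn c D := hcN.mono (hDN.trans inter_subset_left)
  have hDVK : D ⊆ V \ K := hDN.trans inter_subset_right
  have hDV : D ⊆ V := hDVK.trans sdiff_subset
  have hDK : Disjoint D K := disjoint_left.2 fun y hy => (hDVK hy).2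
  have hopen : ∀ r : ℝ, IsOpen (D ∩ C.e ⁻¹' Metric.ball (C.e x) r) := fun r =>
    C.continuousOn_e.isOpen_inter_preimage hD Metric.isOpen_ball
  rcases (C.e_nonneg x hxD).eq_or_lt with h0 | h0
  · obtain ⟨ε, hε, hεT⟩ := Metric.isOpen_iff.1 C.isOpen_T _ (C.e_mem x hxD)
    obtain ⟨δ, hδ, rfl⟩ : ∃ δ : ℝ, 0 < δ ∧ 4 * δ = ε := ⟨ε / 4, by positivity, by ring⟩
    refine ⟨D ∩ C.e ⁻¹' Metric.ball (C.e x) δ, hopen _, ⟨hxD, Metric.mem_ball_self hδ⟩,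
      inter_subset_left.trans hDVK, Or.inl fun y hy F s hF hFK hs => ?_⟩
    let q : EuclideanSpace ℝ (Fin 2) := C.e x - EuclideanSpace.single 0 δ
    have hq : q 0 = -δ := by simp [q, ← h0]
    have hqx : dist q (C.e x) = δ := by
      simp [q, abs_of_pos hδ]
    obtain ⟨s', hs', hs'eq⟩ := exists_push_of_finite hπ hD C hxD hcD (q := q) (lo := 2 * δ)
      (hi := 3 * δ) (by positivity) (by linarith)
      (fun a ha _ => hεT (by
        have := dist_triangle a q (C.e x)
        rw [Metric.mem_ball]
        linarith)) (Or.inl (by linarith)) hDV hDK (hF.insert y) hs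
    refine ⟨F \ {y}, s', hF.sdiff, hFK.mono_left sdiff_subset, inter_subset_left, ?_, hs'eq⟩
    rintro p ⟨hpV, hpF⟩
    refine hs' p hpV (fun hp => ?_) fun hpD hpq => ?_
    · have hpy : p = y := by
        by_contra hpy
        exact hpF ⟨hp.resolve_left hpy, hpy⟩
      subst hpy
      refine ⟨hy.1, ?_⟩
      have := dist_triangle_right (C.e p) q (C.e x)
      have h4 : dist (C.e p) (C.e x) < δ := hy.2
      linarith
    · have := C.e_nonneg p hpD
      rw [hpq] at this
      linarith
  · have hTo : IsOpen (C.T ∩ {a | 0 < a 0}) :=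
      C.isOpen_T.inter (isOpen_lt continuous_const (by fun_prop))
    obtain ⟨ε, hε, hεT⟩ := Metric.isOpen_iff.1 hTo _ ⟨C.e_mem x hxD, h0⟩
    obtain ⟨δ, hδ, rfl⟩ : ∃ δ : ℝ, 0 < δ ∧ 4 * δ = ε := ⟨ε / 4, by positivity, by ring⟩
    refine ⟨D ∩ C.e ⁻¹' Metric.ball (C.e x) δ, hopen _, ⟨hxD, Metric.mem_ball_self hδ⟩,
      inter_subset_left.trans hDVK, Or.inr fun y hy y' hy' hR F s hF hFK hs => ?_⟩
    have hyx : dist (C.e y) (C.e x) < δ := hy.2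
    have hy'x : dist (C.e y') (C.e x) < δ := hy'.2
    have hball : ∀ a, dist a (C.e y') < 3 * δ → a ∈ C.T ∩ {a | 0 < a 0} := fun a ha => hεT (by
      have := dist_triangle a (C.e y') (C.e x)
      rw [Metric.mem_ball]
      linarith)
    obtain ⟨s₁, hs₁, L₁, hL₁, hs₁eq⟩ := exists_push_of_finite hπ hD C hxD hcD (q := C.e y')
      (lo := 2 * δ) (hi := 3 * δ) (by positivity) (by linarith)
      (fun a ha _ => (hball a ha).1) (Or.inr fun a ha => (hball a ha).2.le) hDV hDK (hF.insert y) hs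
    obtain ⟨F', s', hF', hF'K, hsubK, hs', L₂, hL₂, hs'eq⟩ := hR (F \ {y}) s₁ hF.sdiff
      (hFK.mono_left sdiff_subset) (by
        rintro p ⟨hpV, hpF⟩
        refine hs₁ p hpV (fun hp => ?_) fun hpD hpq => ?_
        · have hpy : p = y := by
            by_contra hpy
            exact hpF (Or.inr ⟨hp.resolve_left hpy, hpy⟩)
          subst hpy
          refine ⟨hy.1, ?_⟩
          have := dist_triangle_right (C.e p) (C.e y') (C.e x)
          linarith
        · have : p = y' := by rw [← C.j_e p hpD, hpq, C.j_e y' hy'.1]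
          exact hpF (Or.inl this))
    refine ⟨F', s', hF', hF'K, fun p hp => ((hsubK hp).1), hs', L₁ ∩ L₂, inter_mem hL₁ hL₂,
      fun a ha b hb => ?_⟩
    rw [hs'eq a ha.2 b hb.2, hs₁eq a ha.1 b hb.1]

theorem isRemovable_of_isFull [ChartedSpace (EuclideanHalfSpace 2) Z]
    (hπ : Function.Surjective π) (hc : ∀ p, ∃ O ∈ 𝓝 p, IsCocycleOn c O) {V K K' : Set Z}
    (hK : IsCompact K) (hKf : IsFull K) (hV : IsOpen V) (hK' : IsCompact K') (hK'V : K' ⊆ V)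
    {x : Z} (hxK : x ∉ K) : IsRemovable π c V K K' x := by
  by_contra hx
  have hout : ∀ {y : Z}, y ∉ K → ¬ IsRemovable π c V K K' y → y ∈ K' := fun h1 h2 => by
    by_contra h
    exact h2 (isRemovable_of_notMem h1 h)
  have hlocal := fun y (hyV : y ∈ V) (hyK : y ∉ K) =>
    exists_nbhd_isRemovable (K' := K') hπ hc hK.isClosed hV hyV hyK
  refine hKf {y | y ∉ K ∧ ¬ IsRemovable π c V K K' y} ?_ ⟨x, hxK, hx⟩
    (disjoint_left.2 fun y hy => hy.1) ?_ K' hK' fun y hy => hout hy.1 hy.2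
  · refine isOpen_iff_mem_nhds.2 fun y hy => ?_
    obtain ⟨O, hO, hyO, hOVK, h⟩ := hlocal y (hK'V (hout hy.1 hy.2)) hy.1
    refine mem_of_superset (hO.mem_nhds hyO) fun y' hy' => ⟨(hOVK hy').2, fun hR => ?_⟩
    rcases h with h | h
    exacts [hy.2 (h y hyO), hy.2 (h y hyO y' hy' hR)]
  · refine isClosed_of_closure_subset fun y hy => ?_
    by_contra hyn
    have hyK : y ∉ K := fun h => hyn (Or.inr h)
    have hyR : IsRemovable π c V K K' y := by
      by_contra h
      exact hyn (Or.inl ⟨hyK, h⟩)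
    have hyK' : y ∈ K ∪ K' := closure_minimal (union_subset (fun z hz => Or.inr (hout hz.1 hz.2))
      subset_union_left) (hK.isClosed.union hK'.isClosed) hy
    obtain ⟨O, hO, hyO, hOVK, h⟩ := hlocal y (hK'V (hyK'.resolve_left hyK)) hyK
    obtain ⟨y', hy'O, hy'⟩ := mem_closure_iff.1 hy O hO hyO
    have hy'2 := (hy'.resolve_right (hOVK hy'O).2).2
    rcases h with h | h
    exacts [hy'2 (h y' hy'O), hy'2 (h y' hy'O y hyO hyR)]

theorem exists_lift_of_finite_singularities [ChartedSpace (EuclideanHalfSpace 2) Z]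
    (hπ : Function.Surjective π) (hc : ∀ p, ∃ O ∈ 𝓝 p, IsCocycleOn c O) {V K K' : Set Z}
    (hK : IsCompact K) (hKf : IsFull K) (hV : IsOpen V) (hK' : IsCompact K') (hK'V : K' ⊆ V)
    {F : Set Z} {s : Z → Z → E} (hF : F.Finite) (hFK : Disjoint F K)
    (hs : ∀ p ∈ V \ F, IsLiftAt π c s p) :
    ∃ (V' : Set Z) (s' : Z → Z → E), IsOpen V' ∧ K' ⊆ V' ∧ (∀ p ∈ V', IsLiftAt π c s' p) ∧
      ∃ L ∈ 𝓝ˢ K, ∀ x ∈ L, ∀ y ∈ L, s' x y = s x y := by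
  induction hn : (F ∩ K').ncard using Nat.strong_induction_on generalizing F s with
  | _ n ih =>
    rcases (F ∩ K').eq_empty_or_nonempty with he | ⟨x, hxF, hxK'⟩
    · exact ⟨V \ F, s, hV.sdiff hF.isClosed,
        fun p hp => ⟨hK'V hp, fun hpF => notMem_empty p (he ▸ ⟨hpF, hp⟩)⟩, hs, univ, univ_mem,
        fun _ _ _ _ => rfl⟩
    · obtain ⟨F', s₁, hF', hF'K, hsubK, hs₁, L₁, hL₁, hs₁eq⟩ :=
        isRemovable_of_isFull hπ hc hK hKf hV hK' hK'V (disjoint_left.1 hFK hxF) F s hF hFK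
          (by rwa [insert_eq_of_mem hxF])
      have hlt : (F' ∩ K').ncard < n := by
        rw [← hn]
        refine ncard_lt_ncard ⟨fun y hy => ⟨(hsubK hy).1, hy.2⟩, fun h => ?_⟩
          (hF.inter_of_left K')
        exact (hsubK (h ⟨hxF, hxK'⟩)).2 rfl
      obtain ⟨V', s', hV', hKsub, hs', L₂, hL₂, hs'eq⟩ := ih _ hlt hF' hF'K hs₁ rfl
      refine ⟨V', s', hV', hKsub, hs', L₁ ∩ L₂, inter_mem hL₁ hL₂, fun a ha b hb => ?_⟩
      rw [hs'eq a ha.2 b hb.2, hs₁eq a ha.1 b hb.1]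

end PushOut

/-! ### Global lifts -/

section Global

variable {Z E G : Type*} [TopologicalSpace Z] [T2Space Z] [LocallyCompactSpace Z]
  [ChartedSpace (EuclideanHalfSpace 2) Z] [Group E] [Group G] {π : E →* G} {c : Z → Z → G}

theorem exists_extension (hπ : Function.Surjective π)
    (hc : ∀ p, ∃ O ∈ 𝓝 p, IsCocycleOn c O) {K U K' : Set Z} {s : Z → Z → E} (hK : IsCompact K)
    (hKf : IsFull K) (hU : IsOpen U) (hKU : K ⊆ U) (hs : ∀ p ∈ U, IsLiftAt π c s p)
    (hK' : IsCompact K') :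
    ∃ (U' : Set Z) (s' : Z → Z → E), IsOpen U' ∧ K' ⊆ U' ∧ (∀ p ∈ U', IsLiftAt π c s' p) ∧
      ∃ L ∈ 𝓝ˢ K, ∀ x ∈ L, ∀ y ∈ L, s' x y = s x y := by
  classical
  choose Q hQ hQc hQext using exists_nbhd_extension_punctured (π := π) (c := c) hπ hc
  have key : ∀ t : Finset Z, ∃ (U' : Set Z) (s' : Z → Z → E), IsOpen U' ∧
      (K ∪ ⋃ x ∈ t, Q x) ⊆ U' ∧ (∀ p ∈ U', IsLiftAt π c s' p) ∧
      ∃ L ∈ 𝓝ˢ K, ∀ x ∈ L, ∀ y ∈ L, s' x y = s x y := by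
    intro t
    induction t using Finset.induction_on with
    | empty => exact ⟨U, s, hU, by simpa using hKU, hs, univ, univ_mem, fun _ _ _ _ => rfl⟩
    | insert a t _ ih =>
      obtain ⟨U₁, s₁, hU₁, hKU₁, hs₁, L₁, hL₁, hs₁eq⟩ := ih
      have hKt : IsCompact (K ∪ ⋃ x ∈ t, Q x) := hK.union (t.isCompact_biUnion fun x _ => hQc x)
      obtain ⟨V, F, s₂, hV, hKV, hF, hFK, hs₂, L₂, hL₂, hs₂eq⟩ :=
        hQext a _ U₁ s₁ hKt hU₁ hKU₁ hs₁
      obtain ⟨V', s₃, hV', hKV', hs₃, L₃, hL₃, hs₃eq⟩ :=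
        exists_lift_of_finite_singularities hπ hc hK hKf hV (hKt.union (hQc a)) hKV hF
          (hFK.mono_right subset_union_left) hs₂
      refine ⟨V', s₃, hV', ?_, hs₃, L₁ ∩ L₂ ∩ L₃,
        inter_mem (inter_mem hL₁ (nhdsSet_mono subset_union_left hL₂)) hL₃, fun x hx y hy => ?_⟩
      · rw [Finset.set_biUnion_insert, union_comm (Q a), ← union_assoc]
        exact hKV'
      · rw [hs₃eq x hx.2 y hy.2, hs₂eq x hx.1.2 y hy.1.2, hs₁eq x hx.1.1 y hy.1.1]
  obtain ⟨t, -, ht⟩ := hK'.elim_nhds_subcover Q fun x _ => hQ x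
  obtain ⟨U', s', hU', hKU', hs', h⟩ := key t
  exact ⟨U', s', hU', ht.trans (subset_union_right.trans hKU'), hs', h⟩

omit [ChartedSpace (EuclideanHalfSpace 2) Z] in
theorem exists_isFull_exhaustion [SecondCountableTopology Z] [LocallyConnectedSpace Z]
    [ConnectedSpace Z] [NoncompactSpace Z] : ∃ K : ℕ → Set Z, (∀ n, IsCompact (K n)) ∧
      (∀ n, IsFull (K n)) ∧ (∀ n, K n ⊆ interior (K (n + 1))) ∧ K 0 = ∅ ∧ ∀ x, ∃ n, x ∈ K n := by
  let B := CompactExhaustion.choice Z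
  have hstep : ∀ (n : ℕ) (K : {K : Set Z // IsCompact K ∧ IsFull K}),
      ∃ K' : {K : Set Z // IsCompact K ∧ IsFull K}, K.1 ∪ B n ⊆ interior K'.1 := by
    intro n K
    obtain ⟨L, hL, hKL, -⟩ := exists_compact_between (K.2.1.union (B.isCompact n)) isOpen_univ
      (subset_univ _)
    obtain ⟨K', hK', hK'f, hLK'⟩ := exists_isFull_superset hL
    exact ⟨⟨K', hK', hK'f⟩, hKL.trans (interior_mono hLK')⟩
  choose next hnext using hstep
  let K : ℕ → {K : Set Z // IsCompact K ∧ IsFull K} :=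
    fun n => Nat.rec ⟨∅, isCompact_empty, isFull_empty⟩ next n
  have hK : ∀ n, (K n).1 ∪ B n ⊆ interior (K (n + 1)).1 := fun n => hnext n (K n)
  refine ⟨fun n => (K n).1, fun n => (K n).2.1, fun n => (K n).2.2,
    fun n => subset_union_left.trans (hK n), rfl, fun x => ?_⟩
  obtain ⟨n, hn⟩ := B.exists_mem x
  exact ⟨n + 1, interior_subset (hK n (Or.inr hn))⟩

/-- On a connected non-compact surface, cocycles lift along surjective homomorphisms. -/
theorem exists_global_lift [SecondCountableTopology Z] [LocallyConnectedSpace Z]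
    [ConnectedSpace Z] [NoncompactSpace Z] (hπ : Function.Surjective π)
    (hc : ∀ p, ∃ O ∈ 𝓝 p, IsCocycleOn c O) : ∃ s : Z → Z → E, ∀ p, IsLiftAt π c s p := by
  classical
  obtain ⟨K, hK, hKf, hKint, hK0, hKcov⟩ := exists_isFull_exhaustion (Z := Z)
  have hstep : ∀ (n : ℕ) (s : {s : Z → Z → E // ∃ U, IsOpen U ∧ K n ⊆ U ∧
        ∀ p ∈ U, IsLiftAt π c s p}), ∃ s' : {s : Z → Z → E // ∃ U, IsOpen U ∧ K (n + 1) ⊆ U ∧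
        ∀ p ∈ U, IsLiftAt π c s p}, ∃ L ∈ 𝓝ˢ (K n), ∀ x ∈ L, ∀ y ∈ L, s'.1 x y = s.1 x y := by
    rintro n ⟨s, U, hU, hKU, hs⟩
    obtain ⟨U', s', hU', hKU', hs', h⟩ := exists_extension hπ hc (hK n) (hKf n) hU hKU hs (hK (n + 1))
    exact ⟨⟨s', U', hU', hKU', hs'⟩, h⟩
  choose next L hL hnext using hstep
  let S : ∀ n, {s : Z → Z → E // ∃ U, IsOpen U ∧ K n ⊆ U ∧ ∀ p ∈ U, IsLiftAt π c s p} :=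
    fun n => Nat.rec ⟨fun _ _ => 1, ∅, isOpen_empty, hK0.subset, fun p hp => hp.elim⟩ next n
  have hS : ∀ n, ∀ x ∈ L n (S n), ∀ y ∈ L n (S n), (S (n + 1)).1 x y = (S n).1 x y :=
    fun n => hnext n (S n)
  let ν : Z → ℕ := fun x => Nat.find (hKcov x)
  refine ⟨fun x y => (S (max (ν x) (ν y))).1 x y, fun p => ?_⟩
  obtain ⟨U, -, hKU, hsU⟩ := (S (ν p)).2
  have hp : p ∈ K (ν p) := Nat.find_spec (hKcov p)
  have h1 : ∀ᶠ y in 𝓝 p, ν y ≤ ν p + 1 := by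
    filter_upwards [isOpen_interior.mem_nhds (hKint _ hp)] with y hy
    exact Nat.find_min' _ (interior_subset hy)
  have h2 : ∀ᶠ y in 𝓝 p, ν p ≤ ν y := by
    have : ∀ᶠ y in 𝓝 p, ∀ m < ν p, y ∉ K m :=
      (eventually_all_finite (finite_lt_nat (ν p))).2 fun m hm =>
        (hK m).isClosed.isOpen_compl.mem_nhds (Nat.find_min _ hm)
    filter_upwards [this] with y hy
    by_contra h
    exact hy _ (not_le.1 h) (Nat.find_spec (hKcov y))
  have h3 : L (ν p) (S (ν p)) ∈ 𝓝 p := mem_nhdsSet_iff_forall.1 (hL _ _) p hp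
  refine (hsU p (hKU hp)).congr (inter_mem (inter_mem h1 h2) h3) fun x hx y hy => ?_
  have : max (ν x) (ν y) = ν p ∨ max (ν x) (ν y) = ν p + 1 := by
    have a1 : ν x ≤ ν p + 1 := hx.1.1
    have a2 : ν p ≤ ν x := hx.1.2
    have a3 : ν y ≤ ν p + 1 := hy.1.1
    have a4 : ν p ≤ ν y := hy.1.2
    omega
  rcases this with h | h <;> rw [h]
  exact hS _ x hx.2 y hy.2

end Global

/-! ### The tautological cocycle with values in the fundamental group -/

section Tautological

variable {Z : Type*} [TopologicalSpace Z]

/-- Any two paths with the same endpoints in `W` are homotopic in the ambient space. -/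
def IsPathTrivial (W : Set Z) : Prop :=
  ∀ ⦃x y : Z⦄ (p q : Path x y), range p ⊆ W → range q ⊆ W → p.Homotopic q

theorem IsPathTrivial.mono {W W' : Set Z} (h : IsPathTrivial W) (hW : W' ⊆ W) :
    IsPathTrivial W' :=
  fun _ _ p q hp hq => h p q (hp.trans hW) (hq.trans hW)

theorem exists_isPathTrivial [ChartedSpace (EuclideanHalfSpace 2) Z] (x : Z) :
    ∃ W ∈ 𝓝 x, IsPathTrivial W := by
  obtain ⟨D, hD, hxD, -, ⟨C⟩⟩ := exists_halfPlaneCoord (univ_mem (f := 𝓝 x))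
  obtain ⟨r, hr, hrT⟩ := Metric.isOpen_iff.1 C.isOpen_T _ (C.e_mem x hxD)
  refine ⟨D ∩ C.e ⁻¹' Metric.ball (C.e x) r,
    (C.continuousOn_e.isOpen_inter_preimage hD Metric.isOpen_ball).mem_nhds
      ⟨hxD, Metric.mem_ball_self hr⟩, fun a b p q hp hq => ?_⟩
  let A : Set (EuclideanSpace ℝ (Fin 2)) := Metric.ball (C.e x) r ∩ {a | 0 ≤ a 0}
  have hA : Convex ℝ A := by
    refine (convex_ball _ _).inter ?_
    intro u hu v hv s t hs ht _
    simp only [Set.mem_ofPred_eq, PiLp.add_apply, PiLp.smul_apply, smul_eq_mul] at *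
    positivity
  have hAT : A ⊆ C.T ∩ {a | 0 ≤ a 0} := fun a ha => ⟨hrT ha.1, ha.2⟩
  have hmem : ∀ {γ : Path a b}, range γ ⊆ D ∩ C.e ⁻¹' Metric.ball (C.e x) r →
      ∀ t, C.e (γ t) ∈ A := fun hγ t => by
    have := hγ (mem_range_self t)
    exact ⟨this.2, C.e_nonneg _ this.1⟩
  have hcont : ∀ {γ : Path a b}, range γ ⊆ D ∩ C.e ⁻¹' Metric.ball (C.e x) r →
      Continuous fun t => C.e (γ t) := fun {γ} hγ =>
    C.continuousOn_e.comp_continuous γ.continuous fun t => (hγ (mem_range_self t)).1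
  have hp' := hcont hp
  have hq' := hcont hq
  have hline : ∀ z : I × I, AffineMap.lineMap (C.e (p z.2)) (C.e (q z.2)) (z.1 : ℝ) ∈ A := fun z =>
    hA.lineMap_mem (hmem hp z.2) (hmem hq z.2) z.1.2
  have hj : ∀ y, y ∈ range p ∪ range q → C.j (C.e y) = y := by
    rintro y (hy | hy)
    exacts [C.j_e y (hp hy).1, C.j_e y (hq hy).1]
  refine ⟨⟨⟨⟨fun z => C.j (AffineMap.lineMap (C.e (p z.2)) (C.e (q z.2)) (z.1 : ℝ)), ?_⟩, ?_, ?_⟩,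
    ?_⟩⟩
  · refine C.continuousOn_j.comp_continuous ?_ fun z => hAT (hline z)
    simp only [AffineMap.lineMap_apply_module]
    exact ((continuous_const.sub (continuous_subtype_val.comp continuous_fst)).smul
      (hp'.comp continuous_snd)).add
        ((continuous_subtype_val.comp continuous_fst).smul (hq'.comp continuous_snd))
  · intro t
    simpa using hj _ (Or.inl (mem_range_self t))
  · intro t
    simpa using hj _ (Or.inr (mem_range_self t))
  · intro s t ht
    have he : q t = p t := by
      rcases ht with rfl | rfl <;> simp
    simpa [he] using hj _ (Or.inl (mem_range_self t))

variable {z : Z}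

/-- The class of a path as a morphism of the fundamental groupoid. -/
def pathClass {x y : Z} (p : Path x y) : FundamentalGroupoid.mk x ⟶ FundamentalGroupoid.mk y :=
  FundamentalGroupoid.fromPath (Path.Homotopic.Quotient.mk p)

/-- The class of the loop obtained from the inverse of a path by joining its endpoints to the
base point. -/
noncomputable def loopClass (Γ : ∀ x, FundamentalGroupoid.mk z ⟶ FundamentalGroupoid.mk x)
    {x y : Z} (p : Path x y) : FundamentalGroup Z z :=
  Γ y ≫ Groupoid.inv (pathClass p) ≫ Groupoid.inv (Γ x)

variable (Γ : ∀ x, FundamentalGroupoid.mk z ⟶ FundamentalGroupoid.mk x) {x y w : Z}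

theorem loopClass_homotopic {p q : Path x y} (h : p.Homotopic q) :
    loopClass Γ p = loopClass Γ q := by
  have : pathClass p = pathClass q := Path.Homotopic.Quotient.eq.2 h
  rw [loopClass, this, loopClass]

theorem loopClass_trans (p : Path x y) (q : Path y w) :
    loopClass Γ (p.trans q) = loopClass Γ p * loopClass Γ q := by
  have h1 : pathClass (p.trans q) = pathClass p ≫ pathClass q :=
    Path.Homotopic.Quotient.mk_trans p q
  have h2 : loopClass Γ p * loopClass Γ q =
    (Γ w ≫ Groupoid.inv (pathClass q) ≫ Groupoid.inv (Γ y)) ≫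
      (Γ y ≫ Groupoid.inv (pathClass p) ≫ Groupoid.inv (Γ x)) := rfl
  rw [h2, loopClass, h1]
  simp

theorem loopClass_refl (x : Z) : loopClass Γ (Path.refl x) = 1 := by
  have h := loopClass_trans Γ (Path.refl x) (Path.refl x)
  rw [Path.refl_trans_refl] at h
  exact left_eq_mul.1 h

theorem loopClass_cast {x' y' : Z} (p : Path x y) (hx : x' = x) (hy : y' = y) :
    loopClass Γ (p.cast hx hy) = loopClass Γ p := by
  subst hx hy
  rfl

theorem pathClass_eq_of_loopClass_eq_one {p : Path z z} (h : loopClass Γ p = 1) :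
    pathClass p = 𝟙 _ := by
  have h : Γ z ≫ Groupoid.inv (pathClass p) ≫ Groupoid.inv (Γ z) = 𝟙 _ := h
  simp only [Groupoid.inv_eq_inv] at h
  rw [← Category.assoc, IsIso.comp_inv_eq, Category.id_comp, IsIso.comp_inv_eq] at h
  exact (cancel_epi (Γ z)).1 (by rw [← h, Category.comp_id])

end Tautological

section Metric

variable {Z : Type*} [MetricSpace Z] {z x y w : Z}

/-- A path is short if it stays in a ball around its source in which all paths with the same
endpoints are homotopic. -/
def IsShort (p : Path x y) : Prop :=
  ∃ r, IsPathTrivial (Metric.ball x r) ∧ range p ⊆ Metric.ball x r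

theorem IsShort.homotopic {p q : Path x y} (hp : IsShort p) (hq : IsShort q) : p.Homotopic q := by
  obtain ⟨r, hr, hpr⟩ := hp
  obtain ⟨r', hr', hqr'⟩ := hq
  rcases le_total r r' with h | h
  · exact hr' p q (hpr.trans (Metric.ball_subset_ball h)) hqr'
  · exact hr p q hpr (hqr'.trans (Metric.ball_subset_ball h))

variable (Γ : ∀ x, FundamentalGroupoid.mk z ⟶ FundamentalGroupoid.mk x)

open Classical in
/-- The tautological cocycle with values in the fundamental group. -/
noncomputable def tautCocycle (x y : Z) : FundamentalGroup Z z :=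
  if h : ∃ p : Path x y, IsShort p then loopClass Γ h.choose else 1

theorem tautCocycle_eq {p : Path x y} (hp : IsShort p) : tautCocycle Γ x y = loopClass Γ p := by
  have h : ∃ p : Path x y, IsShort p := ⟨p, hp⟩
  rw [tautCocycle, dif_pos h]
  exact loopClass_homotopic Γ (h.choose_spec.homotopic hp)

theorem exists_nbhd_isShort (hZ : ∀ x : Z, ∃ W ∈ 𝓝 x, IsPathTrivial W) (p : Z) :
    ∃ W ∈ 𝓝 p, ∀ x y (q : Path x y), range q ⊆ W → IsShort q := by
  obtain ⟨W, hW, hWt⟩ := hZ p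
  obtain ⟨r, hr, hrW⟩ := Metric.mem_nhds_iff.1 hW
  refine ⟨Metric.ball p (r / 3), Metric.ball_mem_nhds p (by positivity), fun x y q hq =>
    ⟨2 * r / 3, hWt.mono (Subset.trans (fun a ha => ?_) hrW), fun a ha => ?_⟩⟩
  · have h1 : dist x p < r / 3 := hq ⟨0, q.source⟩
    have h2 : dist a x < 2 * r / 3 := ha
    have := dist_triangle a x p
    rw [Metric.mem_ball]
    linarith
  · have h1 : dist x p < r / 3 := hq ⟨0, q.source⟩
    have h2 : dist a p < r / 3 := hq ha
    have := dist_triangle_right a x p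
    rw [Metric.mem_ball]
    linarith

theorem exists_isCocycleOn_tautCocycle [LocallyPathConnectedSpace Z]
    (hZ : ∀ x : Z, ∃ W ∈ 𝓝 x, IsPathTrivial W) (p : Z) :
    ∃ O ∈ 𝓝 p, IsCocycleOn (tautCocycle Γ) O := by
  obtain ⟨W, hW, hWs⟩ := exists_nbhd_isShort hZ p
  obtain ⟨O, ⟨hO, hOp⟩, hOW⟩ := (path_connected_basis p).mem_iff.1 hW
  refine ⟨O, hO, fun x hx y hy w hw => ?_⟩
  obtain ⟨q₁, hq₁⟩ := hOp.joinedIn x hx y hy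
  obtain ⟨q₂, hq₂⟩ := hOp.joinedIn y hy w hw
  have h₁ : range q₁ ⊆ W := range_subset_iff.2 fun t => hOW (hq₁ t)
  have h₂ : range q₂ ⊆ W := range_subset_iff.2 fun t => hOW (hq₂ t)
  have h₃ : range (q₁.trans q₂) ⊆ W := by
    rw [Path.trans_range]
    exact union_subset h₁ h₂
  rw [tautCocycle_eq Γ (hWs _ _ _ h₁), tautCocycle_eq Γ (hWs _ _ _ h₂),
    tautCocycle_eq Γ (hWs _ _ _ h₃), loopClass_trans]

theorem trivializes_tautCocycle (hZ : ∀ x : Z, ∃ W ∈ 𝓝 x, IsPathTrivial W) (p : Path x y) :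
    Trivializes (tautCocycle Γ) p fun t => loopClass Γ (p.subpath 0 t) := by
  intro t
  obtain ⟨W, hW, hWs⟩ := exists_nbhd_isShort hZ (p t)
  have hpre : p ⁻¹' W ∈ 𝓝 t := p.continuous.continuousAt.preimage_mem_nhds hW
  obtain ⟨a₁, a₂, -, hO, hOW⟩ := exists_Icc_mem_subset_of_mem_nhds hpre
  refine ⟨Icc a₁ a₂, hO, fun u hu v hv => ?_⟩
  have hsub : range (p.subpath u v) ⊆ W := by
    rw [Path.range_subpath]
    rintro _ ⟨a, ha, rfl⟩
    exact hOW (ordConnected_Icc.uIcc_subset hu hv ha)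
  rw [tautCocycle_eq Γ (hWs _ _ _ hsub), inv_mul_eq_iff_eq_mul, ← loopClass_trans]
  exact (loopClass_homotopic Γ ⟨Path.Homotopy.subpathTransSubpath p 0 u v⟩).symm

end Metric

/-! ### The fundamental group -/

section FundamentalGroup

theorem Trivializes.map {X E G : Type*} [Group E] [Group G] [TopologicalSpace X] {π : E →* G}
    {c : X → X → G} {s : X → X → E} {γ : I → X} {f : I → E} (hs : ∀ p, IsLiftAt π c s p)
    (hγ : Continuous γ) (h : Trivializes s γ f) : Trivializes c γ (π ∘ f) := by
  intro t
  obtain ⟨O, hO, hsO⟩ := hs (γ t)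
  obtain ⟨W, hW, hfW⟩ := h t
  refine ⟨W ∩ γ ⁻¹' O, inter_mem hW (hγ.continuousAt.preimage_mem_nhds hO), fun u hu v hv => ?_⟩
  simp only [Function.comp_apply]
  rw [← map_inv, ← map_mul, hfW u hu.1 v hv.1, hsO.map_eq _ hu.2 _ hv.2]

theorem isFreeGroup_of_exists_lift {Z : Type*} [MetricSpace Z] [LocallyPathConnectedSpace Z]
    [PathConnectedSpace Z] (hZ : ∀ x : Z, ∃ W ∈ 𝓝 x, IsPathTrivial W) (z : Z)
    (hlift : ∀ c : Z → Z → FundamentalGroup Z z, (∀ p, ∃ O ∈ 𝓝 p, IsCocycleOn c O) →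
      ∃ s, ∀ p, IsLiftAt (FreeGroup.lift (id : FundamentalGroup Z z → _)) c s p) :
    IsFreeGroup (FundamentalGroup Z z) := by
  let Γ : ∀ x, FundamentalGroupoid.mk z ⟶ FundamentalGroupoid.mk x := fun x =>
    pathClass (PathConnectedSpace.somePath z x)
  obtain ⟨s, hs⟩ := hlift (tautCocycle Γ) (exists_isCocycleOn_tautCocycle Γ hZ)
  have hs' : ∀ p, ∃ O ∈ 𝓝 p, IsCocycleOn s O := fun p => by
    obtain ⟨O, hO, h⟩ := hs p
    exact ⟨O, hO, h.cocycle⟩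
  have hrep : ∀ g : FundamentalGroup Z z, ∃ p : Path z z, pathClass p = g := fun g =>
    Quotient.exists_rep g
  choose rep hrep using hrep
  have hhol : ∀ p q : Path z z, pathClass p = pathClass q → hol hs' p = hol hs' q := fun p q h =>
    hol_homotopic hs' (Path.Homotopic.Quotient.eq.1 h)
  let ψ : FundamentalGroup Z z →* FreeGroup (FundamentalGroup Z z) :=
    MonoidHom.mk' (fun g => (hol hs' (rep g))⁻¹) fun g h => by
      have : pathClass (rep (g * h)) = pathClass ((rep h).trans (rep g)) := by
        have h1 : pathClass ((rep h).trans (rep g)) = pathClass (rep h) ≫ pathClass (rep g) :=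
          Path.Homotopic.Quotient.mk_trans _ _
        rw [h1, hrep, hrep, hrep]
        rfl
      rw [hhol _ _ this, hol_trans, mul_inv_rev]
  have hψ : Function.Injective ψ := by
    refine (injective_iff_map_eq_one ψ).2 fun g hg => ?_
    have hg : hol hs' (rep g) = 1 := inv_eq_one.1 hg
    obtain ⟨f, hf⟩ := exists_trivializes hs' (rep g).continuous
    rw [hol_eq hs' _ hf, inv_mul_eq_one] at hg
    have h1 := (hf.map hs (rep g).continuous).endpoints_eq
      (trivializes_tautCocycle Γ hZ (rep g))
    rw [Path.subpath_self, Path.subpath_zero_one, loopClass_refl, loopClass_cast, inv_one, one_mul,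
      Function.comp_apply, Function.comp_apply, hg, inv_mul_cancel] at h1
    rw [← hrep g, pathClass_eq_of_loopClass_eq_one Γ h1.symm]
    rfl
  exact IsFreeGroup.ofMulEquiv (MonoidHom.ofInjective hψ).symm

end FundamentalGroup

end LocalCocycle

/-- Every connected non-compact surface (two-dimensional topological manifold, possibly with
boundary: a Hausdorff second-countable space locally homeomorphic to open subsets of the closed
half-plane) has a free fundamental group at every basepoint. -/
theorem fundamentalGroup_free_of_noncompact_surface (Z : Type) [TopologicalSpace Z]
    [T2Space Z] [SecondCountableTopology Z] [ChartedSpace (EuclideanHalfSpace 2) Z]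
    [ConnectedSpace Z] [NoncompactSpace Z] (z : Z) :
    IsFreeGroup (FundamentalGroup Z z) := by
  have : LocallyCompactSpace (EuclideanHalfSpace 2) :=
    (isClosed_le (f := fun _ : EuclideanSpace ℝ (Fin 2) => (0 : ℝ)) continuous_const
      (by fun_prop)).isClosedEmbedding_subtypeVal.locallyCompactSpace
  have : LocallyCompactSpace Z := ChartedSpace.locallyCompactSpace (EuclideanHalfSpace 2) Z
  have : LocallyPathConnectedSpace Z :=
    ChartedSpace.locallyPathConnectedSpace (EuclideanHalfSpace 2) Z
  have : PathConnectedSpace Z := pathConnectedSpace_iff_connectedSpace.2 ‹_›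
  let _ : MetricSpace Z := TopologicalSpace.metrizableSpaceMetric Z
  refine LocalCocycle.isFreeGroup_of_exists_lift LocalCocycle.exists_isPathTrivial z fun c hc => ?_
  exact LocalCocycle.exists_global_lift (fun g => ⟨FreeGroup.of g, by simp⟩) hc
end

section
/- Let Z be a connected, non-compact surface (a two-dimensional topological manifold, possibly with boundary). Then Z is aspherical: for every point z ∈ Z and every integer k ≥ 2, the homotopy group π_k(Z, z) is trivial. -/
open scoped Topology

section

open Set Filter unitInterval

theorem continuousAt_ite_zero {X Y : Type*} [TopologicalSpace X] [TopologicalSpace Y] [Zero Y]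
    {M N : Set X} [DecidablePred (· ∈ M)] (hM : IsOpen M) (hN : IsOpen N) (hMN : Disjoint M N)
    {w : X → Y} (hw : Continuous w) {x : X} (hx : x ∈ M ∨ x ∈ N ∨ w x = 0) :
    ContinuousAt (fun y => if y ∈ M then w y else 0) x := by
  rcases hx with hx | hx | hx
  · refine hw.continuousAt.congr ?_
    filter_upwards [hM.mem_nhds hx] with y hy
    simp [hy]
  · refine (continuousAt_const (y := (0 : Y))).congr ?_
    filter_upwards [hN.mem_nhds hx] with y hy
    simp [hMN.notMem_of_mem_right hy]
  · have h0 : (if x ∈ M then w x else 0) = 0 := by split_ifs <;> simp [hx]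
    unfold ContinuousAt
    simp only [h0]
    exact Tendsto.if' (by simpa [hx] using hw.tendsto x) tendsto_const_nhds

/-- In a simply connected, locally path connected normal space, two connected open sets that
cover the space have connected intersection. -/
theorem IsPreconnected.inter_of_union_eq_univ {X : Type*} [TopologicalSpace X] [NormalSpace X]
    [SimplyConnectedSpace X] [LocallyPathConnectedSpace X] {P Q : Set X} (hPo : IsOpen P)
    (hQo : IsOpen Q) (hP : IsPreconnected P) (hQ : IsPreconnected Q) (hPQ : P ∪ Q = univ) :
    IsPreconnected (P ∩ Q) := by
  classical
  rw [isPreconnected_iff_subset_of_disjoint]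
  intro M' N' hM' hN' hcov hdis
  by_contra hcon
  rw [not_or, not_subset, not_subset] at hcon
  obtain ⟨⟨n, hn, hnM⟩, ⟨m, hm, hmN⟩⟩ := hcon
  set M := P ∩ Q ∩ M' with hMdef
  set N := P ∩ Q ∩ N' with hNdef
  have hM : IsOpen M := (hPo.inter hQo).inter hM'
  have hN : IsOpen N := (hPo.inter hQo).inter hN'
  have hMN : Disjoint M N := by
    rw [Set.disjoint_left]
    rintro x ⟨hx, hxM⟩ ⟨-, hxN⟩
    have : x ∈ P ∩ Q ∩ (M' ∩ N') := ⟨hx, hxM, hxN⟩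
    simp [hdis] at this
  have hmem : ∀ x, x ∈ P → x ∈ Q → x ∈ M ∨ x ∈ N := fun x h1 h2 => by
    rcases hcov ⟨h1, h2⟩ with h | h
    · exact Or.inl ⟨⟨h1, h2⟩, h⟩
    · exact Or.inr ⟨⟨h1, h2⟩, h⟩
  have hmM : m ∈ M := (hmem m hm.1 hm.2).resolve_right fun h => hmN h.2
  have hnN : n ∈ N := (hmem n hn.1 hn.2).resolve_left fun h => hnM h.2
  obtain ⟨u, hu0, hu1, -⟩ := exists_continuous_zero_one_of_isClosed
    hQo.isClosed_compl hPo.isClosed_compl (by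
      rw [Set.disjoint_left]
      intro x hx hx'
      rcases (hPQ ▸ mem_univ x : x ∈ P ∪ Q) with h | h
      exacts [hx' h, hx h])
  have huc : Continuous u := u.continuous
  let φ : X → AddCircle (1 : ℝ) := fun x => if x ∈ M then ((u x : ℝ) : AddCircle (1 : ℝ)) else 0
  have hφ : Continuous φ := by
    refine continuous_iff_continuousAt.2 fun x => ?_
    refine continuousAt_ite_zero (w := fun x => ((u x : ℝ) : AddCircle (1 : ℝ))) hM hN hMN
      ((AddCircle.continuous_mk' (1 : ℝ)).comp huc) ?_
    by_cases h1 : x ∈ P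
    · by_cases h2 : x ∈ Q
      · exact (hmem x h1 h2).imp_right Or.inl
      · simp [hu0 h2]
    · have : u x = 1 := hu1 h1
      simp only [this]
      exact Or.inr (Or.inr (AddCircle.coe_period (1 : ℝ)))
  obtain ⟨e, he⟩ := QuotientAddGroup.mk_surjective (φ m)
  obtain ⟨ψ, ⟨-, hψ⟩, -⟩ := (AddCircle.isCoveringMap_coe (1 : ℝ)).existsUnique_continuousMap_lifts
    ⟨φ, hφ⟩ m e he
  have hψ' : ∀ x, ((ψ x : ℝ) : AddCircle (1 : ℝ)) = φ x := fun x => congrFun hψ x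
  have hinteger : ∀ r : ℝ, (r : AddCircle (1 : ℝ)) = 0 → r ∈ range ((↑) : ℤ → ℝ) := fun r hr => by
    obtain ⟨k, hk⟩ := AddCircle.coe_eq_zero_iff (1 : ℝ) |>.1 hr
    exact ⟨k, by simpa using hk⟩
  have hdisc : IsDiscrete (range ((↑) : ℤ → ℝ)) :=
    ⟨Int.isClosedEmbedding_coe_real.isEmbedding.toHomeomorph.discreteTopology⟩
  have key : ∀ (S : Set X) (c : ℝ), IsPreconnected S → ((c : ℝ) : AddCircle (1 : ℝ)) = 0 →
      (∀ x ∈ S, x ∈ M ∨ x ∈ N ∨ u x - c = 0) →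
      ∃ k : ℝ, ∀ x ∈ S, ψ x - (if x ∈ M then u x - c else 0) = k := by
    intro S c hS hc hSx
    obtain ⟨k, -, hk⟩ := hS.eqOn_const_of_mapsTo hdisc (T := range ((↑) : ℤ → ℝ))
      (f := fun x => ψ x - (if x ∈ M then u x - c else 0))
      (fun x hx => (ψ.continuous.continuousAt.sub (continuousAt_ite_zero (w := fun x => u x - c)
        hM hN hMN (huc.sub continuous_const) (hSx x hx))).continuousWithinAt)
      (fun x hx => hinteger _ (by
        rw [AddCircle.coe_sub, hψ' x]
        by_cases h : x ∈ M <;> simp [φ, h, hc])) ⟨_, 0, rfl⟩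
    exact ⟨k, fun x hx => hk hx⟩
  obtain ⟨a, ha⟩ := key P 0 hP (by simp) fun x hx => by
    by_cases h2 : x ∈ Q
    · exact (hmem x hx h2).imp_right Or.inl
    · have : u x = 0 := hu0 h2
      simp [this]
  obtain ⟨b, hb⟩ := key Q 1 hQ (AddCircle.coe_period (1 : ℝ)) fun x hx => by
    by_cases h1 : x ∈ P
    · exact (hmem x h1 hx).imp_right Or.inl
    · have : u x = 1 := hu1 h1
      simp [this]
  have e1 := ha m hm.1
  have e2 := hb m hm.2
  have e3 := ha n hn.1
  have e4 := hb n hn.2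
  have hn' : n ∉ M := hMN.notMem_of_mem_right hnN
  simp only [hmM, hn', if_true, if_false] at e1 e2 e3 e4
  linarith

/-- The map `f` is constant on the set `A`. -/
def ContinuousMap.ConstOn {X Z : Type*} [TopologicalSpace X] [TopologicalSpace Z] (A : Set X)
    (f : C(X, Z)) : Prop :=
  ∀ a ∈ A, ∀ b ∈ A, f a = f b

theorem ContinuousMap.HomotopicWith.constOn_right {X Z : Type*} [TopologicalSpace X]
    [TopologicalSpace Z] {A : Set X} {f g : C(X, Z)}
    (h : ContinuousMap.HomotopicWith f g (ContinuousMap.ConstOn A)) : g.ConstOn A := by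
  obtain ⟨F⟩ := h
  intro a ha b hb
  have := F.prop 1 a ha b hb
  simpa using this

/-- A chart of `Z` from an open set onto a convex subset of the plane, which need not be open. -/
structure ConvexChart (Z : Type*) [TopologicalSpace Z] extends PartialEquiv Z (ℝ × ℝ) where
  isOpen_source : IsOpen source
  convex_target : Convex ℝ target
  continuousOn_toFun : ContinuousOn toFun source
  continuousOn_invFun : ContinuousOn invFun target

namespace ConvexChart

variable {X Z : Type*} [TopologicalSpace X] [TopologicalSpace Z] (φ : ConvexChart Z)

theorem continuousOn_symm_lineMap {S : Set X} {v w : X → ℝ × ℝ} {s : X → ℝ}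
    (hv : ContinuousOn v S) (hw : ContinuousOn w S) (hs : ContinuousOn s S)
    (hvt : MapsTo v S φ.target) (hwt : MapsTo w S φ.target) (hsI : MapsTo s S (Icc 0 1)) :
    ContinuousOn (fun x => φ.toPartialEquiv.symm (AffineMap.lineMap (v x) (w x) (s x))) S := by
  refine φ.continuousOn_invFun.comp ?_ fun x hx =>
    φ.convex_target.lineMap_mem (hvt hx) (hwt hx) (hsI hx)
  simp only [AffineMap.lineMap_apply_module]
  fun_prop

theorem isOpen_inter_preimage {K : Set (ℝ × ℝ)} (hK : IsOpen K) :
    IsOpen (φ.source ∩ φ.toPartialEquiv ⁻¹' K) :=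
  φ.continuousOn_toFun.isOpen_inter_preimage φ.isOpen_source hK

/-- A map that sends `U` into the domain of a convex chart and `V` into a convex part of it can be
deformed inside `U` so that both sets are sent into the convex part, provided `V` contains the
frontier of `U`. -/
theorem exists_homotopicWith_mapsTo_union [NormalSpace X] {K : Set (ℝ × ℝ)} (hK : Convex ℝ K)
    {A : Set X} (hAc : IsClosed A) {f : C(X, Z)} (hf : f.ConstOn A) {U V R : Set X}
    (hU : IsOpen U) (hV : IsOpen V) (hR : IsOpen R) (hcov : ∀ x, x ∈ U ∨ x ∈ V ∨ x ∈ R)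
    (hUR : Disjoint U R) (hAU : A ⊆ U ∨ Disjoint A U) (hAV : A ⊆ V ∨ Disjoint A V)
    (hfU : MapsTo f U φ.source) (hfV : MapsTo f V (φ.source ∩ φ.toPartialEquiv ⁻¹' K))
    (hVne : V.Nonempty) :
    ∃ g : C(X, Z), f.HomotopicWith g (ContinuousMap.ConstOn A) ∧ (∀ x ∉ U, g x = f x) ∧
      MapsTo g (U ∪ V) (φ.source ∩ φ.toPartialEquiv ⁻¹' K) := by
  classical
  obtain ⟨x₀, hx₀⟩ := hVne
  set q := φ.toPartialEquiv (f x₀) with hq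
  have hqt : q ∈ φ.target := φ.map_source (hfV hx₀).1
  have hqK : q ∈ K := (hfV hx₀).2
  have hfUV : MapsTo f (U ∪ V) φ.source := fun x hx => hx.elim (fun h => hfU h) fun h => (hfV h).1
  obtain ⟨u, hu0, hu1, huI, huA⟩ : ∃ u : C(X, ℝ), (∀ x ∉ U, u x = 0) ∧
      (∀ x, x ∉ V → x ∉ R → u x = 1) ∧ (∀ x, u x ∈ Icc (0 : ℝ) 1) ∧
      ∀ a ∈ A, ∀ b ∈ A, u a = u b := by
    by_cases hAV' : A ⊆ V
    · obtain ⟨u, h0, h1, hI⟩ := exists_continuous_zero_one_of_isClosed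
        (hU.isClosed_compl.union hAc) (hV.union hR).isClosed_compl (by
          rw [Set.disjoint_left]
          rintro x (hx | hx) hx'
          · rw [mem_compl_iff, mem_union, not_or] at hx'
            rcases hcov x with h | h | h
            exacts [hx h, hx'.1 h, hx'.2 h]
          · exact hx' (Or.inl (hAV' hx)))
      refine ⟨u, fun x hx => h0 (Or.inl hx), fun x h h' => h1 (by simp [h, h']), hI, ?_⟩
      intro a ha b hb
      rw [h0 (Or.inr ha), h0 (Or.inr hb), Pi.zero_apply, Pi.zero_apply]
    · have hAV := hAV.resolve_left hAV'
      obtain ⟨u, h0, h1, hI⟩ := exists_continuous_zero_one_of_isClosed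
        hU.isClosed_compl (hV.union hR).isClosed_compl (by
          rw [Set.disjoint_left]
          rintro x hx hx'
          rw [mem_compl_iff, mem_union, not_or] at hx'
          rcases hcov x with h | h | h
          exacts [hx h, hx'.1 h, hx'.2 h])
      refine ⟨u, fun x hx => h0 hx, fun x h h' => h1 (by simp [h, h']), hI, ?_⟩
      intro a ha b hb
      rcases hAU with h | h
      · have : ∀ c ∈ A, u c = 1 := fun c hc => h1 (by
          simp [hAV.notMem_of_mem_left hc, hUR.notMem_of_mem_left (h hc)])
        rw [this a ha, this b hb]
      · rw [h0 (h.notMem_of_mem_left ha), h0 (h.notMem_of_mem_left hb), Pi.zero_apply,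
          Pi.zero_apply]
  let H : I × X → Z := fun p => if p.2 ∈ U ∪ V then
    φ.toPartialEquiv.symm (AffineMap.lineMap (φ.toPartialEquiv (f p.2)) q ((p.1 : ℝ) * u p.2))
    else f p.2
  have hHf : ∀ p : I × X, (p.1 : ℝ) * u p.2 = 0 → H p = f p.2 := fun p hp => by
    by_cases h : p.2 ∈ U ∪ V
    · simp only [H, h, if_true, hp, AffineMap.lineMap_apply_zero]
      exact φ.left_inv (hfUV h)
    · simp only [H, h, if_false]
  have hsI : ∀ p : I × X, (p.1 : ℝ) * u p.2 ∈ Icc (0 : ℝ) 1 := fun p =>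
    ⟨mul_nonneg p.1.2.1 (huI _).1, mul_le_one₀ p.1.2.2 (huI _).1 (huI _).2⟩
  have hH : Continuous H := by
    rw [← continuousOn_univ]
    have : (univ : Set (I × X)) = Prod.snd ⁻¹' (U ∪ V) ∪ Prod.snd ⁻¹' R := by
      ext p
      simpa [or_assoc] using hcov p.2
    rw [this]
    refine ContinuousOn.union_of_isOpen ?_ ?_ ((hU.union hV).preimage continuous_snd)
      (hR.preimage continuous_snd)
    · refine (φ.continuousOn_symm_lineMap (v := fun p : I × X => φ.toPartialEquiv (f p.2))
        (w := fun _ => q) (s := fun p : I × X => (p.1 : ℝ) * u p.2)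
        (φ.continuousOn_toFun.comp (by fun_prop) fun p hp => hfUV hp) continuousOn_const
        (by fun_prop) (fun p hp => φ.map_source (hfUV hp)) (fun _ _ => hqt)
        (fun p _ => hsI p)).congr fun p hp => ?_
      have : p.2 ∈ U ∪ V := hp
      simp only [H, this, if_true]
    · refine ContinuousOn.congr (f := fun p : I × X => f p.2) (by fun_prop) fun p hp => hHf p ?_
      rw [hu0 _ (hUR.notMem_of_mem_right hp), mul_zero]
  have hHA : ∀ t : I, ∀ a ∈ A, ∀ b ∈ A, H (t, a) = H (t, b) := by
    intro t a ha b hb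
    have hab : a ∈ U ∪ V ↔ b ∈ U ∪ V := by
      have h1 : a ∈ U ↔ b ∈ U := hAU.elim (fun h => iff_of_true (h ha) (h hb))
        fun h => iff_of_false (h.notMem_of_mem_left ha) (h.notMem_of_mem_left hb)
      have h2 : a ∈ V ↔ b ∈ V := hAV.elim (fun h => iff_of_true (h ha) (h hb))
        fun h => iff_of_false (h.notMem_of_mem_left ha) (h.notMem_of_mem_left hb)
      rw [mem_union, mem_union, h1, h2]
    simp only [H, hab, hf a ha b hb, huA a ha b hb]
  refine ⟨⟨fun x => H (1, x), by fun_prop⟩, ⟨⟨⟨⟨H, hH⟩, fun x => hHf _ (by simp), fun x => rfl⟩,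
    fun t => hHA t⟩⟩, fun x hx => hHf _ (by simp [hu0 x hx]), fun x hx => ?_⟩
  have hx1 : H (1, x) = φ.toPartialEquiv.symm
      (AffineMap.lineMap (φ.toPartialEquiv (f x)) q (u x)) := by
    simp only [H, hx, if_true, Icc.coe_one, one_mul]
  have ht : AffineMap.lineMap (φ.toPartialEquiv (f x)) q (u x) ∈ φ.target :=
    φ.convex_target.lineMap_mem (φ.map_source (hfUV hx)) hqt (huI x)
  change H (1, x) ∈ _
  rw [hx1]
  refine ⟨φ.map_target ht, ?_⟩
  rw [mem_preimage, φ.right_inv ht]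
  by_cases hxV : x ∈ V
  · exact hK.lineMap_mem (hfV hxV).2 hqK (huI x)
  · have hxU : x ∈ U := hx.resolve_right hxV
    rw [hu1 x hxV (hUR.notMem_of_mem_left hxU)]
    simpa using hqK

/-- A map into a convex chart is null-homotopic. -/
theorem exists_homotopicWith_const [Nonempty X] {A : Set X} {f : C(X, Z)} (hf : f.ConstOn A)
    (hfφ : ∀ x, f x ∈ φ.source) :
    ∃ c, f.HomotopicWith (ContinuousMap.const X c) (ContinuousMap.ConstOn A) := by
  obtain ⟨x₀⟩ := ‹Nonempty X›
  refine ⟨f x₀, ⟨⟨⟨⟨fun p : I × X => φ.toPartialEquiv.symm (AffineMap.lineMap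
    (φ.toPartialEquiv (f p.2)) (φ.toPartialEquiv (f x₀)) (p.1 : ℝ)), ?_⟩,
    fun x => ?_, fun x => ?_⟩, fun t a ha b hb => ?_⟩⟩⟩
  · rw [← continuousOn_univ]
    exact φ.continuousOn_symm_lineMap (φ.continuousOn_toFun.comp (by fun_prop) fun p _ => hfφ _)
      continuousOn_const (by fun_prop) (fun p _ => φ.map_source (hfφ _))
      (fun _ _ => φ.map_source (hfφ _)) fun p _ => p.1.2
  · simpa using φ.left_inv (hfφ x)
  · simpa using φ.left_inv (hfφ x₀)
  · simp [hf a ha b hb]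

end ConvexChart

section Nerve

variable {X ι : Type*} [TopologicalSpace X]

/-- The graph recording which members of a family of sets intersect. -/
def nerveGraph (W : ι → Set X) : SimpleGraph ι where
  Adj i j := i ≠ j ∧ (W i ∩ W j).Nonempty
  symm := ⟨fun i j h => ⟨h.1.symm, by rw [inter_comm]; exact h.2⟩⟩
  loopless := ⟨fun i h => h.1 rfl⟩

theorem nerveGraph_connected [PreconnectedSpace X] [Nonempty ι] {W : ι → Set X}
    (hW : ∀ i, IsOpen (W i)) (hne : ∀ i, (W i).Nonempty) (hcov : ⋃ i, W i = univ) :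
    (nerveGraph W).Connected := by
  rw [SimpleGraph.connected_iff]
  refine ⟨fun i j => ?_, inferInstance⟩
  by_contra hij
  let S : Set ι := {k | (nerveGraph W).Reachable i k}
  have h := isPreconnected_univ (α := X) (⋃ k ∈ S, W k) (⋃ k ∈ Sᶜ, W k)
    (isOpen_biUnion fun k _ => hW k) (isOpen_biUnion fun k _ => hW k) (fun x _ => by
      obtain ⟨k, hk⟩ := mem_iUnion.1 (hcov ▸ mem_univ x : x ∈ ⋃ i, W i)
      by_cases hkS : k ∈ S
      · exact Or.inl (mem_biUnion hkS hk)
      · exact Or.inr (mem_biUnion (show k ∈ Sᶜ from hkS) hk))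
    (by
      obtain ⟨x, hx⟩ := hne i
      exact ⟨x, mem_univ x, mem_biUnion (show i ∈ S from SimpleGraph.Reachable.refl i) hx⟩)
    (by
      obtain ⟨x, hx⟩ := hne j
      exact ⟨x, mem_univ x, mem_biUnion (show j ∈ Sᶜ from hij) hx⟩)
  obtain ⟨x, -, hx1, hx2⟩ := h
  simp only [mem_iUnion, exists_prop] at hx1 hx2
  obtain ⟨k, hkS, hk⟩ := hx1
  obtain ⟨l, hlS, hl⟩ := hx2
  have hkS : (nerveGraph W).Reachable i k := hkS
  by_cases hkl : k = l
  · exact hlS (hkl ▸ hkS)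
  · exact hlS (hkS.trans (SimpleGraph.Adj.reachable (G := nerveGraph W) ⟨hkl, x, hk, hl⟩))

/-- In a space where connected open sets that cover have connected intersection, a finite cover
by at least two connected open sets without triple intersections has a member that meets
exactly one other. -/
theorem exists_leaf [PreconnectedSpace X] [Finite ι] [Nontrivial ι] {W : ι → Set X}
    (hX : ∀ P Q : Set X, IsOpen P → IsOpen Q → IsPreconnected P → IsPreconnected Q →
      P ∪ Q = univ → IsPreconnected (P ∩ Q))
    (hW : ∀ i, IsOpen (W i)) (hconn : ∀ i, IsConnected (W i)) (hcov : ⋃ i, W i = univ)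
    (htriple : ∀ i j k, i ≠ j → i ≠ k → j ≠ k → W i ∩ W j ∩ W k = ∅) :
    ∃ i j, i ≠ j ∧ ∀ k, k ≠ i → k ≠ j → Disjoint (W i) (W k) := by
  have hG := nerveGraph_connected hW (fun i => (hconn i).nonempty) hcov
  obtain ⟨v, hv⟩ := hG.exists_connected_induce_compl_singleton_of_finite_nontrivial
  have hP : IsPreconnected (⋃ i : ({v}ᶜ : Set ι), W i) := by
    refine IsPreconnected.iUnion_of_reflTransGen (fun i => (hconn i).isPreconnected) fun i j => ?_
    have := (SimpleGraph.reachable_iff_reflTransGen i j).1 (hv.preconnected i j)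
    exact Relation.ReflTransGen.mono (fun a b hab => hab.2) _ _ this
  have hPo : IsOpen (⋃ i : ({v}ᶜ : Set ι), W i) := isOpen_iUnion fun i => hW i
  have hunion : (⋃ i : ({v}ᶜ : Set ι), W i) ∪ W v = univ := by
    refine eq_univ_of_forall fun x => ?_
    obtain ⟨k, hk⟩ := mem_iUnion.1 (hcov ▸ mem_univ x : x ∈ ⋃ i, W i)
    by_cases hkv : k = v
    · exact Or.inr (hkv ▸ hk)
    · exact Or.inl (mem_iUnion.2 ⟨⟨k, hkv⟩, hk⟩)
  have hPQ := hX _ _ hPo (hW v) hP (hconn v).isPreconnected hunion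
  by_cases hall : ∀ k, k ≠ v → Disjoint (W v) (W k)
  · obtain ⟨j, hj⟩ := exists_ne v
    exact ⟨v, j, hj.symm, fun k hk _ => hall k hk⟩
  push Not at hall
  obtain ⟨j, hjv, hj⟩ := hall
  refine ⟨v, j, hjv.symm, fun k hkv hkj => ?_⟩
  by_contra hk
  rw [Set.not_disjoint_iff] at hj hk
  obtain ⟨x, hxv, hxj⟩ := hj
  obtain ⟨y, hyv, hyk⟩ := hk
  obtain ⟨z, hz, hz1, hz2⟩ := hPQ (W j) (⋃ i ∈ ({v, j}ᶜ : Set ι), W i) (hW j)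
    (isOpen_biUnion fun i _ => hW i) (fun z hz => by
      obtain ⟨i, hi⟩ := mem_iUnion.1 hz.1
      by_cases hij : i.1 = j
      · exact Or.inl (hij ▸ hi)
      · refine Or.inr (mem_biUnion (x := i.1) ?_ hi)
        simp only [mem_compl_iff, mem_insert_iff, mem_singleton_iff, not_or]
        exact ⟨i.2, hij⟩)
    ⟨x, ⟨mem_iUnion.2 ⟨⟨j, hjv⟩, hxj⟩, hxv⟩, hxj⟩
    ⟨y, ⟨mem_iUnion.2 ⟨⟨k, hkv⟩, hyk⟩, hyv⟩, mem_biUnion (x := k) (by simp [hkv, hkj]) hyk⟩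
  simp only [mem_iUnion, exists_prop, mem_compl_iff, mem_insert_iff, mem_singleton_iff,
    not_or] at hz2
  obtain ⟨l, ⟨hlv, hlj⟩, hl⟩ := hz2
  have : z ∈ W v ∩ W j ∩ W l := ⟨⟨hz.2, hz1⟩, hl⟩
  rw [htriple v j l hjv.symm (Ne.symm hlv) (Ne.symm hlj)] at this
  exact this

end Nerve

/-- A map that sends the members of a finite cover without triple intersections by connected open
sets into convex parts of charts is null-homotopic, provided the parts are small enough. -/
theorem exists_homotopicWith_const_of_cover {X Z J : Type*} [TopologicalSpace X]
    [TopologicalSpace Z] [NormalSpace X] [ConnectedSpace X]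
    (hX : ∀ P Q : Set X, IsOpen P → IsOpen Q → IsPreconnected P → IsPreconnected Q →
      P ∪ Q = univ → IsPreconnected (P ∩ Q))
    {φ : J → ConvexChart Z} {K : J → Set (ℝ × ℝ)} (hK : ∀ j, Convex ℝ (K j))
    (hφ : ∀ i j, (((φ i).source ∩ (φ i).toPartialEquiv ⁻¹' K i) ∩
      ((φ j).source ∩ (φ j).toPartialEquiv ⁻¹' K j)).Nonempty →
      (φ i).source ∩ (φ i).toPartialEquiv ⁻¹' K i ⊆ (φ j).source)
    {A : Set X} (hA : IsClosed A) (n : ℕ) {ι : Type} [Finite ι] (hn : Nat.card ι = n + 1)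
    {W : ι → Set X} (hW : ∀ i, IsOpen (W i)) (hconn : ∀ i, IsConnected (W i))
    (hcov : ⋃ i, W i = univ)
    (htriple : ∀ i j k, i ≠ j → i ≠ k → j ≠ k → W i ∩ W j ∩ W k = ∅)
    (hAW : ∀ i, A ⊆ W i ∨ Disjoint A (W i)) {f : C(X, Z)} (hf : f.ConstOn A) {β : ι → J}
    (hβ : ∀ i, MapsTo f (W i) ((φ (β i)).source ∩ (φ (β i)).toPartialEquiv ⁻¹' K (β i))) :
    ∃ c, f.HomotopicWith (ContinuousMap.const X c) (ContinuousMap.ConstOn A) := by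
  classical
  induction n generalizing ι f with
  | zero =>
    rw [zero_add, Nat.card_eq_one_iff_exists] at hn
    obtain ⟨i, hi⟩ := hn
    refine (φ (β i)).exists_homotopicWith_const hf fun x => ?_
    obtain ⟨k, hk⟩ := mem_iUnion.1 (hcov ▸ mem_univ x : x ∈ ⋃ i, W i)
    exact (hβ i (hi k ▸ hk)).1
  | succ n ih =>
    have hnt : Nontrivial ι := Finite.one_lt_card_iff_nontrivial.1 (by lia)
    obtain ⟨a, b, hab, hleaf⟩ := exists_leaf hX hW hconn hcov htriple
    have hmeet : (W a ∩ W b).Nonempty := by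
      by_contra h
      rw [Set.not_nonempty_iff_eq_empty, ← Set.disjoint_iff_inter_eq_empty] at h
      have hadj : ∀ k, ¬ (nerveGraph W).Adj a k := fun k hk => by
        by_cases hkb : k = b
        · exact Set.not_disjoint_iff_nonempty_inter.2 hk.2 (hkb ▸ h)
        · exact Set.not_disjoint_iff_nonempty_inter.2 hk.2 (hleaf k hk.1.symm hkb)
      obtain ⟨k, hk⟩ := (nerveGraph_connected hW (fun i => (hconn i).nonempty)
        hcov).preconnected.exists_adj_of_nontrivial a
      exact hadj k hk
    obtain ⟨x, hxa, hxb⟩ := hmeet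
    have hsub := hφ (β a) (β b) ⟨f x, hβ a hxa, hβ b hxb⟩
    obtain ⟨g, hfg, hg1, hg2⟩ := (φ (β b)).exists_homotopicWith_mapsTo_union (hK (β b)) hA hf
      (hW a) (hW b) (R := ⋃ k ∈ ({a, b}ᶜ : Set ι), W k) (isOpen_biUnion fun k _ => hW k)
      (fun y => by
        obtain ⟨k, hk⟩ := mem_iUnion.1 (hcov ▸ mem_univ y : y ∈ ⋃ i, W i)
        by_cases hka : k = a
        · exact Or.inl (hka ▸ hk)
        by_cases hkb : k = b
        · exact Or.inr (Or.inl (hkb ▸ hk))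
        exact Or.inr (Or.inr (mem_biUnion (x := k) (by simp [hka, hkb]) hk)))
      (by
        simp only [mem_compl_iff, mem_insert_iff, mem_singleton_iff, not_or,
          disjoint_iUnion_right]
        exact fun k hk => hleaf k hk.1 hk.2)
      (hAW a) (hAW b) (fun y hy => hsub (hβ a hy)) (hβ b) ⟨x, hxb⟩
    let W' : {i // i ≠ a} → Set X := fun i => if i.1 = b then W a ∪ W b else W i
    have hW'b : ∀ i : {i // i ≠ a}, i.1 = b → W' i = W a ∪ W b := fun i hi => by simp [W', hi]
    have hW'n : ∀ i : {i // i ≠ a}, i.1 ≠ b → W' i = W i := fun i hi => by simp [W', hi]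
    have hdisj : ∀ i : {i // i ≠ a}, i.1 ≠ b → Disjoint (W a) (W i) := fun i hi =>
      hleaf i i.2 hi
    have hcard : Nat.card {i // i ≠ a} = n + 1 := by
      have := Fintype.ofFinite ι
      rw [Nat.card_eq_fintype_card] at hn ⊢
      rw [Fintype.card_subtype_compl, hn]
      simp
    have hW's : ∀ i j : {i // i ≠ a}, i ≠ j → W' i ∩ W' j = W i ∩ W j := fun i j hij => by
      have hij' : i.1 ≠ j.1 := fun h => hij (Subtype.ext h)
      by_cases hi : i.1 = b
      · have hj : j.1 ≠ b := fun h => hij' (hi.trans h.symm)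
        rw [hW'b i hi, hW'n j hj, union_inter_distrib_right, (hdisj j hj).inter_eq, empty_union, hi]
      · by_cases hj : j.1 = b
        · rw [hW'b j hj, hW'n i hi, inter_union_distrib_left, inter_comm, (hdisj i hi).inter_eq,
            empty_union, hj]
        · rw [hW'n i hi, hW'n j hj]
    obtain ⟨c, hc⟩ := ih hcard (W := W') (β := fun i => β i)
      (fun i => by
        by_cases hi : i.1 = b
        · rw [hW'b i hi]; exact (hW a).union (hW b)
        · rw [hW'n i hi]; exact hW i)
      (fun i => by
        by_cases hi : i.1 = b
        · rw [hW'b i hi]; exact IsConnected.union ⟨x, hxa, hxb⟩ (hconn a) (hconn b)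
        · rw [hW'n i hi]; exact hconn i)
      (eq_univ_of_forall fun y => by
        obtain ⟨k, hk⟩ := mem_iUnion.1 (hcov ▸ mem_univ y : y ∈ ⋃ i, W i)
        rw [mem_iUnion]
        by_cases hka : k = a
        · exact ⟨⟨b, hab.symm⟩, by rw [hW'b _ rfl]; exact Or.inl (hka ▸ hk)⟩
        · refine ⟨⟨k, hka⟩, ?_⟩
          by_cases hkb : k = b
          · rw [hW'b _ hkb]; exact Or.inr (hkb ▸ hk)
          · rw [hW'n _ hkb]; exact hk)
      (fun i j k hij hik hjk => by
        have h1 := hW's i j hij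
        have h2 := hW's i k hik
        have h3 : W' i ∩ W' j ∩ W' k = (W' i ∩ W' j) ∩ (W' i ∩ W' k) := by
          ext; simp only [mem_inter_iff]; tauto
        rw [h3, h1, h2, ← subset_empty_iff, ← htriple i j k (fun h => hij (Subtype.ext h))
          (fun h => hik (Subtype.ext h)) (fun h => hjk (Subtype.ext h))]
        exact fun y hy => ⟨hy.1, hy.2.2⟩)
      (fun i => by
        by_cases hi : i.1 = b
        · rw [hW'b i hi]
          rcases hAW a with h | h
          · exact Or.inl (h.trans subset_union_left)
          · rcases hAW b with h' | h'
            · exact Or.inl (h'.trans subset_union_right)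
            · exact Or.inr (disjoint_union_right.2 ⟨h, h'⟩)
        · rw [hW'n i hi]; exact hAW i)
      hfg.constOn_right
      (fun i => by
        by_cases hi : i.1 = b
        · rw [hW'b i hi, hi]; exact hg2
        · rw [hW'n i hi]
          intro y hy
          rw [hg1 y ((hdisj i hi).notMem_of_mem_right hy)]
          exact hβ i hy)
    exact ⟨c, hfg.trans hc⟩

/-- Radial projection of a convex body onto its frontier. -/
theorem exists_radial_projection {E : Type*} [NormedAddCommGroup E] [NormedSpace ℝ E] {D : Set E}
    (hD : Convex ℝ D) (hDc : IsCompact D) {p : E} (hp : p ∈ interior D) :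
    ∃ q : E → E, ContinuousOn q {p}ᶜ ∧ (∀ x, x ≠ p → q x ∈ frontier D) ∧
      ∀ x ∈ frontier D, q x = x := by
  let e : E ≃ₜ E := Homeomorph.addLeft p
  have he : ∀ x, e x = p + x := fun _ => rfl
  set D' : Set E := e ⁻¹' D with hD'
  have hconv : Convex ℝ D' := hD.translate_preimage_right p
  have hcomp : IsCompact D' := e.isCompact_preimage.2 hDc
  have h0 : D' ∈ 𝓝 (0 : E) := by
    refine e.continuous.continuousAt.preimage_mem_nhds ?_
    rw [he, add_zero]
    exact mem_interior_iff_mem_nhds.1 hp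
  have hfr : ∀ x, gauge D' x = 1 ↔ p + x ∈ frontier D := fun x => by
    rw [gauge_eq_one_iff_mem_frontier hconv h0, hD', ← e.preimage_frontier, mem_preimage, he]
  have hpos : ∀ x, 0 < gauge D' x ↔ x ≠ 0 := fun x =>
    gauge_pos (absorbent_nhds_zero h0) ((NormedSpace.isVonNBounded_iff ℝ).2 hcomp.isBounded)
  have hcont : Continuous (gauge D') := continuous_gauge hconv h0
  refine ⟨fun x => p + (gauge D' (x - p))⁻¹ • (x - p), ?_, fun x hx => ?_, fun x hx => ?_⟩
  · refine continuousOn_const.add (ContinuousOn.smul (ContinuousOn.inv₀ (by fun_prop) ?_)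
      (by fun_prop))
    exact fun x hx => ((hpos _).2 (sub_ne_zero.2 hx)).ne'
  · have h := (hpos (x - p)).2 (sub_ne_zero.2 hx)
    rw [← hfr, gauge_smul_of_nonneg (inv_nonneg.2 h.le), smul_eq_mul, inv_mul_cancel₀ h.ne']
  · have : gauge D' (x - p) = 1 := (hfr _).2 (by simpa using hx)
    simp [this]

/-- A convex chart together with a nondegenerate closed box in its target. -/
structure ChartBox (Z : Type*) [TopologicalSpace Z] extends ConvexChart Z where
  lower : ℝ × ℝ
  upper : ℝ × ℝ
  lower_fst_lt : lower.1 < upper.1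
  lower_snd_lt : lower.2 < upper.2
  Icc_subset_target : Icc lower upper ⊆ target

/-- A set is thin if it is a finite union of compact sets that embed into the line. -/
def IsThin {Z : Type*} [TopologicalSpace Z] (T : Set Z) : Prop :=
  ∃ F : Set (Set Z), F.Finite ∧ ⋃₀ F = T ∧
    ∀ S ∈ F, IsCompact S ∧ ∃ h : Z → ℝ, ContinuousOn h S ∧ InjOn h S

theorem IsThin.union {Z : Type*} [TopologicalSpace Z] {S T : Set Z} (hS : IsThin S)
    (hT : IsThin T) : IsThin (S ∪ T) := by
  obtain ⟨F, hF, rfl, hF'⟩ := hS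
  obtain ⟨G, hG, rfl, hG'⟩ := hT
  exact ⟨F ∪ G, hF.union hG, sUnion_union F G, fun S hS => hS.elim (hF' S) (hG' S)⟩

theorem IsThin.isCompact {Z : Type*} [TopologicalSpace Z] {T : Set Z} (hT : IsThin T) :
    IsCompact T := by
  obtain ⟨F, hF, rfl, hF'⟩ := hT
  exact hF.isCompact_sUnion fun S hS => (hF' S hS).1

namespace ChartBox

variable {X Z : Type*} [TopologicalSpace X] [TopologicalSpace Z] (B : ChartBox Z)

/-- The part of the space parametrized by the box. -/
def region : Set Z := B.source ∩ B.toPartialEquiv ⁻¹' Icc B.lower B.upper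

/-- The part of the space parametrized by the interior of the box. -/
def core : Set Z := B.source ∩ B.toPartialEquiv ⁻¹' interior (Icc B.lower B.upper)

/-- The part of the space parametrized by the frontier of the box. -/
def rim : Set Z := B.source ∩ B.toPartialEquiv ⁻¹' frontier (Icc B.lower B.upper)

theorem interior_nonempty : (interior (Icc B.lower B.upper)).Nonempty := by
  rw [← Prod.mk.eta (p := B.lower), ← Prod.mk.eta (p := B.upper), ← Icc_prod_Icc,
    interior_prod_eq, interior_Icc, interior_Icc]
  exact (nonempty_Ioo.2 B.lower_fst_lt).prod (nonempty_Ioo.2 B.lower_snd_lt)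

theorem region_eq : B.region = B.core ∪ B.rim := by
  rw [region, core, rim, ← inter_union_distrib_left, ← preimage_union, ←
    closure_eq_interior_union_frontier,
    isClosed_Icc.closure_eq]

theorem rim_subset_region : B.rim ⊆ B.region := by
  rw [region_eq]
  exact subset_union_right

theorem isOpen_core : IsOpen B.core := B.isOpen_inter_preimage isOpen_interior

theorem disjoint_core_rim : Disjoint B.core B.rim :=
  (disjoint_interior_frontier.preimage _).mono inter_subset_right inter_subset_right

theorem isCompact_inter_preimage {S : Set (ℝ × ℝ)} (hS : IsCompact S)
    (h : S ⊆ Icc B.lower B.upper) : IsCompact (B.source ∩ B.toPartialEquiv ⁻¹' S) := by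
  have ht := h.trans B.Icc_subset_target
  rw [← B.toPartialEquiv.symm_image_eq_source_inter_preimage ht]
  exact hS.image_of_continuousOn (B.continuousOn_invFun.mono ht)

theorem isCompact_region : IsCompact B.region :=
  B.isCompact_inter_preimage isCompact_Icc Subset.rfl

theorem isThin_rim : IsThin B.rim := by
  have key : ∀ S : Set (ℝ × ℝ), IsCompact S → S ⊆ Icc B.lower B.upper → ∀ h : ℝ × ℝ → ℝ,
      Continuous h → InjOn h S → IsThin (B.source ∩ B.toPartialEquiv ⁻¹' S) := by
    intro S hS hSB h hh hinj
    refine ⟨{B.source ∩ B.toPartialEquiv ⁻¹' S}, finite_singleton _, sUnion_singleton _, ?_⟩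
    rintro _ rfl
    exact ⟨B.isCompact_inter_preimage hS hSB, h ∘ B.toPartialEquiv,
      hh.comp_continuousOn (B.continuousOn_toFun.mono inter_subset_left),
      hinj.comp (B.injOn.mono inter_subset_left) fun x hx => hx.2⟩
  have h1 := B.lower_fst_lt.le
  have h2 := B.lower_snd_lt.le
  have hfr : frontier (Icc B.lower B.upper) =
      ((Icc B.lower.1 B.upper.1 ×ˢ {B.lower.2}) ∪ (Icc B.lower.1 B.upper.1 ×ˢ {B.upper.2})) ∪
      (({B.lower.1} ×ˢ Icc B.lower.2 B.upper.2) ∪ ({B.upper.1} ×ˢ Icc B.lower.2 B.upper.2)) := by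
    rw [← Prod.mk.eta (p := B.lower), ← Prod.mk.eta (p := B.upper), ← Icc_prod_Icc,
      frontier_prod_eq, frontier_Icc h1, frontier_Icc h2,
      isClosed_Icc.closure_eq, isClosed_Icc.closure_eq, insert_eq, insert_eq, prod_union,
      union_prod]
  rw [rim, hfr]
  simp only [preimage_union, inter_union_distrib_left]
  have hfst : ∀ (s : Set ℝ) (c : ℝ), InjOn (Prod.fst : ℝ × ℝ → ℝ) (s ×ˢ {c}) := by
    rintro s c ⟨a, b⟩ ⟨-, hb⟩ ⟨a', b'⟩ ⟨-, hb'⟩ h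
    exact Prod.ext h (Eq.trans hb (Eq.symm hb'))
  have hsnd : ∀ (s : Set ℝ) (c : ℝ), InjOn (Prod.snd : ℝ × ℝ → ℝ) ({c} ×ˢ s) := by
    rintro s c ⟨a, b⟩ ⟨hb, -⟩ ⟨a', b'⟩ ⟨hb', -⟩ h
    exact Prod.ext (Eq.trans hb (Eq.symm hb')) h
  refine ((key _ (isCompact_Icc.prod isCompact_singleton) ?_ _ continuous_fst (hfst _ _)).union
    (key _ (isCompact_Icc.prod isCompact_singleton) ?_ _ continuous_fst (hfst _ _))).union
    ((key _ (isCompact_singleton.prod isCompact_Icc) ?_ _ continuous_snd (hsnd _ _)).union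
    (key _ (isCompact_singleton.prod isCompact_Icc) ?_ _ continuous_snd (hsnd _ _)))
  all_goals
    rintro ⟨x, y⟩ ⟨hx, hy⟩
    simp only [mem_Icc, mem_singleton_iff] at hx hy
    simp only [mem_Icc, Prod.le_def]
    subst_vars
    refine ⟨⟨?_, ?_⟩, ?_, ?_⟩ <;> simp_all

theorem inter_core_nonempty {O : Set Z} (hO : IsOpen O) (h : (B.region ∩ O).Nonempty) :
    (O ∩ B.core).Nonempty := by
  obtain ⟨x, ⟨hxs, hxB⟩, hxO⟩ := h
  have hcl : B.toPartialEquiv x ∈ closure (interior (Icc B.lower B.upper)) := by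
    rw [(convex_Icc (𝕜 := ℝ) B.lower B.upper).closure_interior_eq_closure_of_nonempty_interior
      B.interior_nonempty]
    exact subset_closure hxB
  have hxt : B.toPartialEquiv x ∈ B.target := B.map_source hxs
  have hcont : ContinuousWithinAt B.toPartialEquiv.symm B.target (B.toPartialEquiv x) :=
    B.continuousOn_invFun _ hxt
  have hnhds : B.toPartialEquiv.symm ⁻¹' O ∈ 𝓝[B.target] (B.toPartialEquiv x) :=
    hcont.preimage_mem_nhdsWithin (by
      rw [B.left_inv hxs]
      exact hO.mem_nhds hxO)
  obtain ⟨N, hN, hNs⟩ := mem_nhdsWithin_iff_exists_mem_nhds_inter.1 hnhds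
  obtain ⟨y, hyN, hy⟩ := mem_closure_iff_nhds.1 hcl N hN
  have hyt : y ∈ B.target := B.Icc_subset_target (interior_subset hy)
  refine ⟨B.toPartialEquiv.symm y, hNs ⟨hyN, hyt⟩, B.map_target hyt, ?_⟩
  rwa [mem_preimage, B.right_inv hyt]

theorem interior_rim : interior B.rim = ∅ := by
  by_contra h
  obtain ⟨x, hx⟩ := Set.nonempty_iff_ne_empty.2 h
  obtain ⟨y, hy, hy'⟩ := B.inter_core_nonempty isOpen_interior
    ⟨x, B.rim_subset_region (interior_subset hx), hx⟩
  exact B.disjoint_core_rim.notMem_of_mem_left hy' (interior_subset hy)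

/-- A map that misses a point of the core of a box can be pushed into the complement of the core. -/
theorem exists_homotopicWith_push [T2Space Z] {A : Set X} {f : C(X, Z)} (hf : f.ConstOn A) {z : Z}
    (hz : z ∈ B.core) (hfz : ∀ x, f x ≠ z) :
    ∃ g : C(X, Z), f.HomotopicWith g (ContinuousMap.ConstOn A) ∧
      ∀ x, (f x ∉ B.region ∧ g x = f x) ∨ g x ∈ B.rim := by
  classical
  obtain ⟨q, hq, hqfr, hqid⟩ := exists_radial_projection (convex_Icc B.lower B.upper)
    isCompact_Icc hz.2
  have hne : ∀ x, f x ∈ B.region → B.toPartialEquiv (f x) ≠ B.toPartialEquiv z := fun x hx h =>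
    hfz x (B.injOn hx.1 hz.1 h)
  have hfrt : frontier (Icc B.lower B.upper) ⊆ Icc B.lower B.upper :=
    isClosed_Icc.frontier_subset
  let H : I × X → Z := fun p => if f p.2 ∈ B.region then B.toPartialEquiv.symm
    (AffineMap.lineMap (B.toPartialEquiv (f p.2)) (q (B.toPartialEquiv (f p.2))) (p.1 : ℝ))
    else f p.2
  have hH1 : ∀ p : I × X, f p.2 ∈ B.region → H p = B.toPartialEquiv.symm
      (AffineMap.lineMap (B.toPartialEquiv (f p.2)) (q (B.toPartialEquiv (f p.2))) (p.1 : ℝ)) :=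
    fun p hp => by simp only [H, hp, if_true]
  have hH2 : ∀ p : I × X, f p.2 ∉ B.core → H p = f p.2 := fun p hp => by
    by_cases h : f p.2 ∈ B.region
    · have hr : f p.2 ∈ B.rim := by
        rw [region_eq] at h
        exact h.resolve_left hp
      rw [hH1 p h, hqid _ hr.2, AffineMap.lineMap_same_apply]
      exact B.left_inv h.1
    · simp only [H, h, if_false]
  have hH : Continuous H := by
    rw [← continuousOn_univ]
    have : (univ : Set (I × X)) = {p | f p.2 ∈ B.region} ∪ {p | f p.2 ∈ B.coreᶜ} := by
      ext p
      rw [region_eq]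
      simp only [mem_univ, mem_union, mem_ofPred_eq, mem_compl_iff, true_iff]
      tauto
    rw [this]
    refine ContinuousOn.union_of_isClosed ?_ ?_
      (B.isCompact_region.isClosed.preimage (by fun_prop : Continuous fun p : I × X => f p.2))
      (B.isOpen_core.isClosed_compl.preimage (by fun_prop : Continuous fun p : I × X => f p.2))
    · have hcont : ContinuousOn (fun p : I × X => B.toPartialEquiv (f p.2))
          {p | f p.2 ∈ B.region} :=
        B.continuousOn_toFun.comp (by fun_prop) fun p hp => hp.1
      refine (B.continuousOn_symm_lineMap (v := fun p : I × X => B.toPartialEquiv (f p.2))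
        (w := fun p : I × X => q (B.toPartialEquiv (f p.2))) (s := fun p : I × X => (p.1 : ℝ))
        hcont (hq.comp hcont fun p hp => hne _ hp) (by fun_prop)
        (fun p hp => B.map_source hp.1)
        (fun p hp => B.Icc_subset_target (hfrt (hqfr _ (hne _ hp))))
        (fun p _ => p.1.2)).congr fun p hp => hH1 p hp
    · exact ContinuousOn.congr (f := fun p : I × X => f p.2) (by fun_prop) fun p hp => hH2 p hp
  refine ⟨⟨fun x => H (1, x), by fun_prop⟩, ⟨⟨⟨⟨H, hH⟩, fun x => ?_, fun x => rfl⟩,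
    fun t a ha b hb => ?_⟩⟩, fun x => ?_⟩
  · change H (0, x) = f x
    by_cases h : f x ∈ B.region
    · rw [hH1 _ h]
      simpa using B.left_inv h.1
    · simp only [H, h, if_false]
  · change H (t, a) = H (t, b)
    simp only [H, hf a ha b hb]
  · change (_ ∧ H (1, x) = f x) ∨ H (1, x) ∈ B.rim
    by_cases h : f x ∈ B.region
    · right
      have hfr := hqfr _ (hne x h)
      have ht := B.Icc_subset_target (hfrt hfr)
      rw [hH1 _ h]
      simp only [Icc.coe_one, AffineMap.lineMap_apply_one]
      refine ⟨B.map_target ht, ?_⟩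
      rwa [mem_preimage, B.right_inv ht]
    · left
      exact ⟨h, by simp only [H, h, if_false]⟩

/-- Sets covered by a chain of boxes starting at `B`, together with the union of the rims. -/
inductive Reach (B : ChartBox Z) : Set Z → Set Z → Prop
  | base : Reach B B.region B.rim
  | step {S T : Set Z} (B' : ChartBox Z) : Reach B S T → (B'.region ∩ interior S).Nonempty →
      Reach B (S ∪ B'.region) (T ∪ B'.rim)

variable {B}

theorem Reach.subset_left {S T : Set Z} (h : B.Reach S T) : B.region ⊆ S := by
  induction h with
  | base => exact Subset.rfl
  | step B' _ _ ih => exact ih.trans subset_union_left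

theorem Reach.exists_union {S T S' T' : Set Z} (h : B.Reach S T) (h' : B.Reach S' T') :
    ∃ S'' T'', B.Reach S'' T'' ∧ S ∪ S' ⊆ S'' := by
  induction h' with
  | base => exact ⟨S, T, h, union_subset Subset.rfl h.subset_left⟩
  | step B' _ hne ih =>
    obtain ⟨S'', T'', h'', hsub⟩ := ih
    refine ⟨_, _, h''.step B' (hne.mono (inter_subset_inter_right _
      (interior_mono (subset_union_right.trans hsub)))), ?_⟩
    rw [← union_assoc]
    exact union_subset_union_left _ hsub

theorem Reach.thin {S T : Set Z} (h : B.Reach S T) : IsThin T := by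
  induction h with
  | base => exact B.isThin_rim
  | step B' _ _ ih => exact ih.union B'.isThin_rim

theorem Reach.interior_eq_empty [T2Space Z] {S T : Set Z} (h : B.Reach S T) : interior T = ∅ := by
  induction h with
  | base => exact B.interior_rim
  | step B' h _ ih =>
    rw [interior_union_isClosed_of_interior_empty h.thin.isCompact.isClosed B'.interior_rim, ih]

theorem Reach.exists_homotopicWith [T2Space Z] {S T : Set Z} (h : B.Reach S T) {A : Set X}
    {f : C(X, Z)} (hf : f.ConstOn A) {z : Z} (hz : z ∈ B.core) (hfz : ∀ x, f x ≠ z) :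
    ∃ g : C(X, Z), f.HomotopicWith g (ContinuousMap.ConstOn A) ∧
      ∀ x, (f x ∉ S ∧ g x = f x) ∨ g x ∈ T := by
  induction h with
  | base => exact B.exists_homotopicWith_push hf hz hfz
  | @step S T B' h hne ih =>
    obtain ⟨g, hfg, hg⟩ := ih
    have hO : IsOpen (interior S ∩ B'.core) := isOpen_interior.inter B'.isOpen_core
    obtain ⟨w, hw⟩ := B'.inter_core_nonempty isOpen_interior hne
    obtain ⟨v, hv, hvT⟩ : ∃ v ∈ interior S ∩ B'.core, v ∉ T := by
      by_contra! hcon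
      have := interior_maximal hcon hO hw
      rw [h.interior_eq_empty] at this
      exact this
    have hgv : ∀ x, g x ≠ v := fun x hx => by
      rcases hg x with ⟨h1, h2⟩ | h1
      · exact h1 (h2 ▸ hx ▸ interior_subset hv.1)
      · exact hvT (hx ▸ h1)
    obtain ⟨g', hgg', hg'⟩ := B'.exists_homotopicWith_push hfg.constOn_right hv.2 hgv
    refine ⟨g', hfg.trans hgg', fun x => ?_⟩
    rcases hg' x with ⟨h1, h2⟩ | h1
    · rcases hg x with ⟨h3, h4⟩ | h3
      · refine Or.inl ⟨?_, h2.trans h4⟩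
        rintro (h | h)
        exacts [h3 h, h1 (h4 ▸ h)]
      · exact Or.inr (Or.inl (h2 ▸ h3))
    · exact Or.inr (Or.inr h1)

end ChartBox

/-- Every point of a surface lies in the interior of an arbitrarily small chart box. -/
theorem exists_chartBox {Z : Type*} [TopologicalSpace Z] [ChartedSpace (EuclideanHalfSpace 2) Z]
    (y : Z) {N : Set Z} (hN : N ∈ 𝓝 y) :
    ∃ B : ChartBox Z, y ∈ B.source ∧ B.source ⊆ N ∧ B.region ∈ 𝓝 y := by
  set c := chartAt (EuclideanHalfSpace 2) y with hc
  have hyc : y ∈ c.source := mem_chart_source _ y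
  let k : EuclideanHalfSpace 2 → ℝ × ℝ := fun x => (x.1 0, x.1 1)
  have hk : Continuous k := by fun_prop
  let j : ℝ × ℝ → EuclideanHalfSpace 2 := fun p => ⟨!₂[max p.1 0, p.2], by simp⟩
  have hj : Continuous j := by
    refine Continuous.subtype_mk ?_ _
    refine (PiLp.continuous_toLp 2 _).comp ?_
    refine continuous_pi fun i => ?_
    fin_cases i <;> simp <;> fun_prop
  have hjk : ∀ x, j (k x) = x := fun x => by
    refine Subtype.ext ?_
    ext i
    fin_cases i
    · simpa [j, k] using x.2
    · simp [j, k]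
  have hkj : ∀ p : ℝ × ℝ, 0 ≤ p.1 → k (j p) = p := fun p hp => by
    refine Prod.ext ?_ ?_ <;> simp [j, k, hp]
  have hk0 : ∀ x, 0 ≤ (k x).1 := fun x => x.2
  have hS : c.target ∩ c.symm ⁻¹' interior N ∈ 𝓝 (j (k (c y))) := by
    rw [hjk]
    refine (c.symm.isOpen_inter_preimage isOpen_interior).mem_nhds ⟨c.map_source hyc, ?_⟩
    rw [mem_preimage, c.left_inv hyc]
    exact mem_interior_iff_mem_nhds.2 hN
  obtain ⟨ε, hε, hball⟩ := Metric.mem_nhds_iff.1 (hj.continuousAt.preimage_mem_nhds hS)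
  set u := k (c y) with hu
  have hu0 : 0 ≤ u.1 := hk0 _
  let φ : ConvexChart Z :=
    { toFun := fun z => k (c z)
      invFun := fun p => c.symm (j p)
      source := c.source ∩ c ⁻¹' (k ⁻¹' Metric.ball u ε)
      target := Metric.ball u ε ∩ {p | 0 ≤ p.1}
      map_source' := fun z hz => ⟨hz.2, hk0 _⟩
      map_target' := fun p hp => by
        have := hball hp.1
        refine ⟨c.map_target this.1, ?_⟩
        rw [mem_preimage, mem_preimage, c.right_inv this.1, hkj _ hp.2]
        exact hp.1
      left_inv' := fun z hz => by
        rw [hjk, c.left_inv hz.1]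
      right_inv' := fun p hp => by
        rw [c.right_inv (hball hp.1).1, hkj _ hp.2]
      isOpen_source := c.isOpen_inter_preimage (Metric.isOpen_ball.preimage hk)
      convex_target := (convex_ball _ _).inter
        ((convex_Ici (0 : ℝ)).linear_preimage (LinearMap.fst ℝ ℝ ℝ))
      continuousOn_toFun := hk.comp_continuousOn (c.continuousOn.mono inter_subset_left)
      continuousOn_invFun := c.continuousOn_symm.comp hj.continuousOn fun p hp => (hball hp.1).1 }
  have hy : y ∈ φ.source := ⟨hyc, Metric.mem_ball_self hε⟩
  have hbox : Icc (max (u.1 - ε / 2) 0, u.2 - ε / 2) (u.1 + ε / 2, u.2 + ε / 2) ⊆ φ.target := by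
    rintro ⟨a, b⟩ ⟨⟨h1, h2⟩, h3, h4⟩
    simp only [max_le_iff] at h1 h2 h3 h4
    refine ⟨?_, h1.2⟩
    rw [Metric.mem_ball, Prod.dist_eq, max_lt_iff, Real.dist_eq, Real.dist_eq, abs_lt, abs_lt]
    refine ⟨⟨?_, ?_⟩, ?_, ?_⟩ <;> simp only <;> linarith [h1.1]
  refine ⟨⟨φ, _, _, ?_, ?_, hbox⟩, hy, fun z hz => ?_, ?_⟩
  · simp only [max_lt_iff]
    constructor <;> linarith
  · simp only
    linarith
  · have := hball hz.2
    have h2 := this.2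
    rw [mem_preimage, hjk, c.left_inv hz.1] at h2
    exact interior_subset h2
  · have hopen : IsOpen (φ.source ∩ φ.toPartialEquiv ⁻¹' Metric.ball u (ε / 2)) :=
      φ.isOpen_inter_preimage Metric.isOpen_ball
    refine mem_of_superset (hopen.mem_nhds ⟨hy, Metric.mem_ball_self (half_pos hε)⟩) ?_
    rintro z ⟨hz, hz'⟩
    refine ⟨hz, ?_⟩
    have h0 := hk0 (c z)
    rw [mem_preimage, Metric.mem_ball, Prod.dist_eq, max_lt_iff, Real.dist_eq, Real.dist_eq,
      abs_lt, abs_lt] at hz'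
    have h1 : (k (c z)).1 - u.1 = (φ.toPartialEquiv z).1 - u.1 := rfl
    have h2 : (k (c z)).2 - u.2 = (φ.toPartialEquiv z).2 - u.2 := rfl
    rw [← h1, ← h2] at hz'
    obtain ⟨⟨h3, h4⟩, h5, h6⟩ := hz'
    exact ⟨⟨max_le (by linarith) h0, (by linarith : u.2 - ε / 2 ≤ (k (c z)).2)⟩,
      (by linarith : (k (c z)).1 ≤ u.1 + ε / 2), (by linarith : (k (c z)).2 ≤ u.2 + ε / 2)⟩

/-- A chart can be shrunk to a convex part around a point. -/
theorem ConvexChart.exists_convex_subset {Z : Type*} [TopologicalSpace Z] (φ : ConvexChart Z)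
    {y : Z} (hy : y ∈ φ.source) {N : Set Z} (hN : N ∈ 𝓝 y) :
    ∃ K : Set (ℝ × ℝ), Convex ℝ K ∧ IsOpen K ∧ φ.toPartialEquiv y ∈ K ∧
      φ.source ∩ φ.toPartialEquiv ⁻¹' K ⊆ N := by
  have hcont := φ.continuousOn_invFun _ (φ.map_source hy)
  have hnhds : φ.toPartialEquiv.symm ⁻¹' N ∈ 𝓝[φ.target] (φ.toPartialEquiv y) :=
    hcont.preimage_mem_nhdsWithin (by
      change N ∈ 𝓝 (φ.toPartialEquiv.symm _)
      rwa [φ.left_inv hy])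
  obtain ⟨ε, hε, h⟩ := Metric.mem_nhdsWithin_iff.1 hnhds
  refine ⟨Metric.ball _ ε, convex_ball _ _, Metric.isOpen_ball, Metric.mem_ball_self hε, ?_⟩
  rintro z ⟨hz, hz'⟩
  have := h ⟨hz', φ.map_source hz⟩
  rwa [mem_preimage, φ.left_inv hz] at this

/-- A map from a compact space that is not surjective can be deformed into a thin set. -/
theorem exists_homotopicWith_thin {X Z : Type*} [TopologicalSpace X] [TopologicalSpace Z]
    [CompactSpace X] [T2Space Z] [ConnectedSpace Z] [ChartedSpace (EuclideanHalfSpace 2) Z]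
    {A : Set X} {f : C(X, Z)} (hf : f.ConstOn A) {p : Z} (hp : p ∉ range f) :
    ∃ (g : C(X, Z)) (T : Set Z), f.HomotopicWith g (ContinuousMap.ConstOn A) ∧ IsThin T ∧
      range g ⊆ T := by
  have hcomp : IsCompact (range f) := isCompact_range f.continuous
  obtain ⟨B, -, -, hB⟩ := exists_chartBox p univ_mem
  obtain ⟨z, hzf, hz⟩ := B.inter_core_nonempty hcomp.isClosed.isOpen_compl
    ⟨p, mem_of_mem_nhds hB, hp⟩
  let R : Set Z := {y | ∃ S T, B.Reach S T ∧ S ∈ 𝓝 y}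
  have hRo : IsOpen R := by
    rw [isOpen_iff_mem_nhds]
    rintro y ⟨S, T, h, hS⟩
    filter_upwards [eventually_mem_nhds_iff.2 hS] with x hx
    exact ⟨S, T, h, hx⟩
  have hRc : IsClosed R := by
    refine isClosed_of_closure_subset fun y hy => ?_
    obtain ⟨B', -, -, hB'⟩ := exists_chartBox y univ_mem
    obtain ⟨x, hx, S, T, h, hS⟩ := mem_closure_iff_nhds.1 hy _ hB'
    exact ⟨_, _, h.step B' ⟨x, hx, mem_interior_iff_mem_nhds.2 hS⟩,
      mem_of_superset hB' subset_union_right⟩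
  have hR : R = univ := IsClopen.eq_univ ⟨hRc, hRo⟩ ⟨p, _, _, .base, hB⟩
  obtain ⟨S, T, h, hS⟩ : ∃ S T, B.Reach S T ∧ range f ⊆ S := by
    refine hcomp.induction_on (p := fun s => ∃ S T, B.Reach S T ∧ s ⊆ S)
      ⟨_, _, .base, empty_subset _⟩ ?_ ?_ ?_
    · rintro s t hst ⟨S, T, h, hS⟩
      exact ⟨S, T, h, hst.trans hS⟩
    · rintro s t ⟨S, T, h, hS⟩ ⟨S', T', h', hS'⟩
      obtain ⟨S'', T'', h'', hs⟩ := h.exists_union h'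
      exact ⟨S'', T'', h'', (union_subset_union hS hS').trans hs⟩
    · intro y _
      obtain ⟨S, T, h, hS⟩ : y ∈ R := hR ▸ mem_univ y
      exact ⟨S, mem_nhdsWithin_of_mem_nhds hS, S, T, h, Subset.rfl⟩
  obtain ⟨g, hfg, hg⟩ := h.exists_homotopicWith hf hz fun x hx => hzf ⟨x, hx⟩
  refine ⟨g, T, hfg, h.thin, ?_⟩
  rintro _ ⟨x, rfl⟩
  exact (hg x).resolve_left fun h => h.1 (hS ⟨x, rfl⟩)

/-- A compact set is zero-dimensional if neighborhoods with frontier avoiding it can be found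
around every compact set. -/
structure IsCompactZeroDim {Z : Type*} [TopologicalSpace Z] (C : Set Z) : Prop where
  isCompact : IsCompact C
  exists_frontier_disjoint : ∀ K U : Set Z, IsCompact K → IsOpen U → K ⊆ U →
    ∃ V, IsOpen V ∧ K ⊆ V ∧ closure V ⊆ U ∧ Disjoint (frontier V) C

namespace IsCompactZeroDim

variable {Z : Type*} [TopologicalSpace Z]

theorem mono {C C' : Set Z} (h : IsCompactZeroDim C) (hC' : IsCompact C') (hsub : C' ⊆ C) :
    IsCompactZeroDim C' :=
  ⟨hC', fun K U hK hU hKU => by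
    obtain ⟨V, hV, hKV, hVU, hd⟩ := h.2 K U hK hU hKU
    exact ⟨V, hV, hKV, hVU, hd.mono_right hsub⟩⟩

theorem of_point {C : Set Z} (hC : IsCompact C) (h : ∀ (x : Z) (U : Set Z), IsOpen U → x ∈ U →
    ∃ V, IsOpen V ∧ x ∈ V ∧ closure V ⊆ U ∧ Disjoint (frontier V) C) : IsCompactZeroDim C := by
  refine ⟨hC, fun K U hK hU hKU => ?_⟩
  refine hK.induction_on
    (p := fun s => ∃ V, IsOpen V ∧ s ⊆ V ∧ closure V ⊆ U ∧ Disjoint (frontier V) C)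
    ⟨∅, isOpen_empty, Subset.rfl, by simp, by simp⟩ ?_ ?_ ?_
  · rintro s t hst ⟨V, hV, h1, h2⟩
    exact ⟨V, hV, hst.trans h1, h2⟩
  · rintro s t ⟨V, hV, h1, h2, h3⟩ ⟨V', hV', h1', h2', h3'⟩
    refine ⟨V ∪ V', hV.union hV', union_subset_union h1 h1', ?_, ?_⟩
    · rw [closure_union]
      exact union_subset h2 h2'
    · exact (h3.union_left h3').mono_left ((frontier_union_subset V V').trans
        (union_subset_union inter_subset_left inter_subset_right))
  · intro x hx
    obtain ⟨V, hV, hxV, hVU, hd⟩ := h x U hU (hKU hx)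
    exact ⟨V, mem_nhdsWithin_of_mem_nhds (hV.mem_nhds hxV), V, hV, Subset.rfl, hVU, hd⟩

theorem union [T2Space Z] {C C' : Set Z} (h : IsCompactZeroDim C) (h' : IsCompactZeroDim C') :
    IsCompactZeroDim (C ∪ C') := by
  refine ⟨h.1.union h'.1, fun K U hK hU hKU => ?_⟩
  obtain ⟨V, hV, hKV, hVU, hd⟩ := h.2 K U hK hU hKU
  obtain ⟨V', hV', hKV', hVU', hd'⟩ := h'.2 (C' ∩ frontier V) (U \ C)
    (h'.1.inter_right isClosed_frontier) (hU.sdiff h.1.isClosed)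
    fun x hx => ⟨hVU (frontier_subset_closure hx.2), hd.notMem_of_mem_left hx.2⟩
  refine ⟨V ∪ V', hV.union hV', hKV.trans subset_union_left, ?_, ?_⟩
  · rw [closure_union]
    exact union_subset hVU (hVU'.trans sdiff_subset)
  · rw [Set.disjoint_left]
    intro x hx hxC
    have hx1 : x ∉ V ∪ V' := by
      rw [(hV.union hV').frontier_eq] at hx
      exact hx.2
    rcases frontier_union_subset V V' hx with ⟨h1, -⟩ | ⟨-, h1⟩
    · rcases hxC with h2 | h2
      · exact hd.notMem_of_mem_left h1 h2
      · exact hx1 (Or.inr (hKV' ⟨h2, h1⟩))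
    · rcases hxC with h2 | h2
      · exact (hVU' (frontier_subset_closure h1)).2 h2
      · exact hd'.notMem_of_mem_left h1 h2

theorem of_injOn [T2Space Z] [NormalSpace Z] {D : Set Z} (hD : IsCompact D) {h : Z → ℝ}
    (hc : ContinuousOn h D) (hinj : InjOn h D) (hinterior : interior (h '' D) = ∅) :
    IsCompactZeroDim D := by
  refine of_point hD fun x U hU hx => ?_
  by_cases hxD : x ∈ D
  · have hDU : IsCompact (h '' (D \ U)) :=
      (hD.diff hU).image_of_continuousOn (hc.mono sdiff_subset)
    have hxn : h x ∉ h '' (D \ U) := by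
      rintro ⟨w, ⟨hw, hwU⟩, hwx⟩
      exact hwU (hinj hw hxD hwx ▸ hx)
    obtain ⟨ε, hε, hball⟩ := Metric.mem_nhds_iff.1 (hDU.isClosed.isOpen_compl.mem_nhds hxn)
    have hdense := interior_eq_empty_iff_dense_compl.1 hinterior
    obtain ⟨a, ha, ha'⟩ := hdense.exists_mem_open isOpen_Ioo
      (nonempty_Ioo.2 (sub_lt_self (h x) hε))
    obtain ⟨b, hb, hb'⟩ := hdense.exists_mem_open isOpen_Ioo
      (nonempty_Ioo.2 (lt_add_of_pos_right (h x) hε))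
    have hP : IsCompact (D ∩ h ⁻¹' Icc a b) :=
      hD.of_isClosed_subset (hc.preimage_isClosed_of_isClosed hD.isClosed isClosed_Icc)
        inter_subset_left
    have hQ : IsCompact (D ∩ h ⁻¹' (Ioo a b)ᶜ) :=
      hD.of_isClosed_subset (hc.preimage_isClosed_of_isClosed hD.isClosed isOpen_Ioo.isClosed_compl)
        inter_subset_left
    have hPQ : ∀ w ∈ D, h w ∈ Icc a b → h w ∈ Ioo a b := fun w hw hwI =>
      ⟨hwI.1.lt_of_ne fun e => ha (e ▸ mem_image_of_mem h hw),
        hwI.2.lt_of_ne fun e => hb (e ▸ mem_image_of_mem h hw)⟩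
    obtain ⟨V, hV, hPV, hVU⟩ := normal_exists_closure_subset hP.isClosed (hU.sdiff hQ.isClosed)
      (fun w ⟨hw, hwI⟩ => ⟨by
        by_contra hwU
        have : h w ∈ (h '' (D \ U))ᶜ := hball (by
          rw [Real.ball_eq_Ioo]
          exact ⟨ha'.1.trans_le hwI.1, hwI.2.trans_lt hb'.2⟩)
        exact this ⟨w, ⟨hw, hwU⟩, rfl⟩, fun hwQ => hwQ.2 (hPQ w hw hwI)⟩)
    refine ⟨V, hV, hPV ⟨hxD, ha'.2.le, hb'.1.le⟩, hVU.trans sdiff_subset, ?_⟩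
    rw [Set.disjoint_left]
    intro w hw hwD
    rw [hV.frontier_eq] at hw
    by_cases hwI : h w ∈ Ioo a b
    · exact hw.2 (hPV ⟨hwD, Ioo_subset_Icc_self hwI⟩)
    · exact (hVU hw.1).2 ⟨hwD, hwI⟩
  · obtain ⟨V, hV, hxV, hVU⟩ := normal_exists_closure_subset (isClosed_singleton (x := x))
      (hU.sdiff hD.isClosed) (by simpa using ⟨hx, hxD⟩)
    refine ⟨V, hV, hxV rfl, hVU.trans sdiff_subset, ?_⟩
    rw [Set.disjoint_left]
    exact fun w hw hwD => (hVU (frontier_subset_closure hw)).2 hwD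

theorem empty [T2Space Z] [NormalSpace Z] : IsCompactZeroDim (∅ : Set Z) :=
  of_injOn isCompact_empty (h := fun _ => 0) (by simp) (by simp) (by simp)

end IsCompactZeroDim

/-- Almost every sphere around a point meets a thin set in a zero-dimensional set. -/
theorem IsThin.exists_isCompactZeroDim_sphere {Z : Type*} [MetricSpace Z] {T : Set Z}
    (hT : IsThin T) (y : Z) {ε : ℝ} (hε : 0 < ε) :
    ∃ r, 0 < r ∧ r < ε ∧ IsCompactZeroDim (T ∩ Metric.sphere y r) := by
  obtain ⟨F, hF, rfl, hF'⟩ := hT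
  have hcount : ∀ S ∈ F, {r | ¬ IsCompactZeroDim (S ∩ Metric.sphere y r)}.Countable := by
    intro S hS
    obtain ⟨hSc, h, hc, hinj⟩ := hF' S hS
    refine Set.PairwiseDisjoint.countable_of_nonempty_interior
      (s := fun r => h '' (S ∩ Metric.sphere y r)) ?_ fun r hr => ?_
    · intro r _ r' _ hrr
      change Disjoint (h '' _) (h '' _)
      rw [Set.disjoint_left]
      rintro _ ⟨w, ⟨hwS, hw⟩, rfl⟩ ⟨w', ⟨hwS', hw'⟩, hww⟩
      obtain rfl := hinj hwS' hwS hww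
      exact hrr ((Metric.mem_sphere.1 hw).symm.trans (Metric.mem_sphere.1 hw'))
    · rw [Set.nonempty_iff_ne_empty]
      intro he
      exact hr (.of_injOn (hSc.inter_right Metric.isClosed_sphere) (hc.mono inter_subset_left)
        (hinj.mono inter_subset_left) he)
  have hbad : (⋃ S ∈ F, {r | ¬ IsCompactZeroDim (S ∩ Metric.sphere y r)}).Countable :=
    hF.countable.biUnion hcount
  obtain ⟨r, hr, hr'⟩ := (hbad.dense_compl ℝ).exists_mem_open isOpen_Ioo (nonempty_Ioo.2 hε)
  refine ⟨r, hr'.1, hr'.2, ?_⟩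
  have hgood : ∀ S ∈ F, IsCompactZeroDim (S ∩ Metric.sphere y r) := fun S hS => by
    by_contra hcon
    exact hr (mem_biUnion hS hcon)
  rw [sUnion_eq_biUnion, iUnion₂_inter]
  clear hbad hr hcount hF'
  induction F, hF using Set.Finite.induction_on with
  | empty => simpa using IsCompactZeroDim.empty
  | insert _ _ ih =>
    rw [biUnion_insert]
    exact (hgood _ (mem_insert _ _)).union (ih fun S hS => hgood S (mem_insert_of_mem _ hS))

/-- Small neighborhoods can be made disjoint at the cost of removing their frontiers. -/
theorem IsCompact.exists_pairwiseDisjoint_refinement {Z : Type*} [TopologicalSpace Z] {C : Set Z}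
    (hC : IsCompact C) {P : Set Z → Prop} {N : Z → Set Z}
    (h : ∀ y ∈ C, ∃ V, IsOpen V ∧ y ∈ V ∧ V ⊆ N y ∧ P (frontier V)) :
    ∃ 𝒢 : Set (Set Z), 𝒢.PairwiseDisjoint id ∧ (∀ U ∈ 𝒢, IsOpen U ∧ ∃ y ∈ C, U ⊆ N y) ∧
      ∃ 𝒱 : Set (Set Z), 𝒱.Finite ∧ (∀ R ∈ 𝒱, P R) ∧ C ⊆ ⋃₀ 𝒢 ∪ ⋃₀ 𝒱 := by
  choose! V hVo hyV hVN hVP using h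
  obtain ⟨t, htC, ht⟩ := hC.elim_nhds_subcover V fun y hy => (hVo y hy).mem_nhds (hyV y hy)
  let e := t.equivFin
  let v : Fin t.card → Z := fun i => (e.symm i).1
  have hv : ∀ i, v i ∈ C := fun i => htC _ (e.symm i).2
  let E : Fin t.card → Set Z := fun i => V (v i) \ ⋃ j ∈ Iio i, closure (V (v j))
  have hE : ∀ i j, i < j → Disjoint (E i) (E j) := fun i j hij => by
    rw [Set.disjoint_left]
    exact fun x hx hx' => hx'.2 (mem_biUnion (show i ∈ Iio j from hij) (subset_closure hx.1))
  refine ⟨range E, ?_, ?_, range fun i => frontier (V (v i)), finite_range _, ?_, ?_⟩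
  · rintro _ ⟨i, rfl⟩ _ ⟨j, rfl⟩ hij
    rcases lt_trichotomy i j with h | h | h
    · exact hE i j h
    · exact absurd (h ▸ rfl) hij
    · exact (hE j i h).symm
  · rintro _ ⟨i, rfl⟩
    exact ⟨(hVo _ (hv i)).sdiff ((finite_Iio i).isClosed_biUnion fun j _ => isClosed_closure),
      v i, hv i, sdiff_subset.trans (hVN _ (hv i))⟩
  · rintro _ ⟨i, rfl⟩
    exact hVP _ (hv i)
  · intro x hx
    obtain ⟨y, hy, hxy⟩ := mem_iUnion₂.1 (ht hx)
    have hex : ∃ i, x ∈ closure (V (v i)) :=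
      ⟨e ⟨y, hy⟩, subset_closure (by simpa [v] using hxy)⟩
    obtain ⟨i, hi, hmin⟩ := WellFounded.has_min (wellFounded_lt (α := Fin t.card))
      {i | x ∈ closure (V (v i))} hex
    by_cases hxi : x ∈ V (v i)
    · refine Or.inl ⟨E i, mem_range_self i, hxi, ?_⟩
      simp only [mem_iUnion, not_exists]
      exact fun j hj hxj => hmin j hxj hj
    · refine Or.inr ⟨_, mem_range_self i, ?_⟩
      rw [(hVo _ (hv i)).frontier_eq]
      exact ⟨hi, hxi⟩

/-- A thin set is covered by two disjoint families of small open sets. -/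
theorem IsThin.exists_cover {Z : Type*} [MetricSpace Z] {T : Set Z} (hT : IsThin T)
    {N : Z → Set Z} (hN : ∀ y ∈ T, N y ∈ 𝓝 y) :
    ∃ 𝒢 : Bool → Set (Set Z), (∀ b, (𝒢 b).PairwiseDisjoint id) ∧
      (∀ b, ∀ U ∈ 𝒢 b, IsOpen U ∧ ∃ y ∈ T, U ⊆ N y) ∧ T ⊆ ⋃ b, ⋃₀ 𝒢 b := by
  obtain ⟨𝒢, h𝒢, h𝒢N, 𝒱, h𝒱, h𝒱P, hcov⟩ := hT.isCompact.exists_pairwiseDisjoint_refinement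
    (P := fun R => IsCompactZeroDim (T ∩ R)) (N := N) fun y hy => by
      obtain ⟨ε, hε, hεN⟩ := Metric.mem_nhds_iff.1 (hN y hy)
      obtain ⟨r, hr, hrε, hrT⟩ := hT.exists_isCompactZeroDim_sphere y hε
      refine ⟨Metric.ball y r, Metric.isOpen_ball, Metric.mem_ball_self hr,
        (Metric.ball_subset_ball hrε.le).trans hεN, hrT.mono
          (hT.isCompact.inter_right isClosed_frontier)
          (inter_subset_inter_right _ Metric.frontier_ball_subset_sphere)⟩
  have hC : IsCompactZeroDim (T ∩ ⋃₀ 𝒱) := by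
    rw [sUnion_eq_biUnion, inter_iUnion₂]
    clear hcov
    induction 𝒱, h𝒱 using Set.Finite.induction_on with
    | empty => simpa using IsCompactZeroDim.empty
    | insert _ _ ih =>
      rw [biUnion_insert]
      exact (h𝒱P _ (mem_insert _ _)).union (ih fun S hS => h𝒱P S (mem_insert_of_mem _ hS))
  obtain ⟨ℋ, hℋ, hℋN, 𝒲, -, h𝒲P, hcov'⟩ := hC.isCompact.exists_pairwiseDisjoint_refinement
    (P := fun R => Disjoint R (T ∩ ⋃₀ 𝒱)) (N := N) fun y hy => by
      obtain ⟨V, hV, hyV, hVN, hd⟩ := hC.exists_frontier_disjoint {y} _ isCompact_singleton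
        isOpen_interior (singleton_subset_iff.2 (mem_interior_iff_mem_nhds.2 (hN y hy.1)))
      exact ⟨V, hV, hyV rfl, subset_closure.trans (hVN.trans interior_subset), hd⟩
  refine ⟨fun b => cond b 𝒢 ℋ, ?_, ?_, fun x hx => ?_⟩
  · rintro (_ | _)
    exacts [hℋ, h𝒢]
  · rintro (_ | _) U hU
    · obtain ⟨h1, y, hy, h2⟩ := hℋN U hU
      exact ⟨h1, y, hy.1, h2⟩
    · exact h𝒢N U hU
  · rcases hcov hx with h | h
    · exact mem_iUnion.2 ⟨true, h⟩
    · refine mem_iUnion.2 ⟨false, (hcov' ⟨hx, h⟩).resolve_right ?_⟩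
      rintro ⟨R, hR, hxR⟩
      exact (h𝒲P R hR).notMem_of_mem_left hxR ⟨hx, h⟩

/-- A map into a thin subset of a surface is null-homotopic through maps that are constant on a
given connected closed set. -/
theorem IsThin.exists_homotopicWith_const {X : Type} {Z : Type*} [TopologicalSpace X]
    [MetricSpace Z] [ChartedSpace (EuclideanHalfSpace 2) Z] [CompactSpace X] [NormalSpace X]
    [ConnectedSpace X] [LocallyConnectedSpace X]
    (hX : ∀ P Q : Set X, IsOpen P → IsOpen Q → IsPreconnected P → IsPreconnected Q →
      P ∪ Q = univ → IsPreconnected (P ∩ Q))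
    {A : Set X} (hA : IsClosed A) (hAc : IsPreconnected A) {f : C(X, Z)} (hf : f.ConstOn A)
    {T : Set Z} (hT : IsThin T) (hfT : range f ⊆ T) :
    ∃ c, f.HomotopicWith (ContinuousMap.const X c) (ContinuousMap.ConstOn A) := by
  classical
  obtain ⟨δ, hδ, hδT⟩ := lebesgue_number_lemma_of_metric hT.isCompact
    (c := fun φ : ConvexChart Z => φ.source) (fun φ => φ.isOpen_source) fun y _ => by
      obtain ⟨B, hB, -⟩ := exists_chartBox y univ_mem
      exact mem_iUnion.2 ⟨B.toConvexChart, hB⟩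
  have : Nonempty (ConvexChart Z) := by
    obtain ⟨x⟩ := (inferInstance : Nonempty X)
    obtain ⟨B, -⟩ := exists_chartBox (f x) univ_mem
    exact ⟨B.toConvexChart⟩
  choose! φ hφ using hδT
  have hKex : ∀ y ∈ T, ∃ K : Set (ℝ × ℝ), Convex ℝ K ∧ IsOpen K ∧ (φ y).toPartialEquiv y ∈ K ∧
      (φ y).source ∩ (φ y).toPartialEquiv ⁻¹' K ⊆ Metric.ball y (δ / 4) := fun y hy =>
    (φ y).exists_convex_subset (hφ y hy (Metric.mem_ball_self hδ))
      (Metric.ball_mem_nhds y (by positivity))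
  choose! K hK hKo hyK hKball using hKex
  obtain ⟨𝒢, h𝒢, h𝒢N, hcov⟩ := hT.exists_cover
    (N := fun y => (φ y).source ∩ (φ y).toPartialEquiv ⁻¹' K y) fun y hy =>
      ((φ y).isOpen_inter_preimage (hKo y hy)).mem_nhds
        ⟨hφ y hy (Metric.mem_ball_self hδ), hyK y hy⟩
  have hx : ∀ x : X, ∃ b, ∃ U ∈ 𝒢 b, f x ∈ U := fun x => by
    simpa using hcov (hfT (mem_range_self x))
  choose b U hU hxU using hx
  have hfU : ∀ x, IsOpen (f ⁻¹' U x) := fun x => (h𝒢N _ _ (hU x)).1.preimage f.continuous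
  let W : X → Set X := fun x => connectedComponentIn (f ⁻¹' U x) x
  have hxW : ∀ x, x ∈ W x := fun x => mem_connectedComponentIn (hxU x)
  have hWo : ∀ x, IsOpen (W x) := fun x => (hfU x).connectedComponentIn
  have hWsub : ∀ x, W x ⊆ f ⁻¹' U x := fun x => connectedComponentIn_subset _ _
  have hWW : ∀ x y, b x = b y → (W x ∩ W y).Nonempty → W x = W y := by
    rintro x y hb ⟨w, hwx, hwy⟩
    have hUU : U x = U y := (h𝒢 (b y)).elim (hb ▸ hU x) (hU y) (by
      rw [Set.not_disjoint_iff]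
      exact ⟨f w, hWsub x hwx, hWsub y hwy⟩)
    simp only [W] at hwx hwy ⊢
    rw [connectedComponentIn_eq hwx, connectedComponentIn_eq hwy, hUU]
  obtain ⟨t, -, ht⟩ := isCompact_univ.elim_nhds_subcover W fun x _ => (hWo x).mem_nhds (hxW x)
  let ι : Type := W '' (t : Set X)
  have hιx : ∀ i : ι, ∃ x, W x = i.1 := fun i => by
    obtain ⟨x, -, hx⟩ := i.2
    exact ⟨x, hx⟩
  choose p hp using hιx
  have hfin : Finite ι := (t.finite_toSet.image W).to_subtype
  have hcovW : ⋃ i : ι, i.1 = univ := by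
    refine eq_univ_of_forall fun x => ?_
    obtain ⟨y, hy, hxy⟩ := mem_iUnion₂.1 (ht (mem_univ x))
    exact mem_iUnion.2 ⟨⟨W y, mem_image_of_mem W hy⟩, hxy⟩
  have hne : Nonempty ι := by
    obtain ⟨x⟩ := (inferInstance : Nonempty X)
    obtain ⟨i, -⟩ := mem_iUnion.1 (hcovW ▸ mem_univ x : x ∈ ⋃ i : ι, i.1)
    exact ⟨i⟩
  have hβ : ∀ x, ∃ y : T, U x ⊆ (φ y).source ∩ (φ y).toPartialEquiv ⁻¹' K y := fun x => by
    obtain ⟨-, y, hy, h⟩ := h𝒢N _ _ (hU x)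
    exact ⟨⟨y, hy⟩, h⟩
  choose β hβ using hβ
  refine exists_homotopicWith_const_of_cover hX (φ := fun y : T => φ y) (K := fun y : T => K y)
    (fun y => hK y y.2) ?_ hA (Nat.card ι - 1) (ι := ι)
    (Nat.succ_pred_eq_of_pos Nat.card_pos).symm (W := fun i => i.1) ?_ ?_ hcovW ?_ ?_ hf
    (β := fun i => β (p i)) ?_
  · rintro y y' ⟨z, hz, hz'⟩ w hw
    refine hφ y' y'.2 (Metric.mem_ball.2 ?_)
    have h1 := Metric.mem_ball.1 (hKball y y.2 hz)
    have h2 := Metric.mem_ball.1 (hKball y' y'.2 hz')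
    have h3 := Metric.mem_ball.1 (hKball y y.2 hw)
    have h4 := dist_triangle4 w y z y'
    rw [dist_comm z] at h1
    linarith
  · exact fun i => hp i ▸ hWo _
  · exact fun i => hp i ▸ ⟨⟨_, hxW _⟩, isPreconnected_connectedComponentIn⟩
  · intro i j k hij hik hjk
    by_contra hcon
    obtain ⟨w, ⟨hi, hj⟩, hk⟩ := Set.nonempty_iff_ne_empty.2 hcon
    have key : ∀ i j : ι, i ≠ j → w ∈ i.1 → w ∈ j.1 → b (p i) ≠ b (p j) := by
      intro i j hij hi hj hb
      rw [← hp i] at hi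
      rw [← hp j] at hj
      have := hWW _ _ hb ⟨w, hi, hj⟩
      rw [hp, hp] at this
      exact hij (Subtype.ext this)
    have h1 := key i j hij hi hj
    have h2 := key i k hik hi hk
    have h3 := key j k hjk hj hk
    revert h1 h2 h3
    cases b (p i) <;> cases b (p j) <;> cases b (p k) <;> simp
  · intro i
    rw [← hp i, or_iff_not_imp_right, Set.not_disjoint_iff]
    rintro ⟨a, haA, haW⟩
    have hAU : A ⊆ f ⁻¹' U (p i) := fun a' ha' => by
      rw [mem_preimage, hf a' ha' a haA]
      exact hWsub _ haW
    simp only [W] at haW ⊢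
    rw [connectedComponentIn_eq haW]
    exact hAc.subset_connectedComponentIn haA hAU
  · intro i x hx
    rw [← hp i] at hx
    exact hβ _ (hWsub _ hx)

theorem Cube.contractibleSpace (N : Type*) : ContractibleSpace (N → I) := by
  rw [contractible_iff_id_nullhomotopic]
  refine ⟨0, ⟨⟨⟨fun p i => σ p.1 * p.2 i, by fun_prop⟩, fun x => ?_, fun x => ?_⟩⟩⟩
  · ext
    simp
  · ext
    simp

theorem Cube.isClosed_boundary (N : Type*) [Finite N] : IsClosed (Cube.boundary N) := by
  have : Cube.boundary N = ⋃ i, {y | y i = 0 ∨ y i = 1} := by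
    ext y
    simp [Cube.boundary]
  rw [this]
  refine isClosed_iUnion_of_finite fun i => ?_
  exact (isClosed_eq (continuous_apply i) continuous_const).union
    (isClosed_eq (continuous_apply i) continuous_const)

theorem Cube.isPreconnected_boundary (N : Type*) [Nontrivial N] :
    IsPreconnected (Cube.boundary N) := by
  classical
  refine isPreconnected_of_forall (0 : N → I) fun y hy => ?_
  obtain ⟨i, hi⟩ := hy
  obtain ⟨j, hj⟩ := exists_ne i
  have h1 : IsPreconnected (range fun t : I => Function.update y j (t * y j)) :=
    isPreconnected_range (by fun_prop)
  have h2 : IsPreconnected (range fun t : I => fun l => t * Function.update y j 0 l) :=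
    isPreconnected_range (by fun_prop)
  have h3 := IsPreconnected.union (Function.update y j 0) (mem_range.2 ⟨0, by simp⟩)
    (mem_range.2 ⟨1, by simp⟩) h1 h2
  refine ⟨_, ?_, ?_, ?_, h3⟩
  · rintro _ (⟨t, rfl⟩ | ⟨t, rfl⟩)
    · exact ⟨i, by simpa [hj.symm] using hi⟩
    · exact ⟨j, by simp⟩
  · exact Or.inr ⟨0, by ext; simp⟩
  · exact Or.inl ⟨1, by simp⟩

/-- A generalized loop that is freely null-homotopic through maps that are constant on the
boundary is null-homotopic. -/
theorem GenLoop.homotopic_const_of_homotopicWith {N Z : Type*} [Fintype N] [Nonempty N]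
    [TopologicalSpace Z] {z c : Z} (f : GenLoop N Z z)
    (h : f.1.HomotopicWith (ContinuousMap.const _ c)
      (ContinuousMap.ConstOn (Cube.boundary N))) :
    GenLoop.Homotopic f GenLoop.const := by
  obtain ⟨F⟩ := h
  have hFA : ∀ t, ∀ a ∈ Cube.boundary N, ∀ b ∈ Cube.boundary N, F (t, a) = F (t, b) :=
    fun t => F.prop t
  have hF0 : ∀ x, F (0, x) = f x := F.apply_zero
  have hF1 : ∀ x, F (1, x) = c := F.apply_one
  have hFc : Continuous F := F.continuous
  let pr : ℝ → I := projIcc 0 1 zero_le_one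
  have hpr : Continuous pr := continuous_projIcc
  have hpr0 : ∀ r ≤ 0, pr r = 0 := fun r hr => projIcc_of_le_left _ hr
  have hpr1 : ∀ r, 1 ≤ r → pr r = 1 := fun r hr => projIcc_of_right_le _ hr
  have hprv : ∀ t : I, pr t = t := fun t => projIcc_val _ t
  let d : (N → I) → ℝ := fun x => 4 * Metric.infDist x (Cube.boundary N)
  have hd : Continuous d := continuous_const.mul (Metric.continuous_infDist_pt _)
  have hd0 : ∀ x ∈ Cube.boundary N, d x = 0 := fun x hx => by
    simp only [d, Metric.infDist_zero_of_mem hx, mul_zero]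
  have hdn : ∀ x, 0 ≤ d x := fun x => mul_nonneg (by norm_num) Metric.infDist_nonneg
  have h0 : (0 : N → I) ∈ Cube.boundary N := ⟨Classical.arbitrary N, Or.inl rfl⟩
  let ρ : I × (N → I) → N → I := fun p i => pr (p.2 i + p.1 * (p.2 i - 1 / 2))
  have hρ : Continuous ρ := by fun_prop
  have hρ0 : ∀ x, ρ (0, x) = x := fun x => by
    ext i
    simp [ρ, hprv]
  have hρb : ∀ s, ∀ x ∈ Cube.boundary N, ρ (s, x) ∈ Cube.boundary N := by
    rintro s x ⟨i, hi⟩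
    refine ⟨i, hi.imp (fun h => hpr0 _ ?_) fun h => hpr1 _ ?_⟩
    · simp only [h, Icc.coe_zero]
      linarith [s.2.1]
    · simp only [h, Icc.coe_one]
      linarith [s.2.1]
  have hρ1 : ∀ x, d x < 1 → ρ (1, x) ∈ Cube.boundary N := by
    intro x hx
    obtain ⟨y, ⟨i, hi⟩, hxy⟩ := (Metric.infDist_lt_iff (x := x) (r := 1 / 4) ⟨0, h0⟩).1
      (by simp only [d] at hx; linarith)
    have hxi : |(x i : ℝ) - y i| < 1 / 4 := (dist_le_pi_dist x y i).trans_lt hxy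
    rw [abs_lt] at hxi
    refine ⟨i, hi.imp (fun h => hpr0 _ ?_) fun h => hpr1 _ ?_⟩
    · simp only [h, Icc.coe_zero, Icc.coe_one] at hxi ⊢
      linarith
    · simp only [h, Icc.coe_one] at hxi ⊢
      linarith
  let g : C(N → I, Z) := ⟨fun x => F (pr (min 1 (d x)), 0), by fun_prop⟩
  have hfz : ∀ x ∈ Cube.boundary N, f x = z := f.2
  have hgz : F (0, 0) = z := (hF0 0).trans (hfz 0 h0)
  have h1 : f.1.HomotopicRel g (Cube.boundary N) := by
    refine ⟨⟨⟨⟨fun p => F (pr (min p.1 (d p.2)), ρ p), by fun_prop⟩, fun x => ?_, fun x => ?_⟩,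
      fun s x hx => ?_⟩⟩
    · change F (pr (min ((0 : I) : ℝ) (d x)), ρ (0, x)) = f x
      rw [Icc.coe_zero, min_eq_left (hdn x), hpr0 _ le_rfl, hρ0, hF0]
    · change F (pr (min ((1 : I) : ℝ) (d x)), ρ (1, x)) = F (pr (min 1 (d x)), 0)
      rw [Icc.coe_one]
      rcases lt_or_ge (d x) 1 with h | h
      · exact hFA _ _ (hρ1 x h) _ h0
      · rw [min_eq_left h, hpr1 _ le_rfl, hF1, hF1]
    · change F (pr (min (s : ℝ) (d x)), ρ (s, x)) = f x
      rw [hd0 x hx, min_eq_right s.2.1, hpr0 _ le_rfl, hF0, hfz x hx, hfz _ (hρb s x hx)]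
  have h2 : g.HomotopicRel (ContinuousMap.const _ z) (Cube.boundary N) := by
    refine ⟨⟨⟨⟨fun p => F (σ p.1 * pr (min 1 (d p.2)), 0), by fun_prop⟩, fun x => ?_,
      fun x => ?_⟩, fun s x hx => ?_⟩⟩
    · change F (σ 0 * pr (min 1 (d x)), 0) = F (pr (min 1 (d x)), 0)
      simp
    · change F (σ 1 * pr (min 1 (d x)), 0) = z
      simp [hgz]
    · change F (σ s * pr (min 1 (d x)), 0) = F (pr (min 1 (d x)), 0)
      rw [hd0 x hx, min_eq_right zero_le_one, hpr0 _ le_rfl, mul_zero]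
  exact h1.trans h2

end

/-- Every connected non-compact surface (two-dimensional topological manifold, possibly with
boundary: a Hausdorff second-countable space locally homeomorphic to open subsets of the closed
half-plane) is aspherical: all homotopy groups `π_k` with `k ≥ 2` are trivial. -/
theorem noncompact_surface_aspherical (Z : Type) [TopologicalSpace Z]
    [T2Space Z] [SecondCountableTopology Z] [ChartedSpace (EuclideanHalfSpace 2) Z]
    [ConnectedSpace Z] [NoncompactSpace Z] (z : Z) (k : ℕ) (hk : 2 ≤ k) :
    Subsingleton (π_ k Z z) := by
  have : Nontrivial (Fin k) := Fin.nontrivial_iff_two_le.2 hk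
  have : LocallyCompactSpace (EuclideanHalfSpace 2) :=
    (isClosed_Ici.preimage (by fun_prop :
      Continuous fun x : EuclideanSpace ℝ (Fin 2) => x 0)).isClosedEmbedding_subtypeVal
      |>.locallyCompactSpace
  have : LocallyCompactSpace Z := ChartedSpace.locallyCompactSpace (EuclideanHalfSpace 2) Z
  let _ : MetricSpace Z := TopologicalSpace.metrizableSpaceMetric Z
  have : LocallyPathConnectedSpace unitInterval := (convex_Icc (0 : ℝ) 1).locallyPathConnectedSpace
  have : ContractibleSpace (Fin k → unitInterval) := Cube.contractibleSpace _
  suffices h : ∀ f : GenLoop (Fin k) Z z, GenLoop.Homotopic f GenLoop.const by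
    refine ⟨fun a b => ?_⟩
    induction a using Quotient.inductionOn with | _ a
    induction b using Quotient.inductionOn with | _ b
    exact Quotient.sound ((h a).trans (h b).symm)
  intro f
  have hf : f.1.ConstOn (Cube.boundary (Fin k)) := fun a ha b hb =>
    (f.2 a ha).trans (f.2 b hb).symm
  obtain ⟨p, hp⟩ : ∃ p, p ∉ Set.range f.1 := by
    by_contra! hcon
    exact noncompact_univ Z (Set.eq_univ_of_forall hcon ▸ isCompact_range f.1.continuous)
  obtain ⟨g, T, hfg, hT, hgT⟩ := exists_homotopicWith_thin hf hp
  obtain ⟨c, hc⟩ := hT.exists_homotopicWith_const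
    (fun P Q hP hQ hP' hQ' h => hP'.inter_of_union_eq_univ hP hQ hQ' h)
    (Cube.isClosed_boundary _) (Cube.isPreconnected_boundary _) hfg.constOn_right hgT
  exact GenLoop.homotopic_const_of_homotopicWith f (hfg.trans hc)
end

section
/- Let (Z, q) be a striped surface. Then every seam R_β = q(X_β) = q(Y_β) is a closed subset of Z. -/
open Topology
/-- A *model strip* is a subset `S` of `ℝ × [-1,1]` containing the open strip `ℝ × (-1,1)`
which is open in `ℝ × [-1,1]` (equivalently, `S ∩ (ℝ × {-1,1})` is a union of at most
countably many mutually disjoint open intervals). -/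
structure IsModelStrip (S : Set (ℝ × ℝ)) : Prop where
  subset_strip : S ⊆ Set.univ ×ˢ Set.Icc (-1 : ℝ) 1
  ioo_subset : Set.univ ×ˢ Set.Ioo (-1 : ℝ) 1 ⊆ S
  isOpen : ∃ V : Set (ℝ × ℝ), IsOpen V ∧ S = V ∩ (Set.univ ×ˢ Set.Icc (-1 : ℝ) 1)

/-- The boundary part `S ∩ (ℝ × {-1,1})` of a model strip `S`. -/
def stripBoundary (S : Set (ℝ × ℝ)) : Set (ℝ × ℝ) :=
  S ∩ (Set.univ ×ˢ ({-1, 1} : Set ℝ))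

/-- A *boundary interval* of a model strip `S` is a connected component of
`S ∩ (ℝ × {-1,1})`. -/
def IsBoundaryInterval (S T : Set (ℝ × ℝ)) : Prop :=
  ∃ p ∈ stripBoundary S, T = connectedComponentIn (stripBoundary S) p

/-- The copy of a subset `T` of the model strip `S α` inside the disjoint union
`Z₀ = ⨿_α S_α`. -/
def sigmaSet {A : Type} (S : A → Set (ℝ × ℝ)) (α : A) (T : Set (ℝ × ℝ)) :
    Set (Σ a : A, S a) :=
  {z | z.1 = α ∧ (z.2 : ℝ × ℝ) ∈ T}

/-- A *striped atlas* on a space `Z`: a quotient map `q : Z₀ = ⨿_{α ∈ A} S_α → Z` from an at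
most countable disjoint union of model strips, together with two disjoint families
`{X_β}_{β ∈ B}`, `{Y_β}_{β ∈ B}` of boundary intervals of the strips, such that `q` is
injective outside `X ∪ Y`, glues `X_β` onto `Y_β` by embeddings, the images of distinct
`X_β`'s are disjoint, and the image of each `X_β` is disjoint from the image of the
complement of `X ∪ Y`.  A *striped surface* is a surface together with such an atlas. -/
structure StripedAtlas (Z : Type) [TopologicalSpace Z] where
  /-- index set of strips -/
  A : Type
  countable_A : Countable A
  /-- the model strips -/
  S : A → Set (ℝ × ℝ)
  modelStrip : ∀ α, IsModelStrip (S α)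
  /-- the gluing quotient map -/
  q : (Σ α : A, S α) → Z
  isQuotientMap : IsQuotientMap q
  /-- index set of pairs of glued boundary intervals -/
  B : Type
  countable_B : Countable B
  /-- strip containing `X_β` -/
  XA : B → A
  /-- strip containing `Y_β` -/
  YA : B → A
  /-- the boundary interval `X_β` (as a subset of the plane) -/
  Xint : B → Set (ℝ × ℝ)
  /-- the boundary interval `Y_β` (as a subset of the plane) -/
  Yint : B → Set (ℝ × ℝ)
  X_bdry : ∀ b, IsBoundaryInterval (S (XA b)) (Xint b)
  Y_bdry : ∀ b, IsBoundaryInterval (S (YA b)) (Yint b)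
  disjoint_XX : ∀ b b', b ≠ b' →
    Disjoint (sigmaSet S (XA b) (Xint b)) (sigmaSet S (XA b') (Xint b'))
  disjoint_YY : ∀ b b', b ≠ b' →
    Disjoint (sigmaSet S (YA b) (Yint b)) (sigmaSet S (YA b') (Yint b'))
  disjoint_XY : ∀ b b',
    Disjoint (sigmaSet S (XA b) (Xint b)) (sigmaSet S (YA b') (Yint b'))
  injOn : Set.InjOn q
    ((⋃ b, sigmaSet S (XA b) (Xint b)) ∪ ⋃ b, sigmaSet S (YA b) (Yint b))ᶜ
  q_X_eq_q_Y : ∀ b, q '' sigmaSet S (XA b) (Xint b) = q '' sigmaSet S (YA b) (Yint b)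
  embed_X : ∀ b, IsEmbedding ((sigmaSet S (XA b) (Xint b)).restrict q)
  embed_Y : ∀ b, IsEmbedding ((sigmaSet S (YA b) (Yint b)).restrict q)
  seams_disjoint : ∀ b b', b ≠ b' →
    Disjoint (q '' sigmaSet S (XA b) (Xint b)) (q '' sigmaSet S (XA b') (Xint b'))
  seam_disjoint_rest : ∀ b,
    Disjoint (q '' sigmaSet S (XA b) (Xint b))
      (q '' ((⋃ b', sigmaSet S (XA b') (Xint b')) ∪ ⋃ b', sigmaSet S (YA b') (Yint b'))ᶜ)

variable {Z : Type} [TopologicalSpace Z]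

/-- The seam `R_β = q(X_β) = q(Y_β)` of a striped atlas. -/
def StripedAtlas.seam (σ : StripedAtlas Z) (b : σ.B) : Set Z :=
  σ.q '' sigmaSet σ.S (σ.XA b) (σ.Xint b)

/-- A connected component of a set is relatively closed in that set. -/
theorem exists_isClosed_connectedComponentIn_eq_inter {X : Type*} [TopologicalSpace X]
    {F : Set X} {p : X} (hp : p ∈ F) :
    ∃ C : Set X, IsClosed C ∧ connectedComponentIn F p = F ∩ C := by
  obtain ⟨C, hC, h⟩ := isClosed_induced_iff.1 (isClosed_connectedComponent (x := (⟨p, hp⟩ : F)))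
  refine ⟨C, hC, ?_⟩
  rw [connectedComponentIn_eq_image hp, ← h, Subtype.image_preimage_coe]

/-- A boundary interval of `S` is relatively closed in `S`. -/
theorem IsBoundaryInterval.exists_isClosed_eq_inter {S T : Set (ℝ × ℝ)}
    (h : IsBoundaryInterval S T) : ∃ C : Set (ℝ × ℝ), IsClosed C ∧ T = S ∩ C := by
  obtain ⟨p, hp, rfl⟩ := h
  obtain ⟨C, hC, h⟩ := exists_isClosed_connectedComponentIn_eq_inter hp
  refine ⟨(Set.univ ×ˢ ({-1, 1} : Set ℝ)) ∩ C, ?_, ?_⟩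
  · exact (isClosed_univ.prod (Set.toFinite _).isClosed).inter hC
  · rw [h, stripBoundary, Set.inter_assoc]

/-- The copy of a boundary interval in the disjoint union of the strips is closed. -/
theorem IsBoundaryInterval.isClosed_sigmaSet {A : Type} {S : A → Set (ℝ × ℝ)} {α : A}
    {T : Set (ℝ × ℝ)} (h : IsBoundaryInterval (S α) T) : IsClosed (sigmaSet S α T) := by
  obtain ⟨C, hC, rfl⟩ := h.exists_isClosed_eq_inter
  refine isClosed_sigma_iff.2 fun i => ?_
  by_cases hi : i = α
  · subst hi
    convert hC.preimage (continuous_subtype_val (p := (· ∈ S i))) using 1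
    ext z
    simp [sigmaSet]
  · convert isClosed_empty using 1
    ext z
    simp [sigmaSet, hi]

/-- The preimage of a seam in the disjoint union of the strips consists of the two boundary
intervals glued along it. -/
theorem StripedAtlas.preimage_seam (σ : StripedAtlas Z) (b : σ.B) :
    σ.q ⁻¹' σ.seam b =
      sigmaSet σ.S (σ.XA b) (σ.Xint b) ∪ sigmaSet σ.S (σ.YA b) (σ.Yint b) := by
  have eq_of_mem : ∀ {b' : σ.B} {x : Z}, x ∈ σ.seam b → x ∈ σ.seam b' → b = b' :=
    fun hx hx' => by_contra fun hne => Set.disjoint_left.1 (σ.seams_disjoint _ _ hne) hx hx'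
  ext z
  constructor
  · intro hz
    by_cases h : z ∈ (⋃ b', sigmaSet σ.S (σ.XA b') (σ.Xint b')) ∪
        ⋃ b', sigmaSet σ.S (σ.YA b') (σ.Yint b')
    · rcases h with h | h
      · obtain ⟨b', hb'⟩ := Set.mem_iUnion.1 h
        obtain rfl := eq_of_mem hz (Set.mem_image_of_mem σ.q hb')
        exact Or.inl hb'
      · obtain ⟨b', hb'⟩ := Set.mem_iUnion.1 h
        obtain rfl := eq_of_mem hz ((σ.q_X_eq_q_Y b').ge (Set.mem_image_of_mem σ.q hb'))
        exact Or.inr hb'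
    · exact (Set.disjoint_left.1 (σ.seam_disjoint_rest b) hz (Set.mem_image_of_mem σ.q h)).elim
  · rintro (h | h)
    · exact Set.mem_image_of_mem σ.q h
    · exact (σ.q_X_eq_q_Y b).ge (Set.mem_image_of_mem σ.q h)

/-- Every seam `R_β = q(X_β) = q(Y_β)` of a striped surface is a closed subset of `Z`. -/
theorem seam_isClosed [T2Space Z] [SecondCountableTopology Z]
    [ChartedSpace (EuclideanHalfSpace 2) Z]
    (σ : StripedAtlas Z) (b : σ.B) : IsClosed (σ.seam b) := by
  rw [← σ.isQuotientMap.isClosed_preimage, σ.preimage_seam]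
  exact (σ.X_bdry b).isClosed_sigmaSet.union (σ.Y_bdry b).isClosed_sigmaSet
end

section
/- Let (Z, q) be a striped surface. For each β ∈ B let N_β = q(nb(X_β)) ∪ q(nb(Y_β)) be the standard neighborhood of the seam R_β, where nb denotes the standard neighborhood of a boundary interval in its model strip. Then each N_β is an open subset of Z containing R_β, N_β ∩ N_{β'} = ∅ for β ≠ β', the family of seams {R_β}_{β∈B} is discrete (hence locally finite) in Z, and the union of any collection of seams is a closed subset of Z. -/
open Topology
variable {Z : Type} [TopologicalSpace Z]

/-- The *standard neighborhood* of a boundary interval: for `X = (a,b) × {1}` it is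
`(a,b) × (0.8, 1]`, and for `X = (a,b) × {-1}` it is `(a,b) × [-1, -0.8)`. -/
def stdNbhd (T : Set (ℝ × ℝ)) : Set (ℝ × ℝ) :=
  (Prod.fst '' (T ∩ (Set.univ ×ˢ ({1} : Set ℝ)))) ×ˢ Set.Ioc (0.8 : ℝ) 1 ∪
    (Prod.fst '' (T ∩ (Set.univ ×ˢ ({-1} : Set ℝ)))) ×ˢ Set.Ico (-1 : ℝ) (-0.8)

/-- The union `X ∪ Y` of all glued boundary intervals inside `Z₀ = ⨿_α S_α`. -/
def StripedAtlas.glued (σ : StripedAtlas Z) : Set (Σ α : σ.A, σ.S α) :=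
  (⋃ b, sigmaSet σ.S (σ.XA b) (σ.Xint b)) ∪ ⋃ b, sigmaSet σ.S (σ.YA b) (σ.Yint b)

/-- The standard neighborhood `N_β = q(nb(X_β)) ∪ q(nb(Y_β))` of the seam `R_β`. -/
def StripedAtlas.seamNbhd (σ : StripedAtlas Z) (b : σ.B) : Set Z :=
  σ.q '' sigmaSet σ.S (σ.XA b) (stdNbhd (σ.Xint b)) ∪
    σ.q '' sigmaSet σ.S (σ.YA b) (stdNbhd (σ.Yint b))

/-- The image `U_α = q(S_α \ (X ∪ Y))` of a strip with the glued boundary intervals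
removed. -/
def StripedAtlas.stripImage (σ : StripedAtlas Z) (α : σ.A) : Set Z :=
  σ.q '' ({z | z.1 = α} \ σ.glued)

theorem IsBoundaryInterval.subset {S T : Set (ℝ × ℝ)} (h : IsBoundaryInterval S T) :
    T ⊆ stripBoundary S := by
  obtain ⟨p, -, rfl⟩ := h
  exact connectedComponentIn_subset _ _

theorem IsBoundaryInterval.eq_component {S T : Set (ℝ × ℝ)} (h : IsBoundaryInterval S T)
    {p : ℝ × ℝ} (hp : p ∈ T) : T = connectedComponentIn (stripBoundary S) p := by
  obtain ⟨r, -, rfl⟩ := h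
  exact connectedComponentIn_eq hp

theorem mem_stdNbhd {T : Set (ℝ × ℝ)} {p : ℝ × ℝ} :
    p ∈ stdNbhd T ↔ ((p.1, 1) ∈ T ∧ 0.8 < p.2 ∧ p.2 ≤ 1) ∨
      ((p.1, -1) ∈ T ∧ -1 ≤ p.2 ∧ p.2 < -0.8) := by
  simp [stdNbhd]

theorem mem_of_mem_stdNbhd {T : Set (ℝ × ℝ)} {p : ℝ × ℝ} (h : p ∈ stdNbhd T)
    (hp : p.2 = -1 ∨ p.2 = 1) : p ∈ T := by
  obtain ⟨x, y⟩ := p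
  rw [mem_stdNbhd] at h
  simp only at h hp
  rcases hp with rfl | rfl
  · rcases h with h | h
    · norm_num at h
    · exact h.1
  · rcases h with h | h
    · exact h.1
    · norm_num at h

theorem subset_stdNbhd {T : Set (ℝ × ℝ)} (hT : ∀ p ∈ T, p.2 = -1 ∨ p.2 = 1) :
    T ⊆ stdNbhd T := by
  rintro ⟨x, y⟩ hp
  rw [mem_stdNbhd]
  rcases hT _ hp with h | h <;> simp only at h <;> subst h
  · right; exact ⟨hp, by norm_num⟩
  · left; exact ⟨hp, by norm_num⟩

theorem disjoint_stdNbhd {T T' : Set (ℝ × ℝ)} (h : Disjoint T T') :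
    Disjoint (stdNbhd T) (stdNbhd T') := by
  rw [Set.disjoint_left] at h ⊢
  intro p hp hp'
  rw [mem_stdNbhd] at hp hp'
  rcases hp with hp | hp <;> rcases hp' with hp' | hp'
  · exact h hp.1 hp'.1
  · linarith [hp.2.1, hp'.2.2]
  · linarith [hp'.2.1, hp.2.2]
  · exact h hp.1 hp'.1

theorem stripBoundary_level {S : Set (ℝ × ℝ)} {p : ℝ × ℝ} (h : p ∈ stripBoundary S) :
    p.2 = -1 ∨ p.2 = 1 := by
  simpa using h.2.2

theorem IsBoundaryInterval.level {S T : Set (ℝ × ℝ)} (h : IsBoundaryInterval S T) :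
    ∀ p ∈ T, p.2 = -1 ∨ p.2 = 1 :=
  fun _ hp => stripBoundary_level (h.subset hp)

theorem IsBoundaryInterval.isOpen_slice {S T : Set (ℝ × ℝ)} (hS : IsModelStrip S)
    (h : IsBoundaryInterval S T) (c : ℝ) : IsOpen {x : ℝ | (x, c) ∈ T} := by
  rw [Metric.isOpen_iff]
  intro x hx
  have hx' : (x, c) ∈ T := hx
  have hb := h.subset hx'
  obtain ⟨V, hV, hSV⟩ := hS.isOpen
  have hxV : (x, c) ∈ V := by
    have := hb.1
    rw [hSV] at this
    exact this.1
  have hV' : IsOpen {t : ℝ | (t, c) ∈ V} := hV.preimage (by fun_prop)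
  obtain ⟨ε, hε, hball⟩ := Metric.isOpen_iff.1 hV' x hxV
  refine ⟨ε, hε, fun t ht => ?_⟩
  rw [h.eq_component hx']
  have hpre : IsPreconnected ((fun t : ℝ => (t, c)) '' Metric.ball x ε) :=
    (convex_ball x ε).isPreconnected.image _ (by fun_prop)
  refine hpre.subset_connectedComponentIn ⟨x, Metric.mem_ball_self hε, rfl⟩ ?_ ⟨t, ht, rfl⟩
  rintro _ ⟨s, hs, rfl⟩
  refine ⟨?_, Set.mem_univ _, hb.2.2⟩
  rw [hSV]
  refine ⟨hball hs, Set.mem_univ _, ?_⟩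
  have hI := hS.subset_strip hb.1
  exact hI.2

theorem IsBoundaryInterval.stdNbhd_subset {S T : Set (ℝ × ℝ)} (hS : IsModelStrip S)
    (h : IsBoundaryInterval S T) : stdNbhd T ⊆ S := by
  rintro ⟨x, y⟩ hp
  by_cases hy : y = -1 ∨ y = 1
  · exact (h.subset (mem_of_mem_stdNbhd hp hy)).1
  · push Not at hy
    refine hS.ioo_subset ⟨Set.mem_univ _, ?_⟩
    rw [mem_stdNbhd] at hp
    rcases hp with ⟨-, h1, h2⟩ | ⟨-, h1, h2⟩
    · exact ⟨by norm_num at *; linarith, lt_of_le_of_ne h2 hy.2⟩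
    · exact ⟨lt_of_le_of_ne h1 hy.1.symm, by norm_num at *; linarith⟩

theorem isOpen_sigmaSet_of_isOpen {A : Type} {S : A → Set (ℝ × ℝ)} {α : A} {T : Set (ℝ × ℝ)}
    (h : IsOpen {s : S α | (s : ℝ × ℝ) ∈ T}) : IsOpen (sigmaSet S α T) := by
  rw [isOpen_sigma_iff]
  intro a
  by_cases ha : a = α
  · subst ha
    simpa [sigmaSet] using h
  · simp [sigmaSet, ha]

theorem IsBoundaryInterval.isOpen_sigmaSet_stdNbhd {A : Type} {S : A → Set (ℝ × ℝ)} {α : A}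
    {T : Set (ℝ × ℝ)} (hS : IsModelStrip (S α)) (h : IsBoundaryInterval (S α) T) :
    IsOpen (sigmaSet S α (stdNbhd T)) := by
  apply isOpen_sigmaSet_of_isOpen
  have hc : ∀ c, IsOpen {s : S α | ((s : ℝ × ℝ).1, c) ∈ T} := fun c =>
    (h.isOpen_slice hS c).preimage (f := fun s : S α => (s : ℝ × ℝ).1) (by fun_prop)
  have h1 : IsOpen {s : S α | 0.8 < (s : ℝ × ℝ).2} :=
    isOpen_lt (by fun_prop) (by fun_prop)
  have h2 : IsOpen {s : S α | (s : ℝ × ℝ).2 < -0.8} :=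
    isOpen_lt (by fun_prop) (by fun_prop)
  convert ((hc 1).inter h1).union ((hc (-1)).inter h2) using 1
  ext s
  have hs := (hS.subset_strip s.2).2
  simp only [Set.mem_ofPred_eq, mem_stdNbhd, Set.mem_union, Set.mem_inter_iff, hs.1, hs.2,
    and_true, true_and]

/-- A set of boundary points that is a union of boundary intervals is closed. -/
theorem isClosed_of_component_saturated {A : Type} {S : A → Set (ℝ × ℝ)}
    (hS : ∀ a, IsModelStrip (S a)) {G : Set (Σ a : A, S a)}
    (hG : ∀ z ∈ G, ∃ T, IsBoundaryInterval (S z.1) T ∧ (z.2 : ℝ × ℝ) ∈ T ∧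
      sigmaSet S z.1 T ⊆ G) : IsClosed G := by
  rw [← isOpen_compl_iff, isOpen_iff_forall_mem_open]
  rintro ⟨a, s⟩ hz
  have hs := (hS a).subset_strip s.2
  by_cases hb : (s : ℝ × ℝ).2 = -1 ∨ (s : ℝ × ℝ).2 = 1
  · have hsb : (s : ℝ × ℝ) ∈ stripBoundary (S a) := ⟨s.2, Set.mem_univ _, by simpa using hb⟩
    have hT : IsBoundaryInterval (S a) (connectedComponentIn (stripBoundary (S a)) s) :=
      ⟨s, hsb, rfl⟩
    have hsT := mem_connectedComponentIn hsb
    refine ⟨_, ?_, hT.isOpen_sigmaSet_stdNbhd (hS a), rfl, subset_stdNbhd hT.level hsT⟩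
    rintro ⟨a', w⟩ ⟨rfl, hw⟩ hwG
    obtain ⟨T, hT', hwT, hTG⟩ := hG _ hwG
    have hwc := mem_of_mem_stdNbhd hw (hT'.level _ hwT)
    refine hz (hTG ⟨rfl, ?_⟩)
    rw [hT'.eq_component hwT, ← hT.eq_component hwc]
    exact hsT
  · push Not at hb
    refine ⟨sigmaSet S a (Set.univ ×ˢ Set.Ioo (-1) 1), ?_, ?_, rfl, Set.mem_univ _,
      lt_of_le_of_ne hs.2.1 hb.1.symm, lt_of_le_of_ne hs.2.2 hb.2⟩
    · rintro ⟨a', w⟩ ⟨rfl, hw⟩ hwG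
      obtain ⟨T, hT, hwT, -⟩ := hG _ hwG
      rcases hT.level _ hwT with h | h
      · exact absurd h hw.2.1.ne'
      · exact absurd h hw.2.2.ne
    · exact isOpen_sigmaSet_of_isOpen
        ((isOpen_univ.prod isOpen_Ioo).preimage continuous_subtype_val)

theorem disjoint_sigmaSet_stdNbhd {A : Type} {S : A → Set (ℝ × ℝ)} {α α' : A}
    {T T' : Set (ℝ × ℝ)} (hT : T ⊆ S α)
    (h : Disjoint (sigmaSet S α T) (sigmaSet S α' T')) :
    Disjoint (sigmaSet S α (stdNbhd T)) (sigmaSet S α' (stdNbhd T')) := by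
  rw [Set.disjoint_left]
  rintro ⟨a, w⟩ ⟨rfl, hw⟩ ⟨ha, hw'⟩
  dsimp only at ha
  subst ha
  refine Set.disjoint_left.1 (disjoint_stdNbhd ?_) hw hw'
  rw [Set.disjoint_left] at h ⊢
  exact fun p hp hp' => h (a := ⟨a, p, hT hp⟩) ⟨rfl, hp⟩ ⟨rfl, hp'⟩

namespace StripedAtlas

/-- The preimage `X_β ∪ Y_β` of a seam in the disjoint union of strips. -/
def seamPre (σ : StripedAtlas Z) (b : σ.B) : Set (Σ α : σ.A, σ.S α) :=
  sigmaSet σ.S (σ.XA b) (σ.Xint b) ∪ sigmaSet σ.S (σ.YA b) (σ.Yint b)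

/-- The preimage `nb(X_β) ∪ nb(Y_β)` of a seam neighborhood in the disjoint union of strips. -/
def nbhdPre (σ : StripedAtlas Z) (b : σ.B) : Set (Σ α : σ.A, σ.S α) :=
  sigmaSet σ.S (σ.XA b) (stdNbhd (σ.Xint b)) ∪ sigmaSet σ.S (σ.YA b) (stdNbhd (σ.Yint b))

variable (σ : StripedAtlas Z)

theorem image_seamPre (b : σ.B) : σ.q '' σ.seamPre b = σ.seam b := by
  rw [seamPre, Set.image_union, ← σ.q_X_eq_q_Y, Set.union_self, seam]

theorem image_nbhdPre (b : σ.B) : σ.q '' σ.nbhdPre b = σ.seamNbhd b := by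
  rw [nbhdPre, Set.image_union, seamNbhd]

theorem mem_glued_iff {z : Σ α : σ.A, σ.S α} : z ∈ σ.glued ↔ ∃ b, z ∈ σ.seamPre b := by
  simp [glued, seamPre, exists_or]

theorem preimage_seam_s11 (b : σ.B) : σ.q ⁻¹' σ.seam b = σ.seamPre b := by
  refine subset_antisymm (fun z hz => ?_) ?_
  · have hzg : z ∈ σ.glued := by
      by_contra hzg
      exact Set.disjoint_left.1 (σ.seam_disjoint_rest b) hz ⟨z, hzg, rfl⟩
    obtain ⟨b', hb'⟩ := σ.mem_glued_iff.1 hzg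
    have hz' : σ.q z ∈ σ.seam b' := by
      rw [← image_seamPre]
      exact ⟨z, hb', rfl⟩
    obtain rfl : b = b' := by
      by_contra hne
      exact Set.disjoint_left.1 (σ.seams_disjoint b b' hne) hz hz'
    exact hb'
  · rw [← image_seamPre]
    exact Set.subset_preimage_image _ _

theorem eq_or_mem_seamPre {z w : Σ α : σ.A, σ.S α} (h : σ.q z = σ.q w) :
    z = w ∨ ∃ b, z ∈ σ.seamPre b ∧ w ∈ σ.seamPre b := by
  by_cases hs : ∃ b, σ.q z ∈ σ.seam b
  · obtain ⟨b, hb⟩ := hs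
    refine Or.inr ⟨b, ?_, ?_⟩ <;> rw [← preimage_seam_s11]
    · exact hb
    · rwa [Set.mem_preimage, ← h]
  · have key : ∀ v, σ.q v = σ.q z → v ∉ σ.glued := by
      intro v hv hg
      obtain ⟨b, hb⟩ := σ.mem_glued_iff.1 hg
      rw [← preimage_seam_s11, Set.mem_preimage, hv] at hb
      exact hs ⟨b, hb⟩
    exact Or.inl (σ.injOn (key z rfl) (key w h.symm) h)

theorem seamPre_subset_nbhdPre (b : σ.B) : σ.seamPre b ⊆ σ.nbhdPre b :=
  Set.union_subset_union (fun _ h => ⟨h.1, subset_stdNbhd (σ.X_bdry b).level h.2⟩)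
    (fun _ h => ⟨h.1, subset_stdNbhd (σ.Y_bdry b).level h.2⟩)

theorem disjoint_nbhdPre {b b' : σ.B} (h : b ≠ b') :
    Disjoint (σ.nbhdPre b) (σ.nbhdPre b') := by
  have hX : ∀ c, σ.Xint c ⊆ σ.S (σ.XA c) := fun c p hp => ((σ.X_bdry c).subset hp).1
  have hY : ∀ c, σ.Yint c ⊆ σ.S (σ.YA c) := fun c p hp => ((σ.Y_bdry c).subset hp).1
  rw [nbhdPre, nbhdPre, Set.disjoint_union_left, Set.disjoint_union_right,
    Set.disjoint_union_right]
  exact ⟨⟨disjoint_sigmaSet_stdNbhd (hX b) (σ.disjoint_XX b b' h),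
      disjoint_sigmaSet_stdNbhd (hX b) (σ.disjoint_XY b b')⟩,
    disjoint_sigmaSet_stdNbhd (hY b) (σ.disjoint_XY b' b).symm,
    disjoint_sigmaSet_stdNbhd (hY b) (σ.disjoint_YY b b' h)⟩

theorem preimage_seamNbhd (b : σ.B) : σ.q ⁻¹' σ.seamNbhd b = σ.nbhdPre b := by
  rw [← image_nbhdPre]
  refine subset_antisymm ?_ (Set.subset_preimage_image _ _)
  rintro z ⟨w, hw, hwz⟩
  rcases σ.eq_or_mem_seamPre hwz with rfl | ⟨b', hwb, hzb⟩
  · exact hw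
  · obtain rfl : b = b' := by
      by_contra hne
      exact Set.disjoint_left.1 (σ.disjoint_nbhdPre hne) hw (σ.seamPre_subset_nbhdPre b' hwb)
    exact σ.seamPre_subset_nbhdPre b hzb

theorem isOpen_seamNbhd (b : σ.B) : IsOpen (σ.seamNbhd b) := by
  rw [← σ.isQuotientMap.isOpen_preimage, preimage_seamNbhd]
  exact ((σ.X_bdry b).isOpen_sigmaSet_stdNbhd (σ.modelStrip _)).union
    ((σ.Y_bdry b).isOpen_sigmaSet_stdNbhd (σ.modelStrip _))

theorem seam_subset_seamNbhd (b : σ.B) : σ.seam b ⊆ σ.seamNbhd b := by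
  rw [← image_seamPre, ← image_nbhdPre]
  exact Set.image_mono (σ.seamPre_subset_nbhdPre b)

theorem disjoint_seamNbhd {b b' : σ.B} (h : b ≠ b') :
    Disjoint (σ.seamNbhd b) (σ.seamNbhd b') := by
  refine Disjoint.of_preimage σ.isQuotientMap.surjective ?_
  rw [preimage_seamNbhd, preimage_seamNbhd]
  exact σ.disjoint_nbhdPre h

theorem isClosed_biUnion_seam (C : Set σ.B) : IsClosed (⋃ b ∈ C, σ.seam b) := by
  rw [← σ.isQuotientMap.isClosed_preimage]
  simp only [Set.preimage_iUnion, preimage_seam_s11]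
  refine isClosed_of_component_saturated σ.modelStrip fun z hz => ?_
  simp only [Set.mem_iUnion] at hz
  obtain ⟨b, hb, hz⟩ := hz
  have hsub : σ.seamPre b ⊆ ⋃ b ∈ C, σ.seamPre b := Set.subset_biUnion_of_mem hb
  obtain ⟨a, w⟩ := z
  rcases hz with ⟨h1, h2⟩ | ⟨h1, h2⟩ <;> dsimp only at h1 <;> subst h1
  · exact ⟨_, σ.X_bdry b, h2, Set.subset_union_left.trans hsub⟩
  · exact ⟨_, σ.Y_bdry b, h2, Set.subset_union_right.trans hsub⟩

theorem locallyFinite_seam : LocallyFinite fun b => σ.seam b := by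
  intro x
  by_cases hx : ∃ b, x ∈ σ.seam b
  · obtain ⟨b, hb⟩ := hx
    refine ⟨σ.seamNbhd b, (σ.isOpen_seamNbhd b).mem_nhds (σ.seam_subset_seamNbhd b hb),
      (Set.finite_singleton b).subset ?_⟩
    rintro b' ⟨y, hy, hy'⟩
    by_contra hne
    exact Set.disjoint_left.1 (σ.disjoint_seamNbhd hne) (σ.seam_subset_seamNbhd b' hy) hy'
  · refine ⟨(⋃ b ∈ Set.univ, σ.seam b)ᶜ,
      (σ.isClosed_biUnion_seam Set.univ).isOpen_compl.mem_nhds (by simpa using hx),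
      Set.finite_empty.subset ?_⟩
    rintro b ⟨y, hy, hy'⟩
    exact hy' (Set.mem_biUnion (Set.mem_univ b) hy)

end StripedAtlas

/-- The standard neighborhoods `N_β` of the seams of a striped surface are open sets
containing the respective seams, they are pairwise disjoint, the family of seams is discrete
(hence locally finite) in `Z`, and the union of any collection of seams is closed in `Z`. -/
theorem seamNbhd_properties [T2Space Z] [SecondCountableTopology Z]
    [ChartedSpace (EuclideanHalfSpace 2) Z] (σ : StripedAtlas Z) :
    (∀ b, IsOpen (σ.seamNbhd b) ∧ σ.seam b ⊆ σ.seamNbhd b) ∧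
      (∀ b b', b ≠ b' → Disjoint (σ.seamNbhd b) (σ.seamNbhd b')) ∧
      (∃ U : σ.B → Set Z, (∀ b, IsOpen (U b) ∧ σ.seam b ⊆ U b) ∧
        ∀ b b', b ≠ b' → Disjoint (U b) (U b')) ∧
      LocallyFinite (fun b => σ.seam b) ∧
      (∀ 𝒞 : Set σ.B, IsClosed (⋃ b ∈ 𝒞, σ.seam b)) := by
  exact ⟨fun b => ⟨σ.isOpen_seamNbhd b, σ.seam_subset_seamNbhd b⟩,
    fun _ _ => σ.disjoint_seamNbhd,
    ⟨σ.seamNbhd, fun b => ⟨σ.isOpen_seamNbhd b, σ.seam_subset_seamNbhd b⟩,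
      fun _ _ => σ.disjoint_seamNbhd⟩,
    σ.locallyFinite_seam, σ.isClosed_biUnion_seam⟩
end
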